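/- arXiv:2005.14384 — 5 statements merged into one kernel-verified Lean document; each statement's English description precedes it below -/
import Mathlib

section
/- For every integer r ≥ 3 there exist a constant c = c(r) and n₀ such that for every n ≥ n₀ there is a collection 𝒞 of r-templates of order n satisfying: (i) every rainbow restricted sum-free r-template of order n is a subtemplate of some P ∈ 𝒞; (ii) every P ∈ 𝒞 satisfies RS(P) ≤ n^{-1/3}·s([n]); (iii) |𝒞| ≤ 2^{c·n^{2/3}·(log₂ n)²}. -/
open Finset

/-- The set of restricted Schur triples of `A`: ordered triples `(a, b, c)` of
elements of `A` with `a < b < c` and `a + b = c`. -/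
def restrictedSchurTriples (A : Finset ℕ) : Finset (ℕ × ℕ × ℕ) :=
  (A ×ˢ A ×ˢ A).filter
    (fun t => t.1 < t.2.1 ∧ t.2.1 < t.2.2 ∧ t.1 + t.2.1 = t.2.2)

/-- `s(A)`: the number of restricted Schur triples of `A`. -/
def numST (A : Finset ℕ) : ℕ := (restrictedSchurTriples A).card

/-- `RS(P)`: the number of rainbow restricted Schur triple subtemplates of the
`r`-template `P` of order `n`, i.e. the number of tuples
`((x₁,c₁),(x₂,c₂),(x₃,c₃))` where `(x₁,x₂,x₃)` is a restricted Schur triple in `[n]`,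
`cᵢ ∈ P xᵢ`, and the colors `c₁, c₂, c₃` are pairwise distinct. -/
def RSCount (n r : ℕ) (P : ℕ → Finset (Fin r)) : ℕ :=
  (((restrictedSchurTriples (Finset.Icc 1 n)) ×ˢ
      (Finset.univ ×ˢ Finset.univ ×ˢ Finset.univ : Finset (Fin r × Fin r × Fin r))).filter
    (fun q => q.2.1 ∈ P q.1.1 ∧ q.2.2.1 ∈ P q.1.2.1 ∧ q.2.2.2 ∈ P q.1.2.2 ∧
      q.2.1 ≠ q.2.2.1 ∧ q.2.1 ≠ q.2.2.2 ∧ q.2.2.1 ≠ q.2.2.2)).card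

section Container

variable {α : Type*} (E : α → α → α → Prop) [∀ u v w, Decidable (E u v w)]

/-- Ordered pairs in `C` that form an edge of `E` with some vertex of `T`. -/
def linkPairs (C T : Finset α) : Finset (α × α) :=
  (C ×ˢ C).filter fun p => ∃ t ∈ T, E t p.1 p.2

/-- The vertices of `C` that form an edge of `E` with `u` and some vertex of `T`. -/
def linkNeighbors (C T : Finset α) (u : α) : Finset α :=
  C.filter fun w => ∃ t ∈ T, E t u w

/-- The ordered edges of `E` with all vertices in `C`. -/
def edgeTriples (C : Finset α) : Finset (α × α × α) :=
  (C ×ˢ C ×ˢ C).filter fun t => E t.1 t.2.1 t.2.2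

/-- Ordered pairs in the link of `v` that are not yet in the link of `T`. -/
def newPairs (C T : Finset α) (v : α) : Finset (α × α) :=
  (C ×ˢ C).filter fun p => E v p.1 p.2 ∧ ¬ ∃ t ∈ T, E t p.1 p.2

variable {E}

theorem card_linkPairs_eq_sum (C T : Finset α) :
    (linkPairs E C T).card = ∑ u ∈ C, (linkNeighbors E C T u).card := by
  simp only [linkPairs, linkNeighbors, card_filter, sum_product]

theorem card_linkPairs_le {C T : Finset α} {M : ℕ}
    (h : ∀ u ∈ C, (linkNeighbors E C T u).card ≤ M) :
    (linkPairs E C T).card ≤ C.card * M := by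
  rw [card_linkPairs_eq_sum]
  exact sum_le_card_nsmul _ _ _ h

theorem card_linkNeighbors_le_of_subset {C C' T : Finset α} (hC : C' ⊆ C) (u : α) :
    (linkNeighbors E C' T u).card ≤ (linkNeighbors E C T u).card :=
  card_le_card (filter_subset_filter _ hC)

variable [DecidableEq α]

theorem card_linkPairs_le_add_sdiff (hE : ∀ u v w, E u v w → E u w v) {C C' T : Finset α}
    {M : ℕ} (h : ∀ u ∈ C, (linkNeighbors E C T u).card ≤ M) :
    (linkPairs E C T).card ≤ (linkPairs E C' T).card + 2 * M * (C \ C').card := by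
  set A := ((C \ C') ×ˢ C).filter fun p : α × α => ∃ t ∈ T, E t p.1 p.2
  have hA : A.card ≤ (C \ C').card * M := by
    simp only [A, card_filter, sum_product]
    simp only [← card_filter]
    exact sum_le_card_nsmul _ _ _ fun u hu => h u (mem_sdiff.1 hu).1
  have hsub : linkPairs E C T ⊆ linkPairs E C' T ∪ (A ∪ A.image Prod.swap) := by
    rintro ⟨u, w⟩ h
    simp only [linkPairs, mem_filter, mem_product, mem_union, mem_image, A, mem_sdiff] at h ⊢
    obtain ⟨⟨hu, hw⟩, t, ht, hE'⟩ := h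
    by_cases hu' : u ∈ C'
    · by_cases hw' : w ∈ C'
      · exact Or.inl ⟨⟨hu', hw'⟩, t, ht, hE'⟩
      · exact Or.inr (Or.inr ⟨(w, u), ⟨⟨⟨hw, hw'⟩, hu⟩, t, ht, hE _ _ _ hE'⟩, rfl⟩)
    · exact Or.inr (Or.inl ⟨⟨⟨hu, hu'⟩, hw⟩, t, ht, hE'⟩)
  have h1 := card_le_card hsub
  have h2 := card_union_le (linkPairs E C' T) (A ∪ A.image Prod.swap)
  have h3 := card_union_le A (A.image Prod.swap)
  have h4 : (A.image Prod.swap).card ≤ A.card := card_image_le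
  nlinarith

theorem card_linkPairs_insert (C T : Finset α) (v : α) :
    (linkPairs E C (insert v T)).card = (linkPairs E C T).card + (newPairs E C T v).card := by
  rw [← card_union_of_disjoint]
  · congr 1
    ext p
    simp only [linkPairs, newPairs, mem_filter, mem_union, exists_mem_insert]
    generalize (∃ t ∈ T, E t p.1 p.2) = A
    tauto
  · rw [disjoint_left]
    intro p hp hp'
    exact (mem_filter.1 hp').2.2 (mem_filter.1 hp).2

theorem card_linkNeighbors_insert_le {K : ℕ}
    (hK : ∀ (C : Finset α) u v, (C.filter fun w => E u v w).card ≤ K) (C T : Finset α) (u v : α) :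
    (linkNeighbors E C (insert v T) u).card ≤ (linkNeighbors E C T u).card + K := by
  refine le_trans ?_ (Nat.add_le_add_left (hK C v u) _)
  refine le_trans (card_le_card ?_) (card_union_le _ _)
  intro w hw
  simp only [linkNeighbors, mem_filter, mem_union, exists_mem_insert] at hw ⊢
  exact hw.2.elim (fun h => Or.inr ⟨hw.1, h⟩) fun h => Or.inl ⟨hw.1, h⟩

theorem card_edgeTriples_le {K D d : ℕ} (hE : ∀ u v w, E u v w → E v w u)
    (hK : ∀ (C : Finset α) u v, (C.filter fun w => E u v w).card ≤ K) {C T : Finset α}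
    (hD : ∀ u ∈ C, (linkNeighbors E C T u).card ≤ D) (hd : ∀ v ∈ C, (newPairs E C T v).card ≤ d) :
    (edgeTriples E C).card ≤ C.card * (d + K * D) := by
  set A := (C ×ˢ C ×ˢ C).filter fun t : α × α × α =>
    E t.1 t.2.1 t.2.2 ∧ ¬ ∃ s ∈ T, E s t.2.1 t.2.2
  set B := (linkPairs E C T ×ˢ C).filter fun t : (α × α) × α => E t.1.1 t.1.2 t.2
  have hA : A.card ≤ C.card * d := by
    simp only [A, card_filter]
    rw [sum_product]
    simp only [← card_filter]
    exact sum_le_card_nsmul _ _ _ hd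
  have hB : B.card ≤ (linkPairs E C T).card * K := by
    simp only [B, card_filter]
    rw [sum_product]
    simp only [← card_filter]
    exact sum_le_card_nsmul _ _ _ fun p _ => hK C p.1 p.2
  have hsub : edgeTriples E C ⊆ A ∪ B.image fun t => (t.2, t.1.1, t.1.2) := by
    rintro ⟨v, u, w⟩ h
    simp only [edgeTriples, mem_filter, mem_product, mem_union, mem_image, A, B, linkPairs] at h ⊢
    by_cases hT : ∃ s ∈ T, E s u w
    · exact Or.inr ⟨((u, w), v), ⟨⟨⟨h.1.2, hT⟩, h.1.1⟩, hE _ _ _ h.2⟩, rfl⟩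
    · exact Or.inl ⟨h.1, h.2, hT⟩
  have h1 := card_le_card hsub
  have h2 := card_union_le A (B.image fun t => (t.2, t.1.1, t.1.2))
  have h3 : (B.image fun t => (t.2, t.1.1, t.1.2)).card ≤ B.card := card_image_le
  have h4 := Nat.mul_le_mul_right K (card_linkPairs_le hD)
  nlinarith

theorem succ_pow_succ_add_succ_pow_le {a a' b : ℕ} (ha : a' ≤ a + 1) :
    (a + 1) ^ (b + 1) + (a' + 1) ^ b ≤ (a + 1 + 1) ^ (b + 1) := by
  have h1 : (a' + 1) ^ b ≤ (a + 1 + 1) ^ b := Nat.pow_le_pow_left (by omega) b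
  have h2 : (a + 1) ^ b ≤ (a + 1 + 1) ^ b := Nat.pow_le_pow_left (by omega) b
  rw [pow_succ, pow_succ]
  nlinarith

/-- The Kleitman–Winston style algorithm for a symmetric `3`-uniform hypergraph `E` with codegrees
at most `K`, started at an intermediate container `C` and fingerprint `T`; the number `b` bounds
the number of fingerprint vertices still to be chosen. -/
theorem exists_containers_of_state {K D d : ℕ} (hd : 0 < d)
    (hE₁ : ∀ u v w, E u v w → E v w u) (hE₂ : ∀ u v w, E u v w → E u w v)
    (hK : ∀ (C : Finset α) u v, (C.filter fun w => E u v w).card ≤ K) (s b : ℕ)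
    (C T : Finset α) (hs : C.card + b ≤ s)
    (hM : ∀ u ∈ C, (linkNeighbors E C T u).card ≤ D + K)
    (hb : C.card * (d + 2 * (D + K) * D) ≤ b * (D * d) + D * (linkPairs E C T).card) :
    ∃ F : Finset (Finset α), F.card ≤ (C.card + 1) ^ b ∧
      (∀ I ⊆ C, T ⊆ I → (∀ u ∈ I, ∀ v ∈ I, ∀ w ∈ I, ¬ E u v w) → ∃ Q ∈ F, I ⊆ Q) ∧
      ∀ Q ∈ F, Q ⊆ C ∧ (edgeTriples E Q).card ≤ Q.card * (d + K * D) := by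
  induction s generalizing b C T with
  | zero =>
    obtain rfl : C = ∅ := card_eq_zero.1 (by omega)
    refine ⟨{∅}, by simp, fun I hI _ _ => ⟨∅, by simp, hI⟩, ?_⟩
    simp [edgeTriples]
  | succ s ih =>
    have hb_pos : ∀ v ∈ C, ∃ b', b = b' + 1 := by
      intro v hv
      refine Nat.exists_eq_succ_of_ne_zero ?_
      rintro rfl
      have h1 := Nat.mul_le_mul_left D (card_linkPairs_le hM)
      have h2 : 0 < C.card * d := Nat.mul_pos (card_pos.2 ⟨v, hv⟩) hd
      nlinarith
    -- Both kinds of query remove the queried vertex from the container on a negative answer.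
    have query : ∀ v ∈ C, ∀ b', b = b' + 1 → ∀ C' ⊆ C, ∀ T',
        (∀ I ⊆ C, T ⊆ I → (∀ u ∈ I, ∀ v ∈ I, ∀ w ∈ I, ¬ E u v w) → v ∈ I →
          I ⊆ C' ∧ T' ⊆ I) →
        (∀ u ∈ C', (linkNeighbors E C' T' u).card ≤ D + K) →
        (C'.card * (d + 2 * (D + K) * D) ≤ b' * (D * d) + D * (linkPairs E C' T').card) →
        ∃ F : Finset (Finset α), F.card ≤ (C.card + 1) ^ b ∧
          (∀ I ⊆ C, T ⊆ I → (∀ u ∈ I, ∀ v ∈ I, ∀ w ∈ I, ¬ E u v w) → ∃ Q ∈ F, I ⊆ Q) ∧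
          ∀ Q ∈ F, Q ⊆ C ∧ (edgeTriples E Q).card ≤ Q.card * (d + K * D) := by
      rintro v hv b' rfl C' hC' T' hyes hM' hb'
      have hcard := card_le_card hC'
      have hpos : 0 < C.card := card_pos.2 ⟨v, hv⟩
      have herase : (C.erase v).card + 1 = C.card := card_erase_add_one hv
      have hloss := card_linkPairs_le_add_sdiff (C' := C.erase v) hE₂ hM
      have hone : (C \ C.erase v).card = 1 := by
        rw [card_sdiff_of_subset (erase_subset v C)]; omega
      rw [hone] at hloss
      obtain ⟨F₁, hF₁, hI₁, hQ₁⟩ := ih (b' + 1) (C.erase v) T (by omega)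
        (fun u hu => (card_linkNeighbors_le_of_subset (erase_subset v C) u).trans
          (hM u (mem_of_mem_erase hu)))
        (by
          have := Nat.mul_le_mul_left D hloss
          rw [← herase] at hb
          nlinarith)
      obtain ⟨F₂, hF₂, hI₂, hQ₂⟩ := ih b' C' T' (by omega) hM' hb'
      refine ⟨F₁ ∪ F₂, ?_, ?_, ?_⟩
      · refine (card_union_le _ _).trans ((Nat.add_le_add hF₁ hF₂).trans ?_)
        rw [← herase]
        exact succ_pow_succ_add_succ_pow_le (by omega)
      · intro I hIC hTI hI
        by_cases hvI : v ∈ I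
        · obtain ⟨h1, h2⟩ := hyes I hIC hTI hI hvI
          obtain ⟨Q, hQ, hIQ⟩ := hI₂ I h1 h2 hI
          exact ⟨Q, mem_union_right _ hQ, hIQ⟩
        · obtain ⟨Q, hQ, hIQ⟩ := hI₁ I (subset_erase.2 ⟨hIC, hvI⟩) hTI hI
          exact ⟨Q, mem_union_left _ hQ, hIQ⟩
      · intro Q hQ
        rcases mem_union.1 hQ with hQ | hQ
        · exact ⟨(hQ₁ Q hQ).1.trans (erase_subset v C), (hQ₁ Q hQ).2⟩
        · exact ⟨(hQ₂ Q hQ).1.trans hC', (hQ₂ Q hQ).2⟩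
    by_cases hdeg : ∃ v ∈ C, D ≤ (linkNeighbors E C T v).card
    · obtain ⟨v, hv, hvD⟩ := hdeg
      obtain ⟨b', rfl⟩ := hb_pos v hv
      have hN : linkNeighbors E C T v ⊆ C := filter_subset _ _
      have hsub : C \ linkNeighbors E C T v ⊆ C := sdiff_subset
      refine query v hv b' rfl _ hsub T ?_ ?_ ?_
      · intro I hIC hTI hI hvI
        refine ⟨fun w hw => mem_sdiff.2 ⟨hIC hw, fun hwN => ?_⟩, hTI⟩
        obtain ⟨_, t, ht, htE⟩ := mem_filter.1 hwN
        exact hI t (hTI ht) v hvI w hw htE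
      · exact fun u hu => (card_linkNeighbors_le_of_subset hsub u).trans (hM u (hsub hu))
      · have hloss := card_linkPairs_le_add_sdiff
          (C' := C \ linkNeighbors E C T v) hE₂ hM
        rw [Finset.sdiff_sdiff_eq_self hN] at hloss
        have hcard := card_sdiff_add_card_eq_card hN
        rw [← hcard] at hb
        have h1 := Nat.mul_le_mul_left D hloss
        have h2 := Nat.mul_le_mul_right d hvD
        nlinarith
    · push Not at hdeg
      by_cases hnew : ∃ v ∈ C, d ≤ (newPairs E C T v).card
      · obtain ⟨v, hv, hvd⟩ := hnew
        obtain ⟨b', rfl⟩ := hb_pos v hv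
        refine query v hv b' rfl C subset_rfl (insert v T) ?_ ?_ ?_
        · exact fun I hIC hTI _ hvI => ⟨hIC, insert_subset hvI hTI⟩
        · exact fun u hu => (card_linkNeighbors_insert_le hK C T u v).trans
            (Nat.add_le_add_right (hdeg u hu).le K)
        · rw [card_linkPairs_insert]
          have := Nat.mul_le_mul_left D hvd
          nlinarith
      · push Not at hnew
        refine ⟨{C}, ?_, fun I hI _ _ => ⟨C, mem_singleton_self C, hI⟩, ?_⟩
        · rw [card_singleton]
          exact Nat.one_le_pow _ _ (by omega)
        · intro Q hQ
          obtain rfl := mem_singleton.1 hQ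
          exact ⟨subset_rfl, card_edgeTriples_le hE₁ hK (fun u hu => (hdeg u hu).le)
            fun v hv => (hnew v hv).le⟩

/-- A container theorem for symmetric `3`-uniform hypergraphs with bounded codegrees. -/
theorem exists_containers {K D d b : ℕ} (hd : 0 < d)
    (hE₁ : ∀ u v w, E u v w → E v w u) (hE₂ : ∀ u v w, E u v w → E u w v)
    (hK : ∀ (C : Finset α) u v, (C.filter fun w => E u v w).card ≤ K) (V : Finset α)
    (hb : V.card * (d + 2 * (D + K) * D) ≤ b * (D * d)) :
    ∃ F : Finset (Finset α), F.card ≤ (V.card + 1) ^ b ∧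
      (∀ I ⊆ V, (∀ u ∈ I, ∀ v ∈ I, ∀ w ∈ I, ¬ E u v w) → ∃ Q ∈ F, I ⊆ Q) ∧
      ∀ Q ∈ F, (edgeTriples E Q).card ≤ V.card * (d + K * D) := by
  obtain ⟨F, hF, hI, hQ⟩ := exists_containers_of_state hd hE₁ hE₂ hK (V.card + b) b V ∅ le_rfl
    (by simp [linkNeighbors]) (by simpa [linkPairs] using hb)
  exact ⟨F, hF, fun I hIV => hI I hIV (empty_subset I), fun Q hQF =>
    (hQ Q hQF).2.trans (Nat.mul_le_mul_right _ (card_le_card (hQ Q hQF).1))⟩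

end Container

/-- The symmetric hypergraph of rainbow restricted Schur triples of coloured integers. -/
def RainbowSchur {r : ℕ} (u v w : ℕ × Fin r) : Prop :=
  (u.1 ≠ v.1 ∧ u.1 ≠ w.1 ∧ v.1 ≠ w.1) ∧ (u.2 ≠ v.2 ∧ u.2 ≠ w.2 ∧ v.2 ≠ w.2) ∧
    (u.1 + v.1 = w.1 ∨ u.1 + w.1 = v.1 ∨ v.1 + w.1 = u.1)

instance {r : ℕ} (u v w : ℕ × Fin r) : Decidable (RainbowSchur u v w) := by
  unfold RainbowSchur; infer_instance

namespace RainbowSchur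

variable {r : ℕ}

theorem rotate {u v w : ℕ × Fin r} (h : RainbowSchur u v w) : RainbowSchur v w u := by
  obtain ⟨⟨h1, h2, h3⟩, ⟨h4, h5, h6⟩, h7⟩ := h
  exact ⟨⟨h3, h1.symm, h2.symm⟩, ⟨h6, h4.symm, h5.symm⟩, by omega⟩

theorem swap_right {u v w : ℕ × Fin r} (h : RainbowSchur u v w) : RainbowSchur u w v := by
  obtain ⟨⟨h1, h2, h3⟩, ⟨h4, h5, h6⟩, h7⟩ := h
  exact ⟨⟨h2, h1, h3.symm⟩, ⟨h5, h4, h6.symm⟩, by omega⟩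

theorem card_filter_le (C : Finset (ℕ × Fin r)) (u v : ℕ × Fin r) :
    (C.filter fun w => RainbowSchur u v w).card ≤ 3 * r := by
  have hsub : (C.filter fun w => RainbowSchur u v w) ⊆
      ({u.1 + v.1, v.1 - u.1, u.1 - v.1} : Finset ℕ) ×ˢ (univ : Finset (Fin r)) := by
    intro w hw
    obtain ⟨_, _, _, h⟩ := mem_filter.1 hw
    simp only [mem_product, mem_insert, mem_singleton, mem_univ, and_true]
    omega
  refine (card_le_card hsub).trans ?_
  rw [card_product, card_univ, Fintype.card_fin]
  exact Nat.mul_le_mul_right r card_le_three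

end RainbowSchur

theorem mem_restrictedSchurTriples_Icc {n a b c : ℕ} :
    (a, b, c) ∈ restrictedSchurTriples (Icc 1 n) ↔ 1 ≤ a ∧ a < b ∧ a + b = c ∧ c ≤ n := by
  simp only [restrictedSchurTriples, mem_filter, mem_product, mem_Icc]
  omega

theorem RSCount_le_card_edgeTriples (n r : ℕ) (Q : Finset (ℕ × Fin r)) :
    RSCount n r (fun x => univ.filter fun c => (x, c) ∈ Q) ≤
      (edgeTriples RainbowSchur Q).card := by
  refine card_le_card_of_injOn
    (fun q => ((q.1.1, q.2.1), (q.1.2.1, q.2.2.1), (q.1.2.2, q.2.2.2))) ?_ ?_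
  · rintro ⟨⟨x, y, z⟩, c₁, c₂, c₃⟩ h
    simp only [coe_filter, Set.mem_ofPred_eq, mem_product, mem_restrictedSchurTriples_Icc,
      mem_filter, mem_univ, true_and, and_true] at h
    simp only [edgeTriples, mem_coe, mem_filter, mem_product]
    obtain ⟨hS, h1, h2, h3, h4, h5, h6⟩ := h
    exact ⟨⟨h1, h2, h3⟩, by omega, ⟨h4, h5, h6⟩, by omega⟩
  · rintro ⟨⟨x, y, z⟩, c₁, c₂, c₃⟩ _ ⟨⟨x', y', z'⟩, c₁', c₂', c₃'⟩ _ h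
    simp only [Prod.mk.injEq] at h ⊢
    tauto

theorem not_rainbowSchur_of_RSCount_eq_zero {n r : ℕ} {P : ℕ → Finset (Fin r)}
    (hP : RSCount n r P = 0) {u v w : ℕ × Fin r} (hu : u.1 ∈ Icc 1 n ∧ u.2 ∈ P u.1)
    (hv : v.1 ∈ Icc 1 n ∧ v.2 ∈ P v.1) (hw : w.1 ∈ Icc 1 n ∧ w.2 ∈ P w.1) :
    ¬ RainbowSchur u v w := by
  have key : ∀ u v w : ℕ × Fin r, u.1 ∈ Icc 1 n ∧ u.2 ∈ P u.1 → v.1 ∈ Icc 1 n ∧ v.2 ∈ P v.1 →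
      w.1 ∈ Icc 1 n ∧ w.2 ∈ P w.1 → u.1 < v.1 → u.1 + v.1 = w.1 → ¬ RainbowSchur u v w := by
    intro u v w hu hv hw hlt hsum h
    have hmem := (filter_eq_empty_iff.1 (card_eq_zero.1 hP))
      (x := ((u.1, v.1, w.1), (u.2, v.2, w.2)))
    simp only [mem_product, mem_univ, and_true, mem_restrictedSchurTriples_Icc] at hmem
    have hu1 := mem_Icc.1 hu.1
    have hw1 := mem_Icc.1 hw.1
    exact hmem ⟨hu1.1, hlt, hsum, hw1.2⟩ ⟨hu.2, hv.2, hw.2, h.2.1⟩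
  intro h
  obtain ⟨⟨h1, h2, h3⟩, _, h7⟩ := id h
  rcases h7 with h7 | h7 | h7
  · rcases lt_or_gt_of_ne h1 with hlt | hlt
    · exact key u v w hu hv hw hlt h7 h
    · exact key v u w hv hu hw hlt (by omega) h.rotate.swap_right
  · rcases lt_or_gt_of_ne h2 with hlt | hlt
    · exact key u w v hu hw hv hlt h7 h.swap_right
    · exact key w u v hw hu hv hlt (by omega) h.rotate.rotate
  · rcases lt_or_gt_of_ne h3 with hlt | hlt
    · exact key v w u hv hw hu hlt h7 h.rotate
    · exact key w v u hw hv hu hlt (by omega) h.rotate.rotate.swap_right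

theorem sq_div_three_le_numST (n : ℕ) : (n / 3) ^ 2 ≤ numST (Icc 1 n) := by
  have : (Icc 1 (n / 3) ×ˢ Icc (n / 3 + 1) (2 * (n / 3))).card ≤ numST (Icc 1 n) := by
    refine card_le_card_of_injOn (fun p => (p.1, p.2, p.1 + p.2)) ?_ ?_
    · rintro ⟨a, b⟩ h
      simp only [coe_product, Set.mem_prod, mem_coe, mem_Icc] at h
      rw [mem_coe, mem_restrictedSchurTriples_Icc]
      omega
    · rintro ⟨a, b⟩ _ ⟨a', b'⟩ _ h
      simp only [Prod.mk.injEq] at h ⊢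
      tauto
  refine le_trans (le_of_eq ?_) this
  rw [card_product, Nat.card_Icc, Nat.card_Icc, sq]
  congr 1
  omega

theorem sq_le_mul_numST {n : ℕ} (hn : 9 ≤ n) : n ^ 2 ≤ 16 * numST (Icc 1 n) := by
  have h1 : n ≤ 4 * (n / 3) := by omega
  have h2 := sq_div_three_le_numST n
  nlinarith [Nat.pow_le_pow_left h1 2]

/-- Containers for rainbow restricted sum-free templates, in terms of `m ≈ n ^ (1 / 3)`. -/
theorem exists_template_containers {r m n : ℕ} (hr : 0 < r) (hm : 96 * r ^ 2 ≤ m)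
    (hn : n ≤ 8 * m ^ 3) :
    ∃ 𝒞 : Set (ℕ → Finset (Fin r)), 𝒞.Finite ∧
      (∀ P : ℕ → Finset (Fin r), RSCount n r P = 0 →
        ∃ Q ∈ 𝒞, ∀ x ∈ Icc 1 n, P x ⊆ Q x) ∧
      (∀ P ∈ 𝒞, 16 * RSCount n r P ≤ n * m ^ 2) ∧
      Nat.card 𝒞 ≤ (n * r + 1) ^ (8 * r * (1 + 256 * r) * m ^ 2) := by
  have hr2 : r ≤ r ^ 2 := by nlinarith
  have hmpos : 0 < m := by omega
  set d := m ^ 2 / (32 * r)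
  have hd1 : 32 * r * d ≤ m ^ 2 := Nat.mul_div_le _ _
  have hd2 : m ^ 2 < 32 * r * (d + 1) := Nat.lt_mul_div_succ _ (by omega)
  have hd : 0 < d := Nat.div_pos (by nlinarith) (by omega)
  have hd3 : m ^ 2 ≤ 64 * r * d := by nlinarith
  have hV : (Icc 1 n ×ˢ (univ : Finset (Fin r))).card = n * r := by simp
  have hb : (Icc 1 n ×ˢ (univ : Finset (Fin r))).card * (d + 2 * (m + 3 * r) * m) ≤
      8 * r * (1 + 256 * r) * m ^ 2 * (m * d) := by
    rw [hV]
    have h1 : d + 2 * (m + 3 * r) * m ≤ (1 + 256 * r) * d := by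
      have h2 : (m + 3 * r) * m ≤ 2 * m ^ 2 := by nlinarith
      linarith
    calc n * r * (d + 2 * (m + 3 * r) * m)
        ≤ 8 * m ^ 3 * r * ((1 + 256 * r) * d) := by gcongr
      _ = _ := by ring
  obtain ⟨F, hF, hI, hQ⟩ := exists_containers (E := RainbowSchur (r := r)) hd
    (fun _ _ _ => RainbowSchur.rotate) (fun _ _ _ => RainbowSchur.swap_right)
    RainbowSchur.card_filter_le _ hb
  rw [hV] at hF hQ
  refine ⟨(fun Q x => univ.filter fun c => (x, c) ∈ Q) '' (F : Set (Finset (ℕ × Fin r))),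
    F.finite_toSet.image _, ?_, ?_, ?_⟩
  · intro P hP
    have hmem : ∀ u ∈ (Icc 1 n ×ˢ (univ : Finset (Fin r))).filter (fun u => u.2 ∈ P u.1),
        u.1 ∈ Icc 1 n ∧ u.2 ∈ P u.1 := by
      intro u hu
      rw [mem_filter, mem_product] at hu
      exact ⟨hu.1.1, hu.2⟩
    obtain ⟨Q, hQF, hIQ⟩ := hI ((Icc 1 n ×ˢ univ).filter fun u => u.2 ∈ P u.1)
      (filter_subset _ _) (by
        intro u hu v hv w hw
        exact not_rainbowSchur_of_RSCount_eq_zero hP (hmem u hu) (hmem v hv) (hmem w hw))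
    refine ⟨_, Set.mem_image_of_mem _ hQF, fun x hx c hc => ?_⟩
    rw [mem_filter]
    exact ⟨mem_univ c, hIQ (mem_filter.2 ⟨mem_product.2 ⟨hx, mem_univ c⟩, hc⟩)⟩
  · rintro _ ⟨Q, hQF, rfl⟩
    have h1 := (RSCount_le_card_edgeTriples n r Q).trans (hQ Q hQF)
    have h2 : 16 * (r * (d + 3 * r * m)) ≤ m ^ 2 := by
      have h3 := Nat.mul_le_mul_right m hm
      linarith
    calc 16 * RSCount n r _ ≤ 16 * (n * r * (d + 3 * r * m)) := Nat.mul_le_mul_left 16 h1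
      _ = n * (16 * (r * (d + 3 * r * m))) := by ring
      _ ≤ n * m ^ 2 := Nat.mul_le_mul_left n h2
  · refine le_trans ?_ hF
    refine (Nat.card_image_le F.finite_toSet).trans ?_
    simp

theorem stmt_9 (r : ℕ) (hr : 3 ≤ r) :
    ∃ c : ℝ, 0 < c ∧ ∃ n₀ : ℕ, ∀ n : ℕ, n₀ ≤ n →
      ∃ 𝒞 : Set (ℕ → Finset (Fin r)), 𝒞.Finite ∧
        (∀ P : ℕ → Finset (Fin r), RSCount n r P = 0 →
          ∃ Q ∈ 𝒞, ∀ x ∈ Finset.Icc 1 n, P x ⊆ Q x) ∧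
        (∀ P ∈ 𝒞, (RSCount n r P : ℝ) ≤
          (n : ℝ) ^ (-(1 : ℝ) / 3) * (numST (Finset.Icc 1 n) : ℝ)) ∧
        (Nat.card 𝒞 : ℝ) ≤
          (2 : ℝ) ^ (c * (n : ℝ) ^ ((2 : ℝ) / 3) * (Real.logb 2 n) ^ 2) := by
  set c₀ := 8 * r * (1 + 256 * r)
  refine ⟨2 * c₀, by positivity, (96 * r ^ 2) ^ 3, fun n hn => ?_⟩
  have hrn : r + 9 ≤ n := by
    have h1 : 96 * r ^ 2 ≤ (96 * r ^ 2) ^ 3 := Nat.le_self_pow (by norm_num) _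
    nlinarith
  have hnpos : (0 : ℝ) < n := by exact_mod_cast (by omega : 0 < n)
  set t : ℝ := (n : ℝ) ^ ((1 : ℝ) / 3)
  have htpos : 0 < t := Real.rpow_pos_of_pos hnpos _
  have ht3 : t ^ 3 = n := by
    rw [← Real.rpow_natCast, ← Real.rpow_mul hnpos.le]; norm_num
  have ht2 : (n : ℝ) ^ ((2 : ℝ) / 3) = t ^ 2 := by
    rw [← Real.rpow_natCast, ← Real.rpow_mul hnpos.le]; norm_num
  have htinv : (n : ℝ) ^ (-(1 : ℝ) / 3) = t⁻¹ := by
    rw [← Real.rpow_neg hnpos.le]; norm_num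
  set m := ⌊t⌋₊
  have hmt : (m : ℝ) ≤ t := Nat.floor_le htpos.le
  have htm : t < m + 1 := Nat.lt_floor_add_one t
  have hm : 96 * r ^ 2 ≤ m := by
    refine Nat.le_floor ?_
    refine le_of_pow_le_pow_left₀ (n := 3) (by norm_num) htpos.le ?_
    rw [ht3]
    exact_mod_cast hn
  have hm1 : 1 ≤ m := by nlinarith
  have hn8 : n ≤ 8 * m ^ 3 := by
    have h1 : t ≤ 2 * m := by
      have : (1 : ℝ) ≤ m := by exact_mod_cast hm1
      linarith
    have h2 : (n : ℝ) ≤ 8 * (m : ℝ) ^ 3 := by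
      rw [← ht3]
      calc t ^ 3 ≤ (2 * (m : ℝ)) ^ 3 := by gcongr
        _ = _ := by ring
    exact_mod_cast h2
  obtain ⟨𝒞, hfin, hcov, hRS, hcard⟩ := exists_template_containers (by omega) hm hn8
  refine ⟨𝒞, hfin, hcov, fun P hP => ?_, ?_⟩
  · have h1 : (16 : ℝ) * RSCount n r P ≤ n * m ^ 2 := by exact_mod_cast hRS P hP
    have h2 : (n : ℝ) ^ 2 ≤ 16 * numST (Icc 1 n) := by
      exact_mod_cast sq_le_mul_numST (by omega : 9 ≤ n)
    have h3 : (n : ℝ) * m ^ 2 ≤ n * t ^ 2 := by gcongr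
    rw [htinv, inv_mul_eq_div, le_div_iff₀ htpos]
    have h4 : (n : ℝ) * t ^ 2 * t = n ^ 2 := by rw [← ht3]; ring
    have h5 := mul_le_mul_of_nonneg_right (h1.trans h3) htpos.le
    linarith
  · have hbase : n * r + 1 ≤ n ^ 2 := by nlinarith
    have hlog : 1 ≤ Real.logb 2 n := by
      rw [Real.le_logb_iff_rpow_le (by norm_num) hnpos, Real.rpow_one]
      exact_mod_cast (by omega : 2 ≤ n)
    have h1 : (Nat.card 𝒞 : ℝ) ≤ (n : ℝ) ^ (2 * (c₀ * m ^ 2)) := by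
      rw [pow_mul]
      exact_mod_cast hcard.trans (Nat.pow_le_pow_left hbase _)
    refine h1.trans ?_
    have h2 : (n : ℝ) ^ (2 * (c₀ * m ^ 2)) =
        (2 : ℝ) ^ (Real.logb 2 n * (2 * (c₀ * m ^ 2) : ℕ)) := by
      rw [Real.rpow_mul (by norm_num), Real.rpow_logb (by norm_num) (by norm_num) hnpos,
        Real.rpow_natCast]
    rw [h2, ht2]
    refine Real.rpow_le_rpow_of_exponent_le (by norm_num) ?_
    push_cast
    calc Real.logb 2 n * (2 * (c₀ * (m : ℝ) ^ 2))
        = 2 * c₀ * (m : ℝ) ^ 2 * Real.logb 2 n := by ring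
      _ ≤ 2 * c₀ * t ^ 2 * Real.logb 2 n ^ 2 := by
        gcongr
        nlinarith
end

section
/- Let r ≥ 3 be an integer, n sufficiently large, δ = 1/(24·log₂ n), and A ⊆ [n] with |A| = (1 - ξ)n where 0 ≤ ξ ≤ r^{-3}. For two colors i, j ∈ [r], let 𝒫(i,j) be the set of good r-templates P of A such that at least (1 - 2δ)n elements of A have palette exactly {i,j}. Then g(𝒫(i,j), A) ≤ 2^{|A|}·(1 + 2^{-n/12}). -/
open Finset

/-- `P` is a good `r`-template of `A` (inside `[n]`). -/
def GoodTemplate (n r : ℕ) (A : Finset ℕ) (P : ℕ → Finset (Fin r)) : Prop :=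
  (∀ i ∈ A, (P i).Nonempty) ∧
  (RSCount n r P : ℝ) ≤ (n : ℝ) ^ (-(1 : ℝ) / 3) * (numST (Finset.Icc 1 n) : ℝ)

/-- The elements `z` of `A` outside `T` whose color is forced by the color of the smaller element
`|z - x|` of `A`, once `x` has a third color and `T` collects all elements of a third color. -/
def forcedSet (A : Finset ℕ) (T : Finset ↥A) (x : ℕ) : Finset ↥A :=
  Finset.univ.filter fun z =>
    z ∉ T ∧ (z : ℕ) ≠ x ∧ x < 2 * (z : ℕ) ∧
      ∃ y : ↥A, y ∉ T ∧ (y : ℕ) = ((z : ℕ) - x) + (x - (z : ℕ))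

lemma le_card_forcedSet {n : ℕ} {A : Finset ℕ} (hA : A ⊆ Finset.Icc 1 n) (T : Finset ↥A)
    {x : ℕ} (hx : x ∈ A) :
    n + 6 * A.card ≤ 2 * (forcedSet A T x).card + 6 * n + 6 * T.card + 2 := by
  classical
  set U : Finset ℕ := Tᶜ.map (Function.Embedding.subtype _) with hU
  have hUA : U ⊆ A := by
    intro z hz
    obtain ⟨w, -, rfl⟩ := Finset.mem_map.1 hz
    exact w.2
  set N : Finset ℕ := Finset.Icc 1 n \ U with hN
  have hUcard : U.card + T.card = A.card := by
    rw [hU, Finset.card_map, Finset.card_compl, Fintype.card_coe]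
    have := Finset.card_le_univ T
    rw [Fintype.card_coe] at this
    omega
  have hNcard : N.card + U.card = n := by
    have := Finset.card_sdiff_add_card_eq_card (hUA.trans hA)
    simpa using this
  have hxn := Finset.mem_Icc.1 (hA hx)
  have hcover : (Finset.Ioc (x / 2) n).erase x ⊆
      (forcedSet A T x).map (Function.Embedding.subtype _) ∪
        (N ∪ (N.image (fun w => x + w) ∪ N.image (fun w => x - w))) := by
    intro z hz
    obtain ⟨hzx, hz⟩ := Finset.mem_erase.1 hz
    obtain ⟨hz1, hz2⟩ := Finset.mem_Ioc.1 hz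
    by_cases hzN : z ∈ N
    · simp [hzN]
    have hzU : z ∈ U := by
      by_contra h
      exact hzN (Finset.mem_sdiff.2 ⟨Finset.mem_Icc.2 ⟨by omega, hz2⟩, h⟩)
    by_cases hpN : (z - x) + (x - z) ∈ N
    · refine Finset.mem_union_right _ (Finset.mem_union_right _ ?_)
      rcases lt_or_gt_of_ne hzx with h | h
      · exact Finset.mem_union_right _ (Finset.mem_image.2 ⟨_, hpN, by omega⟩)
      · exact Finset.mem_union_left _ (Finset.mem_image.2 ⟨_, hpN, by omega⟩)
    have hpU : (z - x) + (x - z) ∈ U := by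
      by_contra h
      exact hpN (Finset.mem_sdiff.2 ⟨Finset.mem_Icc.2 ⟨by omega, by omega⟩, h⟩)
    refine Finset.mem_union_left _ ?_
    obtain ⟨w, hw, rfl⟩ := Finset.mem_map.1 hzU
    obtain ⟨y, hy, hyw⟩ := Finset.mem_map.1 hpU
    refine Finset.mem_map.2 ⟨w, ?_, rfl⟩
    simp only [Function.Embedding.subtype_apply] at *
    simp only [forcedSet, Finset.mem_filter, Finset.mem_univ, true_and]
    exact ⟨by simpa using hw, hzx, by omega, y, by simpa using hy, hyw⟩
  have h1 := Finset.card_le_card hcover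
  have h2 := Finset.card_union_le ((forcedSet A T x).map (Function.Embedding.subtype _))
    (N ∪ (N.image (fun w => x + w) ∪ N.image (fun w => x - w)))
  have h3 := Finset.card_union_le N (N.image (fun w => x + w) ∪ N.image (fun w => x - w))
  have h4 := Finset.card_union_le (N.image (fun w => x + w)) (N.image (fun w => x - w))
  have h5 : (N.image (fun w => x + w)).card ≤ N.card := Finset.card_image_le
  have h6 : (N.image (fun w => x - w)).card ≤ N.card := Finset.card_image_le
  rw [Finset.card_map] at h2
  have h7 := Finset.pred_card_le_card_erase (s := Finset.Ioc (x / 2) n) (a := x)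
  rw [Nat.card_Ioc] at h7
  omega

/-- `f` has no rainbow Schur triple. -/
def RainbowSumFree {A : Finset ℕ} {r : ℕ} (f : ↥A → Fin r) : Prop :=
  ∀ x y z : ↥A, (x : ℕ) + (y : ℕ) = (z : ℕ) → ¬(f x ≠ f y ∧ f x ≠ f z ∧ f y ≠ f z)

/-- The elements receiving a color other than `i` and `j`. -/
def thirdColorSet {A : Finset ℕ} {r : ℕ} (i j : Fin r) (f : ↥A → Fin r) : Finset ↥A :=
  Finset.univ.filter fun x => f x ≠ i ∧ f x ≠ j

lemma mem_thirdColorSet {A : Finset ℕ} {r : ℕ} {i j : Fin r} {f : ↥A → Fin r} {x : ↥A} :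
    x ∈ thirdColorSet i j f ↔ f x ≠ i ∧ f x ≠ j := by
  simp [thirdColorSet]

lemma RainbowSumFree.eq_of_thirdColor {A : Finset ℕ} {r : ℕ} {i j : Fin r} {f : ↥A → Fin r}
    (hf : RainbowSumFree f) {x y z : ↥A} (hx : x ∈ thirdColorSet i j f)
    (hy : y ∉ thirdColorSet i j f) (hz : z ∉ thirdColorSet i j f) (hzx : (z : ℕ) ≠ x)
    (hyz : (y : ℕ) = ((z : ℕ) - x) + (x - (z : ℕ))) : f z = f y := by
  rw [mem_thirdColorSet] at hx hy hz
  by_contra hne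
  rcases lt_or_gt_of_ne hzx with h | h
  · exact hf y z x (by omega) (by grind)
  · exact hf x y z (by omega) (by grind)

open Classical in
lemma card_thirdColorSet_eq_le {A : Finset ℕ} (hA : 0 ∉ A) {r : ℕ} {i j : Fin r} (hij : i ≠ j)
    (T : Finset ↥A) {x : ↥A} (hx : x ∈ T) :
    (Finset.univ.filter fun f : ↥A → Fin r =>
      RainbowSumFree f ∧ thirdColorSet i j f = T).card * 2 ^ (forcedSet A T x).card
        ≤ r ^ T.card * 2 ^ A.card := by
  set D := forcedSet A T x with hD
  have hDT : Disjoint D T := by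
    rw [Finset.disjoint_left]
    intro z hz
    exact (Finset.mem_filter.1 hz).2.1
  let C : ↥A → Finset (Fin r) := fun z => if z ∈ D then {i} else if z ∈ T then univ else {i, j}
  have hinj : (Finset.univ.filter fun f : ↥A → Fin r =>
      RainbowSumFree f ∧ thirdColorSet i j f = T).card ≤ (Fintype.piFinset C).card := by
    refine Finset.card_le_card_of_injOn (fun f z => if z ∈ D then i else f z) ?_ ?_
    · intro f hf
      obtain ⟨-, -, hfT⟩ := Finset.mem_filter.1 hf
      refine Fintype.mem_piFinset.2 fun z => ?_
      by_cases hzD : z ∈ D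
      · simp [C, hzD]
      by_cases hzT : z ∈ T
      · simp [C, hzD, hzT]
      · have h := hzT
        rw [← hfT, mem_thirdColorSet] at h
        simp only [C, hzD, hzT, if_false, Finset.mem_insert, Finset.mem_singleton]
        tauto
    · intro f hf g hg hfg
      obtain ⟨-, hf, hfT⟩ := Finset.mem_filter.1 hf
      obtain ⟨-, hg, hgT⟩ := Finset.mem_filter.1 hg
      have key : ∀ m : ℕ, ∀ z : ↥A, (z : ℕ) = m → f z = g z := by
        intro m
        induction m using Nat.strong_induction_on with
        | _ m ih =>
          intro z hzm
          by_cases hzD : z ∈ D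
          · obtain ⟨-, hzT, hzx, h2, y, hyT, hyz⟩ := Finset.mem_filter.1 hzD
            have hx0 : (x : ℕ) ≠ 0 := fun h => hA (h ▸ x.2)
            rw [hf.eq_of_thirdColor (hfT ▸ hx) (hfT ▸ hyT) (hfT ▸ hzT) hzx hyz,
              hg.eq_of_thirdColor (hgT ▸ hx) (hgT ▸ hyT) (hgT ▸ hzT) hzx hyz]
            exact ih y (by omega) y rfl
          · simpa [hzD] using congrFun hfg z
      exact funext fun z => key z z rfl
  have hprod : (Fintype.piFinset C).card * 2 ^ D.card ≤ r ^ T.card * 2 ^ A.card := by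
    rw [Fintype.card_piFinset]
    have e1 : (2 : ℕ) ^ D.card = ∏ z : ↥A, if z ∈ D then 2 else 1 := by
      rw [Finset.prod_ite_mem, Finset.univ_inter, Finset.prod_const]
    have e2 : r ^ T.card = ∏ z : ↥A, if z ∈ T then r else 1 := by
      rw [Finset.prod_ite_mem, Finset.univ_inter, Finset.prod_const]
    have e3 : (2 : ℕ) ^ A.card = ∏ z : ↥A, 2 := by simp
    rw [e1, e2, e3, ← Finset.prod_mul_distrib, ← Finset.prod_mul_distrib]
    refine Finset.prod_le_prod' fun z _ => ?_
    by_cases hzD : z ∈ D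
    · have hzT : z ∉ T := Finset.disjoint_left.1 hDT hzD
      simp [C, hzD, hzT]
    · by_cases hzT : z ∈ T
      · simp only [C, hzD, hzT, if_true, if_false, Finset.card_univ, Fintype.card_fin]
        omega
      · simp [C, hzD, hzT, Finset.card_pair hij]
  exact (Nat.mul_le_mul_right _ hinj).trans hprod

lemma card_filter_card_le_le {α : Type*} [Fintype α] {n k : ℕ} (hn : 0 < n)
    (hα : Fintype.card α ≤ n) :
    (Finset.univ.filter fun T : Finset α => T.card ≤ k).card ≤ (k + 1) * n ^ k := by
  classical
  have hsub : (Finset.univ.filter fun T : Finset α => T.card ≤ k) ⊆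
      (Finset.range (k + 1)).biUnion fun t => Finset.univ.powersetCard t := by
    intro T hT
    have := (Finset.mem_filter.1 hT).2
    simp only [Finset.mem_biUnion, Finset.mem_range, Finset.mem_powersetCard]
    exact ⟨T.card, by omega, Finset.subset_univ _, rfl⟩
  refine (Finset.card_le_card hsub).trans (Finset.card_biUnion_le.trans ?_)
  have hb : ∀ t ∈ Finset.range (k + 1),
      ((Finset.univ : Finset α).powersetCard t).card ≤ n ^ k := by
    intro t ht
    rw [Finset.card_powersetCard, Finset.card_univ]
    calc (Fintype.card α).choose t ≤ (Fintype.card α) ^ t := Nat.choose_le_pow _ _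
      _ ≤ n ^ t := Nat.pow_le_pow_left hα t
      _ ≤ n ^ k := Nat.pow_le_pow_right hn (by have := Finset.mem_range.1 ht; omega)
  simpa using Finset.sum_le_card_nsmul _ _ _ hb

lemma thirdColor_exponent_bound {n r k : ℕ} {L R ξ : ℝ} (hn : 100 ≤ n)
    (hL : 4 + R ≤ L) (hk : (k : ℝ) * (12 * L) ≤ n) (hr : 3 ≤ r) (hξ : ξ ≤ ((r : ℝ) ^ 3)⁻¹) :
    k + k * L + k * R - (n / 2 - 1 - 3 * (ξ * n + k)) ≤ -(n : ℝ) / 12 := by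
  have hn' : (100 : ℝ) ≤ n := by exact_mod_cast hn
  have hr' : (3 : ℝ) ≤ r := by exact_mod_cast hr
  have hξ' : ξ ≤ 1 / 27 := by
    refine hξ.trans ?_
    rw [one_div]
    refine inv_anti₀ (by norm_num) ?_
    calc (27 : ℝ) = 3 ^ 3 := by norm_num
      _ ≤ (r : ℝ) ^ 3 := by gcongr
  have h1 : ξ * n ≤ 1 / 27 * n := by gcongr
  have h2 : (k : ℝ) * (4 + R) ≤ k * L := by gcongr
  nlinarith

open Classical in
lemma card_rainbowSumFree_thirdColor_le {n r k : ℕ} {A : Finset ℕ} {L : ℝ}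
    (hr : 3 ≤ r) (hn : 100 + 16 * r ≤ n) (hA : A ⊆ Finset.Icc 1 n) {ξ : ℝ}
    (hξ : ξ ≤ ((r : ℝ) ^ 3)⁻¹) (hcard : (A.card : ℝ) = (1 - ξ) * n) (hL : L = Real.logb 2 n)
    (hk : (k : ℝ) * (12 * L) ≤ n) {i j : Fin r} (hij : i ≠ j) :
    ((Finset.univ.filter fun f : ↥A → Fin r => RainbowSumFree f ∧
      (thirdColorSet i j f).Nonempty ∧ (thirdColorSet i j f).card ≤ k).card : ℝ)
        ≤ 2 ^ A.card * (2 : ℝ) ^ (-(n : ℝ) / 12) := by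
  set E : ℝ := n / 2 - 1 - 3 * (ξ * n + k) with hE
  have hr0 : (0 : ℝ) < r := by exact_mod_cast (by omega : 0 < r)
  have hn0 : (0 : ℝ) < n := by exact_mod_cast (by omega : 0 < n)
  have hnpow : (2 : ℝ) ^ L = n := by
    rw [hL]; exact Real.rpow_logb (by norm_num) (by norm_num) hn0
  have hrpow : (2 : ℝ) ^ Real.logb 2 r = r :=
    Real.rpow_logb (by norm_num) (by norm_num) hr0
  have hRL : 4 + Real.logb 2 r ≤ L := by
    have h16 : Real.logb 2 16 = 4 := by
      rw [show (16 : ℝ) = 2 ^ (4 : ℝ) by norm_num]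
      exact Real.logb_rpow (by norm_num) (by norm_num)
    rw [← h16, ← Real.logb_mul (by norm_num) hr0.ne', hL]
    refine Real.logb_le_logb_of_le (by norm_num) (by positivity) ?_
    exact_mod_cast (by omega : 16 * r ≤ n)
  have hfiber : ∀ T : Finset ↥A, T.Nonempty → T.card ≤ k →
      ((Finset.univ.filter fun f : ↥A → Fin r =>
        RainbowSumFree f ∧ thirdColorSet i j f = T).card : ℝ)
          ≤ r ^ k * 2 ^ A.card * (2 : ℝ) ^ (-E) := by
    rintro T ⟨x, hx⟩ hTk
    have h0 : 0 ∉ A := fun h => by simpa using hA h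
    have h1 := card_thirdColorSet_eq_le h0 hij T hx
    have h2 := le_card_forcedSet hA T x.2
    have h2' : (n : ℝ) + 6 * A.card ≤ 2 * (forcedSet A T x).card + 6 * n + 6 * T.card + 2 := by
      exact_mod_cast h2
    have hTk' : (T.card : ℝ) ≤ k := by exact_mod_cast hTk
    have h3 : E ≤ (forcedSet A T x).card := by
      rw [hE]; rw [hcard] at h2'; linarith
    rw [Real.rpow_neg (by norm_num), ← div_eq_mul_inv, le_div_iff₀ (by positivity)]
    calc _ ≤ ((Finset.univ.filter fun f : ↥A → Fin r =>
            RainbowSumFree f ∧ thirdColorSet i j f = T).card : ℝ)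
              * (2 : ℝ) ^ ((forcedSet A T x).card : ℝ) := by
          gcongr
          norm_num
      _ ≤ r ^ T.card * 2 ^ A.card := by
          rw [Real.rpow_natCast]
          exact_mod_cast h1
      _ ≤ r ^ k * 2 ^ A.card := by
          gcongr
          exact_mod_cast (by omega : 1 ≤ r)
  set 𝒯 : Finset (Finset ↥A) := Finset.univ.filter fun T => T.card ≤ k with h𝒯
  have hcover : (Finset.univ.filter fun f : ↥A → Fin r => RainbowSumFree f ∧
      (thirdColorSet i j f).Nonempty ∧ (thirdColorSet i j f).card ≤ k) ⊆
      (𝒯.filter Finset.Nonempty).biUnion fun T => Finset.univ.filter fun f : ↥A → Fin r =>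
        RainbowSumFree f ∧ thirdColorSet i j f = T := by
    intro f hf
    obtain ⟨-, h1, h2, h3⟩ := Finset.mem_filter.1 hf
    simp only [Finset.mem_biUnion, Finset.mem_filter, Finset.mem_univ, true_and, h𝒯]
    exact ⟨_, ⟨h3, h2⟩, h1, rfl⟩
  have hTcount : (𝒯.card : ℝ) ≤ 2 ^ k * n ^ k := by
    have hAn : Fintype.card ↥A ≤ n := by
      rw [Fintype.card_coe]; simpa using Finset.card_le_card hA
    have h1 := card_filter_card_le_le (k := k) (by omega) hAn
    have h2 : (k + 1) * n ^ k ≤ 2 ^ k * n ^ k := Nat.mul_le_mul_right _ Nat.lt_two_pow_self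
    exact_mod_cast h1.trans h2
  calc _ ≤ ((∑ T ∈ 𝒯.filter Finset.Nonempty, (Finset.univ.filter fun f : ↥A → Fin r =>
          RainbowSumFree f ∧ thirdColorSet i j f = T).card : ℕ) : ℝ) := by
        exact_mod_cast (Finset.card_le_card hcover).trans Finset.card_biUnion_le
    _ ≤ ∑ T ∈ 𝒯.filter Finset.Nonempty, (r ^ k * 2 ^ A.card * (2 : ℝ) ^ (-E)) := by
        push_cast
        refine Finset.sum_le_sum fun T hT => ?_
        obtain ⟨h1, h2⟩ := Finset.mem_filter.1 hT
        exact hfiber T h2 (Finset.mem_filter.1 h1).2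
    _ = (𝒯.filter Finset.Nonempty).card * (r ^ k * 2 ^ A.card * (2 : ℝ) ^ (-E)) := by
        rw [Finset.sum_const, nsmul_eq_mul]
    _ ≤ (2 ^ k * n ^ k) * (r ^ k * 2 ^ A.card * (2 : ℝ) ^ (-E)) := by
        gcongr
        exact le_trans (by exact_mod_cast Finset.card_filter_le _ _) hTcount
    _ = 2 ^ A.card * (2 : ℝ) ^ (k + k * L + k * Real.logb 2 r - E) := by
        rw [sub_eq_add_neg, Real.rpow_add (by norm_num), Real.rpow_add (by norm_num),
          Real.rpow_add (by norm_num), mul_comm (k : ℝ) L, mul_comm (k : ℝ) (Real.logb 2 r),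
          Real.rpow_mul (by norm_num), Real.rpow_mul (by norm_num), hnpow, hrpow]
        simp only [Real.rpow_natCast]
        ring
    _ ≤ _ := by
        gcongr
        · norm_num
        · exact thirdColor_exponent_bound (by omega) hRL hk hr hξ

lemma card_filter_thirdColorSet_eq_empty_le {A : Finset ℕ} {r : ℕ} (i j : Fin r) :
    (Finset.univ.filter fun f : ↥A → Fin r => thirdColorSet i j f = ∅).card ≤ 2 ^ A.card := by
  have hsub : (Finset.univ.filter fun f : ↥A → Fin r => thirdColorSet i j f = ∅) ⊆
      Fintype.piFinset fun _ => {i, j} := by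
    intro f hf
    have hf := (Finset.mem_filter.1 hf).2
    refine Fintype.mem_piFinset.2 fun x => ?_
    have hx : x ∉ thirdColorSet i j f := by simp [hf]
    rw [mem_thirdColorSet] at hx
    simp only [Finset.mem_insert, Finset.mem_singleton]
    tauto
  refine (Finset.card_le_card hsub).trans ?_
  rw [Fintype.card_piFinset]
  simpa using Nat.pow_le_pow_left (Finset.card_le_two (a := i) (b := j)) A.card

lemma card_thirdColorSet_add_card_le {A : Finset ℕ} {r : ℕ} {i j : Fin r} {f : ↥A → Fin r}
    {P : ℕ → Finset (Fin r)} (hf : ∀ x : ↥A, f x ∈ P x) :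
    (thirdColorSet i j f).card + (A.filter fun x => P x = {i, j}).card ≤ A.card := by
  rw [← Finset.card_map (Function.Embedding.subtype _), ← Finset.card_union_of_disjoint]
  · refine Finset.card_le_card (Finset.union_subset ?_ (Finset.filter_subset _ _))
    intro z hz
    obtain ⟨w, -, rfl⟩ := Finset.mem_map.1 hz
    exact w.2
  · rw [Finset.disjoint_left]
    intro z hz hz'
    obtain ⟨w, hw, rfl⟩ := Finset.mem_map.1 hz
    have h := hf w
    rw [show P w = {i, j} from (Finset.mem_filter.1 hz').2] at h
    rw [mem_thirdColorSet] at hw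
    simp only [Finset.mem_insert, Finset.mem_singleton] at h
    tauto

theorem stmt_12 (r : ℕ) (hr : 3 ≤ r) :
    ∃ n₀ : ℕ, ∀ n : ℕ, n₀ ≤ n → ∀ ξ : ℝ, 0 ≤ ξ → ξ ≤ ((r : ℝ) ^ 3)⁻¹ →
      ∀ A ⊆ Finset.Icc 1 n, (A.card : ℝ) = (1 - ξ) * n →
      ∀ i j : Fin r, i ≠ j →
      -- `g(𝒫(i,j), A)`: the number of rainbow sum-free `r`-colorings of `A` that are
      -- subtemplates of some good template `P` of `A` in which at least `(1 - 2δ)n`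
      -- elements of `A` have palette exactly `{i, j}`, where `δ = 1/(24 log₂ n)`.
      (Nat.card {f : ↥A → Fin r //
          (∀ x y z : ↥A, (x : ℕ) + (y : ℕ) = (z : ℕ) →
            ¬(f x ≠ f y ∧ f x ≠ f z ∧ f y ≠ f z)) ∧
          ∃ P : ℕ → Finset (Fin r), GoodTemplate n r A P ∧
            (1 - 2 * (1 / (24 * Real.logb 2 n))) * n ≤
              ((A.filter (fun x => P x = {i, j})).card : ℝ) ∧
            ∀ x : ↥A, f x ∈ P (x : ℕ)} : ℝ)
        ≤ (2 : ℝ) ^ A.card * (1 + (2 : ℝ) ^ (-(n : ℝ) / 12)) := by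
  classical
  refine ⟨100 + 16 * r, fun n hn ξ hξ0 hξ A hA hcard i j hij => ?_⟩
  set L := Real.logb 2 n with hL
  have hLpos : 0 < L := Real.logb_pos (by norm_num) (by exact_mod_cast (by omega : 1 < n))
  set k := ⌊(n : ℝ) / (12 * L)⌋₊ with hk
  have hkL : (k : ℝ) * (12 * L) ≤ n := by
    rw [← le_div_iff₀ (by positivity)]
    exact Nat.floor_le (by positivity)
  rw [Nat.card_eq_fintype_card, Fintype.card_subtype]
  refine le_trans ?_ (le_of_eq (mul_one_add _ _).symm)
  have hempty : ((Finset.univ.filter fun f : ↥A → Fin r => thirdColorSet i j f = ∅).card : ℝ)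
      ≤ 2 ^ A.card := by
    exact_mod_cast card_filter_thirdColorSet_eq_empty_le i j
  refine le_trans ?_ (add_le_add hempty
    (card_rainbowSumFree_thirdColor_le hr hn hA hξ hcard hL hkL hij))
  norm_cast
  refine (Finset.card_le_card ?_).trans (Finset.card_union_le _ _)
  intro f hf
  obtain ⟨-, hfree, P, -, hP, hfP⟩ := Finset.mem_filter.1 hf
  rcases (thirdColorSet i j f).eq_empty_or_nonempty with h | h
  · exact Finset.mem_union_left _ (by simpa using h)
  refine Finset.mem_union_right _ (Finset.mem_filter.2 ⟨Finset.mem_univ _, hfree, h, ?_⟩)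
  refine Nat.le_floor ?_
  have h1 : ((thirdColorSet i j f).card : ℝ) + (A.filter fun x => P x = {i, j}).card ≤ A.card := by
    exact_mod_cast card_thirdColorSet_add_card_le hfP
  have h2 : (1 - 2 * (1 / (24 * L))) * n = n - n / (12 * L) := by
    field_simp
    ring
  rw [h2] at hP
  have h3 : 0 ≤ ξ * n := by positivity
  rw [hcard] at h1
  linarith
end

section
/- For every ε > 0 there exist δ₁ = δ₁(ε) > 0 and n₀ such that for all n ≥ n₀: every A ⊆ [n] with |A| ≤ (1 - ε)n satisfies g(A, 3) ≤ 2^{(1 - δ₁)n}. -/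
open Finset

/-- The number of rainbow sum-free `r`-colorings of a finite set `A` of positive
integers. -/
noncomputable def numRSF (r : ℕ) (A : Finset ℕ) : ℕ :=
  Nat.card {f : ↥A → Fin r //
    ∀ x y z : ↥A, (x : ℕ) + (y : ℕ) = (z : ℕ) →
      ¬(f x ≠ f y ∧ f x ≠ f z ∧ f y ≠ f z)}

/-- `p` pairs each element of `U` with a private partner outside `U`, all inside `s`. -/
structure IsPairing (s U : Finset ℕ) (p : ℕ → ℕ) : Prop where
  subset : U ⊆ s
  mapsTo : ∀ u ∈ U, p u ∈ s
  injOn : ∀ u ∈ U, ∀ v ∈ U, p u = p v → u = v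
  notMem : ∀ u ∈ U, p u ∉ U

theorem IsPairing.mono {s U V : Finset ℕ} {p : ℕ → ℕ} (h : IsPairing s U p) (hV : V ⊆ U) :
    IsPairing s V p where
  subset := hV.trans h.subset
  mapsTo u hu := h.mapsTo u (hV hu)
  injOn u hu v hv := h.injOn u (hV hu) v (hV hv)
  notMem u hu hpu := h.notMem u (hV hu) (hV hpu)

theorem IsPairing.disjoint {s U : Finset ℕ} {p : ℕ → ℕ} (h : IsPairing s U p) :
    Disjoint U (U.image p) := by
  rw [Finset.disjoint_right]
  intro k hk
  obtain ⟨u, hu, rfl⟩ := Finset.mem_image.1 hk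
  exact h.notMem u hu

theorem IsPairing.image_subset {s U : Finset ℕ} {p : ℕ → ℕ} (h : IsPairing s U p) :
    U.image p ⊆ s := by
  intro k hk
  obtain ⟨u, hu, rfl⟩ := Finset.mem_image.1 hk
  exact h.mapsTo u hu

theorem IsPairing.card_image {s U : Finset ℕ} {p : ℕ → ℕ} (h : IsPairing s U p) :
    (U.image p).card = U.card :=
  Finset.card_image_of_injOn fun u hu v hv => h.injOn u hu v hv

theorem prod_ite_mem_const {s U : Finset ℕ} (h : U ⊆ s) (a : ℕ) :
    ∏ k ∈ s, (if k ∈ U then a else 1) = a ^ U.card := by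
  rw [Finset.prod_ite_mem, Finset.inter_eq_right.2 h, Finset.prod_const]

/-- A finite family whose members are determined by codes `e k f ∈ C k` is no larger than the
number of code words. -/
theorem card_le_prod_of_codes {α κ γ : Type*} [DecidableEq κ] (F : Finset α) (s : Finset κ)
    (C : κ → Finset γ) (e : κ → α → γ) (he : ∀ f ∈ F, ∀ k ∈ s, e k f ∈ C k)
    (hinj : ∀ f ∈ F, ∀ g ∈ F, (∀ k ∈ s, e k f = e k g) → f = g) :
    F.card ≤ ∏ k ∈ s, (C k).card := by
  rw [← Finset.card_pi]
  refine Finset.card_le_card_of_injOn (fun f k _ => e k f) ?_ ?_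
  · intro f hf
    exact Finset.mem_coe.2 (Finset.mem_pi.2 fun k hk => he f hf k hk)
  · intro f hf g hg h
    exact hinj f hf g hg fun k hk => congrFun (congrFun h k) hk

/-- Colorings which are constant on most pairs of a pairing and use at most two prescribed colors
on most unpaired elements. -/
theorem card_colorings_le {s A U W X : Finset ℕ} {p : ℕ → ℕ} (hA : A ⊆ s)
    (hU : IsPairing s U p) (hW : W ⊆ s) (G : Finset (ℕ → Fin 3))
    (h0 : ∀ f ∈ G, ∀ x, x ∉ A → f x = 0)
    (hX : ∀ f ∈ G, ∀ g ∈ G, ∀ x ∈ X, f x = g x)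
    (hpair : ∀ f ∈ G, ∀ u ∈ U, u ∈ A → p u ∈ A → f u ≠ f (p u) → u ∈ X ∧ p u ∈ X)
    (hpal : ∀ k ∈ A, k ∉ U → k ∉ U.image p → k ∉ W →
      ∃ a b, ∀ f ∈ G, f k = a ∨ f k = b) :
    G.card * 4 ^ U.card ≤ 3 ^ U.card * 3 ^ W.card * 2 ^ s.card := by
  classical
  choose! a b hab using hpal
  let C : ℕ → Finset (Fin 3) := fun k =>
    if k ∈ U then univ else if k ∈ U.image p then {0} else if k ∈ W then univ else {0, 1}
  let e : ℕ → (ℕ → Fin 3) → Fin 3 := fun k f =>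
    if k ∈ U then (if k ∈ A then f k else f (p k)) else if k ∈ U.image p then 0 else
      if k ∈ W then f k else if f k = a k then 0 else 1
  have hcard : G.card ≤ ∏ k ∈ s, (C k).card := by
    refine card_le_prod_of_codes G s C e ?_ ?_
    · intro f hf k hk
      simp only [C, e]
      split_ifs <;> simp
    · intro f hf g hg hfg
      funext k
      by_cases hkA : k ∈ A
      swap
      · rw [h0 f hf k hkA, h0 g hg k hkA]
      have hk := hfg k (hA hkA)
      by_cases hkU : k ∈ U
      · simpa [e, hkU, hkA] using hk
      by_cases hkp : k ∈ U.image p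
      · obtain ⟨u, hu, rfl⟩ := Finset.mem_image.1 hkp
        have hu' := hfg u (hU.subset hu)
        simp only [e, hu, if_true] at hu'
        by_cases huA : u ∈ A
        · simp only [huA, if_true] at hu'
          by_cases h1 : f u = f (p u)
          · by_cases h2 : g u = g (p u)
            · rw [← h1, ← h2, hu']
            · exact hX f hf g hg _ (hpair g hg u hu huA hkA h2).2
          · exact hX f hf g hg _ (hpair f hf u hu huA hkA h1).2
        · simpa [huA] using hu'
      by_cases hkW : k ∈ W
      · simpa only [e, hkU, hkp, hkW, if_true, if_false] using hk
      · simp only [e, hkU, hkp, hkW, if_false] at hk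
        have h1 := hab k hkA hkU hkp hkW f hf
        have h2 := hab k hkA hkU hkp hkW g hg
        by_cases h3 : f k = a k <;> by_cases h4 : g k = a k <;> simp_all
  have h4 : (4 : ℕ) ^ U.card =
      (∏ k ∈ s, if k ∈ U then 2 else 1) * ∏ k ∈ s, if k ∈ U.image p then 2 else 1 := by
    rw [prod_ite_mem_const hU.subset, prod_ite_mem_const hU.image_subset, hU.card_image,
      ← mul_pow]
    norm_num
  calc G.card * 4 ^ U.card ≤ (∏ k ∈ s, (C k).card) * 4 ^ U.card :=
        Nat.mul_le_mul_right _ hcard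
    _ ≤ 3 ^ U.card * 3 ^ W.card * 2 ^ s.card := by
      rw [h4, ← prod_ite_mem_const hU.subset 3, ← prod_ite_mem_const hW 3, ← Finset.prod_const,
        ← Finset.prod_mul_distrib, ← Finset.prod_mul_distrib, ← Finset.prod_mul_distrib,
        ← Finset.prod_mul_distrib]
      refine Finset.prod_le_prod' fun k _ => ?_
      have hd : k ∈ U → k ∉ U.image p := fun h => Finset.disjoint_left.1 hU.disjoint h
      simp only [C]
      by_cases h1 : k ∈ U
      · simp only [h1, hd h1, if_true, if_false]
        split_ifs <;> simp
      · by_cases h2 : k ∈ U.image p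
        · simp only [h1, h2, if_true, if_false]
          split_ifs <;> simp
        · simp only [h1, h2, if_false]
          split_ifs <;> simp

theorem card_uncaught_mul_le {s V : Finset ℕ} {p : ℕ → ℕ} (hV : IsPairing s V p) (K : ℕ)
    (i : Fin (K + 1)) (B : Finset (↥s → Fin (K + 1)))
    (hB : ∀ φ ∈ B, ∀ u v : ↥s, (u : ℕ) ∈ V → p u = v → ¬(φ u = i ∧ φ v = i)) :
    B.card * ((K + 1) ^ 2) ^ V.card ≤ ((K + 1) ^ 2 - 1) ^ V.card * (K + 1) ^ s.card := by
  classical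
  let ext : (↥s → Fin (K + 1)) → ℕ → Fin (K + 1) :=
    fun φ x => if h : x ∈ s then φ ⟨x, h⟩ else 0
  have hext : ∀ φ x (h : x ∈ s), ext φ x = φ ⟨x, h⟩ := fun φ x h => by simp [ext, h]
  let C : ℕ → Finset (Fin (K + 1) × Fin (K + 1)) := fun k =>
    if k ∈ V then univ.erase (i, i) else if k ∈ V.image p then {(0, 0)} else univ ×ˢ {0}
  let e : ℕ → (↥s → Fin (K + 1)) → Fin (K + 1) × Fin (K + 1) := fun k φ =>
    if k ∈ V then (ext φ k, ext φ (p k)) else if k ∈ V.image p then (0, 0) else (ext φ k, 0)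
  have hcard : B.card ≤ ∏ k ∈ s, (C k).card := by
    refine card_le_prod_of_codes B s C e ?_ ?_
    · intro φ hφ k hk
      by_cases hkV : k ∈ V
      · have := hB φ hφ ⟨k, hk⟩ ⟨p k, hV.mapsTo k hkV⟩ hkV rfl
        rw [← hext φ k hk, ← hext φ (p k) (hV.mapsTo k hkV)] at this
        simpa [C, e, hkV] using this
      · simp only [C, e, hkV, if_false]
        split_ifs <;> simp
    · intro φ hφ ψ hψ h
      funext ⟨k, hk⟩
      rw [← hext φ k hk, ← hext ψ k hk]
      have hk' := h k hk
      by_cases hkV : k ∈ V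
      · simp only [e, hkV, if_true, Prod.mk.injEq] at hk'
        exact hk'.1
      by_cases hkp : k ∈ V.image p
      · obtain ⟨u, hu, rfl⟩ := Finset.mem_image.1 hkp
        have hu' := h u (hV.subset hu)
        simp only [e, hu, if_true, Prod.mk.injEq] at hu'
        exact hu'.2
      · simp only [e, hkV, hkp, if_false, Prod.mk.injEq] at hk'
        exact hk'.1
  have h4 : ((K + 1) ^ 2) ^ V.card =
      (∏ k ∈ s, if k ∈ V then (K + 1) else 1) * ∏ k ∈ s, if k ∈ V.image p then (K + 1) else 1 := by
    rw [prod_ite_mem_const hV.subset, prod_ite_mem_const hV.image_subset, hV.card_image,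
      ← mul_pow, pow_two]
  calc B.card * ((K + 1) ^ 2) ^ V.card ≤ (∏ k ∈ s, (C k).card) * ((K + 1) ^ 2) ^ V.card :=
        Nat.mul_le_mul_right _ hcard
    _ ≤ ((K + 1) ^ 2 - 1) ^ V.card * (K + 1) ^ s.card := by
      rw [h4, ← prod_ite_mem_const hV.subset, ← Finset.prod_const,
        ← Finset.prod_mul_distrib, ← Finset.prod_mul_distrib, ← Finset.prod_mul_distrib]
      refine Finset.prod_le_prod' fun k _ => ?_
      have hd : k ∈ V → k ∉ V.image p := fun h => Finset.disjoint_left.1 hV.disjoint h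
      simp only [C]
      by_cases h1 : k ∈ V
      · simp [h1, hd h1, Finset.card_erase_of_mem, pow_two]
      · by_cases h2 : k ∈ V.image p
        · simp only [h1, h2, if_true, if_false]
          simp
        · simp only [h1, h2, if_false]
          simp

/-- A small set containing a pair from each of many large pairings. -/
theorem exists_small_catching_set {s Z : Finset ℕ} {V : ℕ → Finset ℕ} {p : ℕ → ℕ → ℕ} {b K : ℕ}
    (hV : ∀ z ∈ Z, IsPairing s (V z) (p z)) (hb : ∀ z ∈ Z, b ≤ (V z).card)
    (hlt : (Z.card : ℝ) * ((K + 1 : ℕ) : ℝ) * (1 - 1 / ((K + 1 : ℕ) : ℝ) ^ 2) ^ b < 1) :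
    ∃ T ⊆ s, (K + 1) * T.card ≤ s.card ∧ ∀ z ∈ Z, ∃ u ∈ V z, u ∈ T ∧ p z u ∈ T := by
  classical
  let bad : ℕ × Fin (K + 1) → Finset (↥s → Fin (K + 1)) := fun zi =>
    univ.filter fun φ => ∀ u v : ↥s, (u : ℕ) ∈ V zi.1 → p zi.1 u = v →
      ¬(φ u = zi.2 ∧ φ v = zi.2)
  set k : ℝ := ((K + 1 : ℕ) : ℝ) with hk
  have hk1 : 1 ≤ k := by rw [hk]; exact_mod_cast Nat.succ_le_succ (Nat.zero_le K)
  have hk0 : 0 < k := by linarith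
  have hq0 : 0 ≤ 1 - 1 / k ^ 2 := by
    have : 1 / k ^ 2 ≤ 1 := by
      rw [div_le_one (by positivity)]; nlinarith
    linarith
  have hq1 : 1 - 1 / k ^ 2 ≤ 1 := by
    have : 0 ≤ 1 / k ^ 2 := by positivity
    linarith
  have hbad : ∀ zi ∈ Z ×ˢ (univ : Finset (Fin (K + 1))),
      ((bad zi).card : ℝ) ≤ (1 - 1 / k ^ 2) ^ b * k ^ s.card := by
    rintro ⟨z, i⟩ hzi
    have hz : z ∈ Z := (Finset.mem_product.1 hzi).1
    have h := card_uncaught_mul_le (hV z hz) K i (bad (z, i))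
      (fun φ hφ => (Finset.mem_filter.1 hφ).2)
    have h' : ((bad (z, i)).card : ℝ) * (k ^ 2) ^ (V z).card ≤
        (k ^ 2 - 1) ^ (V z).card * k ^ s.card := by
      have h2 : (((K + 1) ^ 2 - 1 : ℕ) : ℝ) = k ^ 2 - 1 := by
        rw [Nat.cast_sub (Nat.one_le_pow _ _ (Nat.succ_pos K))]; push_cast [hk]; ring
      rw [← h2, hk]
      exact_mod_cast h
    have h3 : (k ^ 2 - 1) ^ (V z).card = (1 - 1 / k ^ 2) ^ (V z).card * (k ^ 2) ^ (V z).card := by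
      rw [← mul_pow]; congr 1; field_simp
    rw [h3] at h'
    have h5 : ((bad (z, i)).card : ℝ) ≤ (1 - 1 / k ^ 2) ^ (V z).card * k ^ s.card := by
      have h6 : 0 < (k ^ 2) ^ (V z).card := by positivity
      refine le_of_mul_le_mul_right (h'.trans_eq ?_) h6
      ring
    exact h5.trans (mul_le_mul_of_nonneg_right
      (pow_le_pow_of_le_one hq0 hq1 (hb z hz)) (by positivity))
  have hex : ∃ φ : ↥s → Fin (K + 1), ∀ z ∈ Z, ∀ i, φ ∉ bad (z, i) := by
    by_contra! hcon
    have hsub : (univ : Finset (↥s → Fin (K + 1))) ⊆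
        (Z ×ˢ (univ : Finset (Fin (K + 1)))).biUnion bad := by
      intro φ _
      obtain ⟨z, hz, i, hi⟩ := hcon φ
      exact Finset.mem_biUnion.2 ⟨(z, i), by simp [hz], hi⟩
    have h1 := (Finset.card_le_card hsub).trans Finset.card_biUnion_le
    have h2 : (k ^ s.card : ℝ) ≤
        ∑ zi ∈ Z ×ˢ (univ : Finset (Fin (K + 1))), ((bad zi).card : ℝ) := by
      have : Fintype.card (↥s → Fin (K + 1)) = (K + 1) ^ s.card := by simp
      rw [Finset.card_univ, this] at h1
      rw [hk]
      exact_mod_cast h1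
    have h3 := h2.trans (Finset.sum_le_card_nsmul _ _ _ hbad)
    rw [Finset.card_product, Finset.card_univ, Fintype.card_fin, nsmul_eq_mul, Nat.cast_mul,
      ← hk] at h3
    have h4 : 0 < k ^ s.card := by positivity
    nlinarith
  obtain ⟨φ, hφ⟩ := hex
  let T : Fin (K + 1) → Finset ℕ := fun i =>
    (univ.filter fun x => φ x = i).map (Function.Embedding.subtype _)
  have hsum : ∑ i, (T i).card = s.card := by
    simp only [T, Finset.card_map]
    rw [← Finset.card_eq_sum_card_fiberwise (fun x _ => Finset.mem_coe.2 (Finset.mem_univ (φ x)))]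
    simp
  obtain ⟨i, -, hi⟩ := Finset.exists_le_of_sum_le (s := (univ : Finset (Fin (K + 1))))
    (f := fun i => (K + 1) * (T i).card) (g := fun _ => s.card) ⟨0, Finset.mem_univ _⟩ (by
      rw [← Finset.mul_sum, hsum]; simp)
  refine ⟨T i, ?_, hi, ?_⟩
  · intro x hx
    simp only [T, Finset.mem_map] at hx
    obtain ⟨y, -, rfl⟩ := hx
    exact y.2
  · intro z hz
    have := hφ z hz i
    simp only [bad, Finset.mem_filter, Finset.mem_univ, true_and, not_forall, not_not] at this
    obtain ⟨u, v, huV, huv, hu, hv⟩ := this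
    refine ⟨u, huV, ?_, ?_⟩
    · exact Finset.mem_map.2 ⟨u, by simp [hu], rfl⟩
    · rw [huv]; exact Finset.mem_map.2 ⟨v, by simp [hv], rfl⟩

/-- For each `z ≤ n`, a large part of `[n]` can be paired along solutions of `x + z = y` or
`x + y = z` so that the unpaired elements are mostly below `z`. -/
theorem exists_pairing (n z : ℕ) (hz : 1 ≤ z) (hzn : z ≤ n) :
    ∃ (U W : Finset ℕ) (p : ℕ → ℕ), IsPairing (Icc 1 n) U p ∧ W ⊆ Icc 1 n ∧
      (∀ u ∈ U, p u + z = u ∨ p u + u = z) ∧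
      (∀ k ∈ Icc 1 n, k ∉ U → k ∉ U.image p → k ∉ W → k < z) ∧
      n + 80 * W.card ≤ 20 * U.card + 100 := by
  classical
  by_cases hcase : 10 * z ≤ 9 * n
  · let U := (Ioc z n).filter fun u => ((n - u) / z) % 2 = 0
    have hmem : ∀ u, u ∈ U ↔ (z < u ∧ u ≤ n) ∧ ((n - u) / z) % 2 = 0 := by
      intro u; simp [U]
    have hstep : ∀ u, u ≤ n → z ≤ u → (n - (u - z)) / z = (n - u) / z + 1 := by
      intro u h1 h2
      rw [show n - (u - z) = (n - u) + z by omega, Nat.add_div_right _ hz]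
    have hU : IsPairing (Icc 1 n) U (fun u => u - z) := by
      refine ⟨?_, ?_, ?_, ?_⟩
      · intro u hu; rw [hmem] at hu; rw [Finset.mem_Icc]; omega
      · intro u hu; rw [hmem] at hu; rw [Finset.mem_Icc]; omega
      · intro u hu v hv h; rw [hmem] at hu hv; omega
      · intro u hu hv
        rw [hmem] at hu hv
        have := hstep u (by omega) (by omega)
        omega
    have hcov : Ioc z n ⊆ U ∪ U.image (fun u => u - z) := by
      intro k hk
      rw [Finset.mem_Ioc] at hk
      rw [Finset.mem_union]
      rcases Nat.mod_two_eq_zero_or_one ((n - k) / z) with h | h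
      · left; rw [hmem]; exact ⟨hk, h⟩
      · right
        have hle : z ≤ n - k := by
          by_contra! hlt
          rw [Nat.div_eq_of_lt hlt] at h
          omega
        have := hstep (k + z) (by omega) (by omega)
        rw [Nat.add_sub_cancel] at this
        exact Finset.mem_image.2 ⟨k + z, by rw [hmem]; omega, by simp⟩
    refine ⟨U, {z}, fun u => u - z, hU, ?_, ?_, ?_, ?_⟩
    · simp [hz, hzn]
    · intro u hu; rw [hmem] at hu; left; change u - z + z = u; omega
    · intro k hk h1 h2 h3
      rw [Finset.mem_singleton] at h3
      rw [Finset.mem_Icc] at hk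
      by_contra! hle
      have := hcov (Finset.mem_Ioc.2 ⟨by omega, hk.2⟩)
      rw [Finset.mem_union] at this
      tauto
    · have h := (Finset.card_le_card hcov).trans (Finset.card_union_le _ _)
      rw [hU.card_image, Nat.card_Ioc] at h
      rw [Finset.card_singleton]
      omega
  · have hmem : ∀ u, u ∈ Ioo (z / 2) z ↔ z / 2 < u ∧ u < z := by simp
    have hU : IsPairing (Icc 1 n) (Ioo (z / 2) z) (fun u => z - u) := by
      refine ⟨?_, ?_, ?_, ?_⟩
      · intro u hu; rw [hmem] at hu; rw [Finset.mem_Icc]; omega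
      · intro u hu; rw [hmem] at hu; rw [Finset.mem_Icc]; omega
      · intro u hu v hv h; rw [hmem] at hu hv; omega
      · intro u hu hv; rw [hmem] at hu hv; omega
    refine ⟨Ioo (z / 2) z, Icc z n, fun u => z - u, hU, ?_, ?_, ?_, ?_⟩
    · intro k hk; rw [Finset.mem_Icc] at hk ⊢; omega
    · intro u hu; rw [hmem] at hu; right; change z - u + u = z; omega
    · intro k hk _ _ h3; rw [Finset.mem_Icc] at hk h3; omega
    · rw [Nat.card_Icc, Nat.card_Ioo]; omega

theorem sum_three_pow_card_le (n : ℕ) {y t : ℝ} (hy0 : 0 < y) (hy1 : y ≤ 1) :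
    ∑ X ∈ (Icc 1 n).powerset with (X.card : ℝ) ≤ t, (3 : ℝ) ^ X.card ≤
      y ^ (-t) * (1 + 3 * y) ^ n := by
  calc ∑ X ∈ (Icc 1 n).powerset with (X.card : ℝ) ≤ t, (3 : ℝ) ^ X.card
      ≤ ∑ X ∈ (Icc 1 n).powerset with (X.card : ℝ) ≤ t, y ^ (-t) * (3 * y) ^ X.card := by
        refine Finset.sum_le_sum fun X hX => ?_
        have hXt := (Finset.mem_filter.1 hX).2
        rw [mul_pow, mul_left_comm]
        refine le_mul_of_one_le_right (by positivity) ?_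
        rw [← Real.rpow_natCast y, ← Real.rpow_add hy0]
        exact Real.one_le_rpow_of_pos_of_le_one_of_nonpos hy0 hy1 (by linarith)
    _ ≤ ∑ X ∈ (Icc 1 n).powerset, y ^ (-t) * (3 * y) ^ X.card :=
        Finset.sum_le_sum_of_subset_of_nonneg (Finset.filter_subset _ _)
          fun _ _ _ => by positivity
    _ = y ^ (-t) * (1 + 3 * y) ^ n := by
        rw [← Finset.mul_sum]
        congr 1
        have := Finset.prod_one_add (f := fun _ : ℕ => 3 * y) (s := Icc 1 n)
        simp only [Finset.prod_const, Nat.card_Icc, Nat.add_sub_cancel] at this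
        exact this.symm

theorem le_of_mul_four_pow_le {N n u w : ℕ} (h : N * 4 ^ u ≤ 3 ^ u * 3 ^ w * 2 ^ n)
    (huw : n + 80 * w ≤ 20 * u + 100) :
    (N : ℝ) ≤ 2 ^ n * (3 / 4 : ℝ) ^ ((n : ℝ) / 20 - 5) := by
  have h' : (N : ℝ) * 4 ^ u ≤ 3 ^ u * 3 ^ w * 2 ^ n := by exact_mod_cast h
  have h3 : (3 : ℝ) ^ w ≤ (3 / 4 : ℝ) ^ (-(4 * (w : ℝ))) := by
    have : (3 / 4 : ℝ) ^ (-(4 * (w : ℝ))) = ((4 / 3 : ℝ) ^ 4) ^ w := by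
      rw [Real.rpow_neg (by norm_num), ← Real.inv_rpow (by norm_num), Real.rpow_mul (by norm_num),
        Real.rpow_natCast]
      norm_num
    rw [this]
    exact pow_le_pow_left₀ (by norm_num) (by norm_num) w
  have h4 : (N : ℝ) ≤ 2 ^ n * ((3 / 4 : ℝ) ^ u * 3 ^ w) := by
    refine le_of_mul_le_mul_right (h'.trans_eq ?_) (by positivity : (0 : ℝ) < 4 ^ u)
    rw [div_pow]; field_simp
  refine h4.trans (mul_le_mul_of_nonneg_left ?_ (by positivity))
  calc (3 / 4 : ℝ) ^ u * 3 ^ w ≤ (3 / 4 : ℝ) ^ u * (3 / 4 : ℝ) ^ (-(4 * (w : ℝ))) :=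
        mul_le_mul_of_nonneg_left h3 (by positivity)
    _ = (3 / 4 : ℝ) ^ ((u : ℝ) + -(4 * (w : ℝ))) := by
        rw [Real.rpow_add (by norm_num), Real.rpow_natCast]
    _ ≤ _ := by
        refine Real.rpow_le_rpow_of_exponent_ge (by norm_num) (by norm_num) ?_
        have : (n : ℝ) + 80 * w ≤ 20 * u + 100 := by exact_mod_cast huw
        linarith

theorem card_le_three_pow_mul {F : Finset (ℕ → Fin 3)} {X : Finset ℕ} {Q : ℕ}
    (h : ∀ G ⊆ F, (∀ f ∈ G, ∀ g ∈ G, ∀ x ∈ X, f x = g x) → G.card ≤ Q) :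
    F.card ≤ 3 ^ X.card * Q := by
  classical
  let r : (ℕ → Fin 3) → (↥X → Fin 3) := fun f x => f x
  have h1 := Finset.card_le_mul_card_image (f := r) F Q (by
    intro τ _
    refine h _ (Finset.filter_subset _ _) ?_
    intro f hf g hg x hx
    have hf' := (Finset.mem_filter.1 hf).2
    have hg' := (Finset.mem_filter.1 hg).2
    exact congrFun (hf'.trans hg'.symm) ⟨x, hx⟩)
  have h2 : (F.image r).card ≤ 3 ^ X.card := by
    refine (Finset.card_le_univ _).trans_eq ?_
    simp
  calc F.card ≤ Q * (F.image r).card := h1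
    _ ≤ Q * 3 ^ X.card := Nat.mul_le_mul_left _ h2
    _ = _ := mul_comm _ _

theorem card_rainbowSumFree_le {n b K : ℕ} {A : Finset ℕ} (hA : A ⊆ Icc 1 n)
    (R : Finset (ℕ → Fin 3)) (h0 : ∀ f ∈ R, ∀ x, x ∉ A → f x = 0)
    (hR : ∀ f ∈ R, ∀ x ∈ A, ∀ y ∈ A, ∀ z ∈ A, x + y = z →
      ¬(f x ≠ f y ∧ f x ≠ f z ∧ f y ≠ f z))
    (hlt : (n : ℝ) * ((K + 1 : ℕ) : ℝ) * (1 - 1 / ((K + 1 : ℕ) : ℝ) ^ 2) ^ b < 1)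
    {t y Q : ℝ} (ht : (n : ℝ) / ((K + 1 : ℕ) : ℝ) + 2 * b ≤ t) (hy0 : 0 < y) (hy1 : y ≤ 1)
    (hQ1 : (2 : ℝ) ^ A.card ≤ Q)
    (hQ2 : 2 ^ n * (3 / 4 : ℝ) ^ ((n : ℝ) / 20 - 5) ≤ Q) :
    (R.card : ℝ) ≤ (n + 1) * (y ^ (-t) * (1 + 3 * y) ^ n * Q) := by
  classical
  choose! U W p hU hW hsum hrest hcard using exists_pairing n
  have hA1 : ∀ z ∈ A, 1 ≤ z ∧ z ≤ n := fun z hz => Finset.mem_Icc.1 (hA hz)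
  have hcolor : ∀ f ∈ R, ∀ z ∈ A, ∀ u ∈ U z, u ∈ A → p z u ∈ A → f u ≠ f (p z u) →
      f z = f u ∨ f z = f (p z u) := by
    intro f hf z hz u hu huA hpA hne
    by_contra! hcon
    rcases hsum z (hA1 z hz).1 (hA1 z hz).2 u hu with h | h
    · exact hR f hf _ hpA z hz u huA h ⟨hcon.2.symm, hne.symm, hcon.1⟩
    · exact hR f hf _ hpA u huA z hz h ⟨hne.symm, hcon.2.symm, hcon.1.symm⟩
  let Cl : ℕ → Finset ℕ → Finset (ℕ → Fin 3) := fun m X => R.filter fun f =>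
    (∀ z ∈ A, z < m → ∃ u ∈ U z, u ∈ X ∧ p z u ∈ X ∧ u ∈ A ∧ p z u ∈ A ∧ f u ≠ f (p z u)) ∧
    (m ≤ n → ∀ u ∈ U m, u ∈ A → p m u ∈ A → f u ≠ f (p m u) → u ∈ X ∧ p m u ∈ X)
  let bad : (ℕ → Fin 3) → ℕ → Finset ℕ := fun f z =>
    (U z).filter fun u => u ∈ A ∧ p z u ∈ A ∧ f u ≠ f (p z u)
  have hk0 : (0 : ℝ) < ((K + 1 : ℕ) : ℝ) := by positivity
  have hcatch : ∀ f ∈ R, ∀ Z ⊆ A, (∀ z ∈ Z, b ≤ (bad f z).card) → ∃ T ⊆ Icc 1 n,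
      (T.card : ℝ) ≤ (n : ℝ) / ((K + 1 : ℕ) : ℝ) ∧
        ∀ z ∈ Z, ∃ u ∈ U z, u ∈ T ∧ p z u ∈ T ∧ u ∈ A ∧ p z u ∈ A ∧ f u ≠ f (p z u) := by
    intro f hf Z hZ hb
    have hq0 : (0 : ℝ) ≤ 1 - 1 / ((K + 1 : ℕ) : ℝ) ^ 2 := by
      have h1 : (1 : ℝ) ≤ ((K + 1 : ℕ) : ℝ) := by exact_mod_cast Nat.succ_le_succ (Nat.zero_le K)
      have : 1 / ((K + 1 : ℕ) : ℝ) ^ 2 ≤ 1 := by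
        rw [div_le_one (by positivity)]; nlinarith
      linarith
    have hZn : (Z.card : ℝ) ≤ n := by
      have := Finset.card_le_card (hZ.trans hA)
      rw [Nat.card_Icc, Nat.add_sub_cancel] at this
      exact_mod_cast this
    obtain ⟨T, hT, hTc, hTz⟩ := exists_small_catching_set (s := Icc 1 n) (V := bad f) (p := p)
      (fun z hz => (hU z (hA1 z (hZ hz)).1 (hA1 z (hZ hz)).2).mono (Finset.filter_subset _ _)) hb
      (lt_of_le_of_lt (mul_le_mul_of_nonneg_right
        (mul_le_mul_of_nonneg_right hZn hk0.le) (pow_nonneg hq0 b)) hlt)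
    refine ⟨T, hT, ?_, ?_⟩
    · rw [le_div_iff₀ hk0, mul_comm]
      rw [Nat.card_Icc, Nat.add_sub_cancel] at hTc
      exact_mod_cast hTc
    · intro z hz
      obtain ⟨u, hu, h1, h2⟩ := hTz z hz
      obtain ⟨h3, h4⟩ := Finset.mem_filter.1 hu
      exact ⟨u, h3, h1, h2, h4⟩
  have hcover : R ⊆ (Icc 1 (n + 1)).biUnion fun m =>
      ((Icc 1 n).powerset.filter fun X => (X.card : ℝ) ≤ t).biUnion (Cl m) := by
    intro f hf
    simp only [Finset.mem_biUnion, Finset.mem_filter, Finset.mem_powerset, Cl]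
    by_cases hall : ∀ z ∈ A, b ≤ (bad f z).card
    · obtain ⟨T, hT, hTc, hTz⟩ := hcatch f hf A subset_rfl hall
      refine ⟨n + 1, by simp, T, ⟨hT, ?_⟩, hf, fun z hz _ => hTz z hz, fun h => by omega⟩
      have : (0 : ℝ) ≤ 2 * b := by positivity
      linarith
    · have hex : ∃ m, m ∈ A ∧ (bad f m).card < b := by
        by_contra! h
        exact hall h
      obtain ⟨hmA, hmb⟩ := Nat.find_spec hex
      have hmin : ∀ z ∈ A, z < Nat.find hex → b ≤ (bad f z).card := by
        intro z hz hlt'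
        have := Nat.find_min hex hlt'
        by_contra! h
        exact this ⟨hz, h⟩
      set m := Nat.find hex
      obtain ⟨T, hT, hTc, hTz⟩ := hcatch f hf (A.filter fun z => z < m) (Finset.filter_subset _ _)
        (fun z hz => hmin z (Finset.mem_filter.1 hz).1 (Finset.mem_filter.1 hz).2)
      have hP : IsPairing (Icc 1 n) (bad f m) (p m) :=
        (hU m (hA1 m hmA).1 (hA1 m hmA).2).mono (Finset.filter_subset _ _)
      refine ⟨m, ?_, T ∪ (bad f m ∪ (bad f m).image (p m)), ⟨?_, ?_⟩, hf, ?_, ?_⟩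
      · have := hA1 m hmA
        rw [Finset.mem_Icc]; omega
      · exact Finset.union_subset hT (Finset.union_subset hP.subset hP.image_subset)
      · have h1 := Finset.card_union_le T (bad f m ∪ (bad f m).image (p m))
        have h2 := Finset.card_union_le (bad f m) ((bad f m).image (p m))
        rw [hP.card_image] at h2
        have h3 : (T ∪ (bad f m ∪ (bad f m).image (p m))).card ≤ T.card + 2 * b := by omega
        have h4 : ((T ∪ (bad f m ∪ (bad f m).image (p m))).card : ℝ) ≤ T.card + 2 * b := by
          exact_mod_cast h3
        linarith
      · intro z hz hzm
        obtain ⟨u, hu, h1, h2, h3⟩ := hTz z (Finset.mem_filter.2 ⟨hz, hzm⟩)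
        exact ⟨u, hu, Finset.mem_union_left _ h1, Finset.mem_union_left _ h2, h3⟩
      · intro _ u hu huA hpA hne
        have hub : u ∈ bad f m := Finset.mem_filter.2 ⟨hu, huA, hpA, hne⟩
        exact ⟨Finset.mem_union_right _ (Finset.mem_union_left _ hub),
          Finset.mem_union_right _ (Finset.mem_union_right _ (Finset.mem_image_of_mem _ hub))⟩
  have hQ0 : 0 ≤ Q := le_trans (by positivity) hQ1
  have hclass : ∀ m ∈ Icc 1 (n + 1), ∀ X, ((Cl m X).card : ℝ) ≤ 3 ^ X.card * Q := by
    intro m hm X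
    rw [Finset.mem_Icc] at hm
    have key : (Cl m X).card ≤ 3 ^ X.card * ⌊Q⌋₊ := by
      refine card_le_three_pow_mul fun G hG hagree => ?_
      rw [Nat.le_floor_iff hQ0]
      have hGR : ∀ f ∈ G, f ∈ R := fun f hf => (Finset.mem_filter.1 (hG hf)).1
      have hpal : ∀ k ∈ A, k < m → ∃ a c, ∀ f ∈ G, f k = a ∨ f k = c := by
        intro k hk hkm
        rcases G.eq_empty_or_nonempty with rfl | ⟨g, hg⟩
        · exact ⟨0, 0, by simp⟩
        · obtain ⟨u, hu, h1, h2, h3, h4, h5⟩ := (Finset.mem_filter.1 (hG hg)).2.1 k hk hkm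
          refine ⟨g u, g (p k u), fun f hf => ?_⟩
          rw [hagree g hg f hf u h1, hagree g hg f hf _ h2] at h5 ⊢
          exact hcolor f (hGR f hf) k hk u hu h3 h4 h5
      by_cases hmn : m ≤ n
      · have h := card_colorings_le hA (hU m hm.1 hmn) (hW m hm.1 hmn) G
          (fun f hf => h0 f (hGR f hf)) hagree
          (fun f hf => (Finset.mem_filter.1 (hG hf)).2.2 hmn)
          (fun k hk h1 h2 h3 => hpal k hk (hrest m hm.1 hmn k (hA hk) h1 h2 h3))
        rw [Nat.card_Icc, Nat.add_sub_cancel] at h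
        exact (le_of_mul_four_pow_le h (hcard m hm.1 hmn)).trans hQ2
      · have h := card_colorings_le (s := A) (U := ∅) (W := ∅) (p := id) subset_rfl
          ⟨by simp, by simp, by simp, by simp⟩ (by simp) G
          (fun f hf => h0 f (hGR f hf)) hagree (by simp)
          (fun k hk _ _ _ => hpal k hk (by have := hA1 k hk; omega))
        simp only [Finset.card_empty, pow_zero, mul_one, one_mul] at h
        exact le_trans (by exact_mod_cast h) hQ1
    calc ((Cl m X).card : ℝ) ≤ 3 ^ X.card * (⌊Q⌋₊ : ℝ) := by exact_mod_cast key
      _ ≤ 3 ^ X.card * Q := mul_le_mul_of_nonneg_left (Nat.floor_le hQ0) (by positivity)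
  have h1 : R.card ≤ ∑ m ∈ Icc 1 (n + 1),
      ∑ X ∈ (Icc 1 n).powerset with (X.card : ℝ) ≤ t, (Cl m X).card :=
    (Finset.card_le_card hcover).trans (Finset.card_biUnion_le.trans
      (Finset.sum_le_sum fun m _ => Finset.card_biUnion_le))
  calc (R.card : ℝ) ≤ ∑ m ∈ Icc 1 (n + 1),
        ∑ X ∈ (Icc 1 n).powerset with (X.card : ℝ) ≤ t, ((Cl m X).card : ℝ) := by
        exact_mod_cast h1
    _ ≤ ∑ m ∈ Icc 1 (n + 1), y ^ (-t) * (1 + 3 * y) ^ n * Q := by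
        refine Finset.sum_le_sum fun m hm => ?_
        refine (Finset.sum_le_sum fun X _ => hclass m hm X).trans ?_
        rw [← Finset.sum_mul]
        exact mul_le_mul_of_nonneg_right (sum_three_pow_card_le n hy0 hy1) hQ0
    _ = _ := by
        rw [Finset.sum_const, Nat.card_Icc, nsmul_eq_mul]
        push_cast
        simp

theorem exists_constants {c κ : ℝ} (hc0 : 0 < c) (hc1 : c ≤ 1) :
    ∃ (y θ : ℝ) (K : ℕ), 0 < y ∧ y ≤ 1 ∧ 0 < θ ∧ 1 + 3 * y = (2 : ℝ) ^ (c / 4) ∧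
      (∀ x : ℝ, y ^ (-(θ * x)) = (2 : ℝ) ^ (c / 4 * x)) ∧ 2 / θ ≤ ((K + 1 : ℕ) : ℝ) ∧
      ∃ n₀ : ℕ, ∀ n : ℕ, n₀ ≤ n →
        ((n : ℝ) + 1) * (2 : ℝ) ^ κ ≤ (2 : ℝ) ^ (c / 4 * n) ∧
        (n : ℝ) * ((K + 1 : ℕ) : ℝ) *
          (1 - 1 / ((K + 1 : ℕ) : ℝ) ^ 2) ^ ⌊θ / 4 * n⌋₊ < 1 := by
  obtain ⟨y, hy⟩ : ∃ y : ℝ, y = ((2 : ℝ) ^ (c / 4) - 1) / 3 := ⟨_, rfl⟩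
  have h1 : (1 : ℝ) < 2 ^ (c / 4) := Real.one_lt_rpow (by norm_num) (by linarith)
  have h2 : (2 : ℝ) ^ (c / 4) ≤ 2 := by
    calc (2 : ℝ) ^ (c / 4) ≤ 2 ^ (1 : ℝ) :=
          Real.rpow_le_rpow_of_exponent_le (by norm_num) (by linarith)
      _ = 2 := Real.rpow_one 2
  have hy0 : 0 < y := by rw [hy]; linarith
  have hy1 : y < 1 := by rw [hy]; linarith
  have hL : Real.logb 2 y < 0 := Real.logb_neg (by norm_num) hy0 hy1
  obtain ⟨θ, hθ⟩ : ∃ θ : ℝ, θ = c / 4 / (-Real.logb 2 y) := ⟨_, rfl⟩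
  have hθ0 : 0 < θ := by rw [hθ]; exact div_pos (by linarith) (by linarith)
  obtain ⟨K, hK⟩ := exists_nat_ge (2 / θ)
  have hK' : 2 / θ ≤ ((K + 1 : ℕ) : ℝ) := hK.trans (by push_cast; linarith)
  refine ⟨y, θ, K, hy0, hy1.le, hθ0, by rw [hy]; ring, ?_, hK', ?_⟩
  · intro x
    have h3 : y = (2 : ℝ) ^ Real.logb 2 y :=
      (Real.rpow_logb (by norm_num) (by norm_num) hy0).symm
    have h4 : Real.logb 2 y * (-(θ * x)) = c / 4 * x := by
      have : Real.logb 2 y ≠ 0 := hL.ne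
      rw [hθ]; field_simp
    rw [← h4, Real.rpow_mul (by norm_num), ← h3]
  · set k : ℝ := ((K + 1 : ℕ) : ℝ) with hk
    have hk1 : 1 ≤ k := by rw [hk]; exact_mod_cast Nat.succ_le_succ (Nat.zero_le K)
    have hq0 : 0 ≤ 1 - 1 / k ^ 2 := by
      have : 1 / k ^ 2 ≤ 1 := by
        rw [div_le_one (by positivity)]; nlinarith
      linarith
    have hq1 : 1 - 1 / k ^ 2 < 1 := by
      have : 0 < 1 / k ^ 2 := by positivity
      linarith
    have hlin : ∀ {q : ℝ} (a : ℝ), 0 ≤ q → q < 1 →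
        Filter.Tendsto (fun n : ℕ => ((n : ℝ) + 1) * q ^ n * a) Filter.atTop (nhds 0) := by
      intro q a h0 h1
      have := ((tendsto_self_mul_const_pow_of_lt_one h0 h1).add
        (tendsto_pow_atTop_nhds_zero_of_lt_one h0 h1)).mul_const a
      simpa [add_mul] using this
    have hr0 : (0 : ℝ) ≤ ((2 : ℝ) ^ (c / 4))⁻¹ := by positivity
    have hr1 : ((2 : ℝ) ^ (c / 4))⁻¹ < 1 := inv_lt_one_of_one_lt₀ h1
    have hev1 := (hlin ((2 : ℝ) ^ κ) hr0 hr1).eventually (gt_mem_nhds one_pos)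
    have hfl : Filter.Tendsto (fun n : ℕ => ⌊θ / 4 * (n : ℝ)⌋₊) Filter.atTop Filter.atTop :=
      tendsto_nat_floor_atTop.comp
        (tendsto_natCast_atTop_atTop.const_mul_atTop (by linarith : 0 < θ / 4))
    have hev2 := hfl.eventually ((hlin (4 / θ * k) hq0 hq1).eventually (gt_mem_nhds one_pos))
    obtain ⟨n₀, hn₀⟩ := Filter.eventually_atTop.1 (hev1.and hev2)
    refine ⟨n₀, fun n hn => ⟨?_, ?_⟩⟩
    · have h := (hn₀ n hn).1
      have h5 : (2 : ℝ) ^ (c / 4 * n) = ((2 : ℝ) ^ (c / 4)) ^ n := by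
        rw [Real.rpow_mul (by norm_num), Real.rpow_natCast]
      rw [inv_pow, mul_right_comm, ← div_eq_mul_inv, div_lt_one (by positivity)] at h
      rw [h5]
      exact h.le
    · refine lt_of_le_of_lt ?_ (hn₀ n hn).2
      have h6 : θ / 4 * n ≤ (⌊θ / 4 * (n : ℝ)⌋₊ : ℝ) + 1 := (Nat.lt_floor_add_one _).le
      have h7 : (n : ℝ) ≤ ((⌊θ / 4 * (n : ℝ)⌋₊ : ℝ) + 1) * (4 / θ) := by
        rw [← div_le_iff₀ (by positivity)]
        refine le_of_eq_of_le ?_ h6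
        field_simp
      have h8 : 0 ≤ (1 - 1 / k ^ 2) ^ ⌊θ / 4 * (n : ℝ)⌋₊ := pow_nonneg hq0 _
      calc (n : ℝ) * k * (1 - 1 / k ^ 2) ^ ⌊θ / 4 * (n : ℝ)⌋₊
          ≤ ((⌊θ / 4 * (n : ℝ)⌋₊ : ℝ) + 1) * (4 / θ) * k *
            (1 - 1 / k ^ 2) ^ ⌊θ / 4 * (n : ℝ)⌋₊ := by gcongr
        _ = _ := by ring

theorem exists_finset_numRSF_eq (A : Finset ℕ) :
    ∃ R : Finset (ℕ → Fin 3), R.card = numRSF 3 A ∧ (∀ f ∈ R, ∀ x, x ∉ A → f x = 0) ∧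
      ∀ f ∈ R, ∀ x ∈ A, ∀ y ∈ A, ∀ z ∈ A, x + y = z →
        ¬(f x ≠ f y ∧ f x ≠ f z ∧ f y ≠ f z) := by
  classical
  let ext : (↥A → Fin 3) → ℕ → Fin 3 := fun f x => if h : x ∈ A then f ⟨x, h⟩ else 0
  have hext : ∀ f x (h : x ∈ A), ext f x = f ⟨x, h⟩ := fun f x h => by simp [ext, h]
  refine ⟨(univ.filter fun f : ↥A → Fin 3 => ∀ x y z : ↥A, (x : ℕ) + (y : ℕ) = (z : ℕ) →
      ¬(f x ≠ f y ∧ f x ≠ f z ∧ f y ≠ f z)).image ext, ?_, ?_, ?_⟩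
  · rw [Finset.card_image_of_injective, numRSF, Nat.card_eq_fintype_card, Fintype.card_subtype]
    intro f g hfg
    funext x
    rw [← hext f x x.2, ← hext g x x.2, hfg]
  · intro f hf x hx
    obtain ⟨g, -, rfl⟩ := Finset.mem_image.1 hf
    simp [ext, hx]
  · intro f hf x hx y hy z hz hxyz
    obtain ⟨g, hg, rfl⟩ := Finset.mem_image.1 hf
    rw [hext g x hx, hext g y hy, hext g z hz]
    exact (Finset.mem_filter.1 hg).2 ⟨x, hx⟩ ⟨y, hy⟩ ⟨z, hz⟩ hxyz

theorem stmt_14 (ε : ℝ) (hε : 0 < ε) :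
    ∃ δ₁ : ℝ, 0 < δ₁ ∧ ∃ n₀ : ℕ, ∀ n : ℕ, n₀ ≤ n → ∀ A ⊆ Finset.Icc 1 n,
      (A.card : ℝ) ≤ (1 - ε) * n →
      (numRSF 3 A : ℝ) ≤ (2 : ℝ) ^ ((1 - δ₁) * n) := by
  obtain ⟨κ, hκ⟩ : ∃ κ : ℝ, κ = -Real.logb 2 (3 / 4) / 20 := ⟨_, rfl⟩
  have hκ0 : 0 < κ := by
    have := Real.logb_neg (b := 2) (x := 3 / 4) (by norm_num) (by norm_num) (by norm_num)
    rw [hκ]; linarith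
  have hpow : (3 / 4 : ℝ) = (2 : ℝ) ^ (-(20 * κ)) := by
    rw [hκ, show -(20 * (-Real.logb 2 (3 / 4) / 20)) = Real.logb 2 (3 / 4) by ring,
      Real.rpow_logb (by norm_num) (by norm_num) (by norm_num)]
  obtain ⟨c, hc⟩ : ∃ c : ℝ, c = min (min ε κ) 1 := ⟨_, rfl⟩
  have hc0 : 0 < c := by rw [hc]; positivity
  have hc1 : c ≤ 1 := by rw [hc]; exact min_le_right _ _
  have hcε : c ≤ ε := by rw [hc]; exact (min_le_left _ _).trans (min_le_left _ _)
  have hcκ : c ≤ κ := by rw [hc]; exact (min_le_left _ _).trans (min_le_right _ _)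
  obtain ⟨y, θ, K, hy0, hy1, hθ0, hy2, hyθ, hK, n₀, hn₀⟩ :=
    exists_constants (κ := 100 * κ) hc0 hc1
  refine ⟨c / 4, by linarith, n₀, fun n hn A hA hcard => ?_⟩
  obtain ⟨hbig, hlt⟩ := hn₀ n hn
  obtain ⟨R, hRcard, hR0, hR⟩ := exists_finset_numRSF_eq A
  have hn0 : (0 : ℝ) ≤ n := Nat.cast_nonneg n
  have hK0 : (0 : ℝ) < ((K + 1 : ℕ) : ℝ) := by positivity
  have ht : (n : ℝ) / ((K + 1 : ℕ) : ℝ) + 2 * (⌊θ / 4 * (n : ℝ)⌋₊ : ℝ) ≤ θ * n := by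
    have h1 : (⌊θ / 4 * (n : ℝ)⌋₊ : ℝ) ≤ θ / 4 * n := Nat.floor_le (by positivity)
    have h2 : (n : ℝ) / ((K + 1 : ℕ) : ℝ) ≤ θ / 2 * n := by
      rw [div_le_iff₀ hθ0] at hK
      rw [div_le_iff₀ hK0]
      nlinarith
    linarith
  have hQ1 : (2 : ℝ) ^ A.card ≤ (2 : ℝ) ^ ((1 - c) * n + 100 * κ) := by
    rw [← Real.rpow_natCast]
    refine Real.rpow_le_rpow_of_exponent_le (by norm_num) ?_
    nlinarith
  have hQ2 : 2 ^ n * (3 / 4 : ℝ) ^ ((n : ℝ) / 20 - 5) ≤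
      (2 : ℝ) ^ ((1 - c) * n + 100 * κ) := by
    rw [hpow, ← Real.rpow_mul (by norm_num), ← Real.rpow_natCast,
      ← Real.rpow_add (by norm_num)]
    refine Real.rpow_le_rpow_of_exponent_le (by norm_num) ?_
    nlinarith
  have h := card_rainbowSumFree_le hA R hR0 hR hlt ht hy0 hy1 hQ1 hQ2
  rw [hRcard, hyθ, hy2, ← Real.rpow_natCast, ← Real.rpow_mul (by norm_num),
    Real.rpow_add (by norm_num) ((1 - c) * n)] at h
  calc (numRSF 3 A : ℝ)
      ≤ ((n : ℝ) + 1) * (2 : ℝ) ^ (100 * κ) *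
        ((2 : ℝ) ^ (c / 4 * n) * (2 : ℝ) ^ (c / 4 * n) * (2 : ℝ) ^ ((1 - c) * n)) := by
        refine h.trans_eq ?_
        ring
    _ ≤ (2 : ℝ) ^ (c / 4 * n) *
        ((2 : ℝ) ^ (c / 4 * n) * (2 : ℝ) ^ (c / 4 * n) * (2 : ℝ) ^ ((1 - c) * n)) :=
        mul_le_mul_of_nonneg_right hbig (by positivity)
    _ = (2 : ℝ) ^ ((1 - c / 4) * n) := by
        rw [← Real.rpow_add (by norm_num), ← Real.rpow_add (by norm_num),
          ← Real.rpow_add (by norm_num)]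
        congr 1
        ring
end

section
/- For every ε > 0 and every integer r ≥ 5 there exist δ₁ = δ₁(ε, r) > 0 and n₀ such that for all n ≥ n₀: every A ⊆ [n] with |A| ≥ (1/2 + ε)n satisfies g(A, r) ≤ r^{(1/2 - δ₁)n}. -/
open Finset

namespace RainbowSum

section Energy

variable {ι C : Type*} [DecidableEq C]

/-- The colorings in `Ω` agreeing with `f` on `S`. -/
def fiber (Ω : Finset (ι → C)) (S : Finset ι) (f : ι → C) : Finset (ι → C) :=
  {g ∈ Ω | ∀ i ∈ S, g i = f i}

/-- The probability that a uniformly random element of `Ω` gives `z` the color `c`, conditioned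
on agreeing with `f` on `S`. -/
noncomputable def condProb (Ω : Finset (ι → C)) (S : Finset ι) (z : ι) (c : C) (f : ι → C) : ℝ :=
  (#{g ∈ fiber Ω S f | g z = c} : ℝ) / #(fiber Ω S f)

lemma mem_fiber {Ω : Finset (ι → C)} {S : Finset ι} {f g : ι → C} :
    g ∈ fiber Ω S f ↔ g ∈ Ω ∧ ∀ i ∈ S, g i = f i := by
  simp [fiber]

lemma fiber_subset (Ω : Finset (ι → C)) (S : Finset ι) (f : ι → C) : fiber Ω S f ⊆ Ω :=
  fun _ h => (mem_fiber.1 h).1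

lemma fiber_congr (Ω : Finset (ι → C)) {S : Finset ι} {f g : ι → C} (h : ∀ i ∈ S, g i = f i) :
    fiber Ω S g = fiber Ω S f := by
  ext k
  simp only [mem_fiber]
  refine and_congr_right fun _ => forall₂_congr fun i hi => ?_
  rw [h i hi]

lemma condProb_congr (Ω : Finset (ι → C)) {S : Finset ι} {f g : ι → C} (z : ι) (c : C)
    (h : ∀ i ∈ S, g i = f i) : condProb Ω S z c g = condProb Ω S z c f := by
  simp only [condProb, fiber_congr Ω h]

lemma condProb_nonneg (Ω : Finset (ι → C)) (S : Finset ι) (z : ι) (c : C) (f : ι → C) :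
    0 ≤ condProb Ω S z c f := by
  unfold condProb; positivity

lemma condProb_le_one (Ω : Finset (ι → C)) (S : Finset ι) (z : ι) (c : C) (f : ι → C) :
    condProb Ω S z c f ≤ 1 := by
  unfold condProb
  refine div_le_one_of_le₀ ?_ (by positivity)
  exact_mod_cast card_le_card (filter_subset _ _)

lemma sum_condProb_mul (Ω : Finset (ι → C)) (S : Finset ι) (z : ι) (c : C) (φ : (ι → C) → ℝ)
    (hφ : ∀ f g, (∀ i ∈ S, g i = f i) → φ g = φ f) :
    ∑ f ∈ Ω, condProb Ω S z c f * φ f = ∑ f ∈ Ω with f z = c, φ f := by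
  have h1 : ∀ f ∈ Ω, condProb Ω S z c f * φ f =
      ∑ g ∈ fiber Ω S f with g z = c, φ f / #(fiber Ω S f) := by
    intro f _
    rw [sum_const, nsmul_eq_mul, condProb]
    ring
  rw [sum_congr rfl h1, sum_comm' (t' := {f ∈ Ω | f z = c}) (s' := fun g => fiber Ω S g)]
  · refine sum_congr rfl fun g hg => ?_
    have h2 : ∀ f ∈ fiber Ω S g, φ f / #(fiber Ω S f) = φ g / #(fiber Ω S g) := by
      intro f hf
      rw [fiber_congr Ω (mem_fiber.1 hf).2, hφ _ _ (mem_fiber.1 hf).2]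
    rw [sum_congr rfl h2, sum_const, nsmul_eq_mul]
    have h3 : (#(fiber Ω S g) : ℝ) ≠ 0 := by
      have : g ∈ fiber Ω S g := mem_fiber.2 ⟨(mem_filter.1 hg).1, fun _ _ => rfl⟩
      exact_mod_cast (card_pos.2 ⟨g, this⟩).ne'
    field_simp
  · intro f g
    simp only [mem_filter, mem_fiber]
    constructor
    · rintro ⟨h1, ⟨h2, h3⟩, h4⟩
      exact ⟨⟨h1, fun i hi => (h3 i hi).symm⟩, h2, h4⟩
    · rintro ⟨⟨h1, h3⟩, h2, h4⟩
      exact ⟨h1, ⟨h2, fun i hi => (h3 i hi).symm⟩, h4⟩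

lemma sum_sq_condProb_sub (Ω : Finset (ι → C)) {S S' : Finset ι} (hS : S ⊆ S') (z : ι) (c : C) :
    ∑ f ∈ Ω, (condProb Ω S' z c f - condProb Ω S z c f) ^ 2 =
      ∑ f ∈ Ω, condProb Ω S' z c f ^ 2 - ∑ f ∈ Ω, condProb Ω S z c f ^ 2 := by
  have h1 := sum_condProb_mul Ω S z c (condProb Ω S z c) fun f g h => condProb_congr Ω z c h
  have h2 := sum_condProb_mul Ω S' z c (condProb Ω S z c)
    fun f g h => condProb_congr Ω z c fun i hi => h i (hS hi)
  have h3 : ∑ f ∈ Ω, (condProb Ω S' z c f - condProb Ω S z c f) ^ 2 =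
      ∑ f ∈ Ω, condProb Ω S' z c f ^ 2 + ∑ f ∈ Ω, condProb Ω S z c f * condProb Ω S z c f
        - 2 * ∑ f ∈ Ω, condProb Ω S' z c f * condProb Ω S z c f := by
    rw [mul_sum, ← sum_add_distrib, ← sum_sub_distrib]
    exact sum_congr rfl fun f _ => by ring
  have h4 : ∑ f ∈ Ω, condProb Ω S z c f ^ 2 =
      ∑ f ∈ Ω, condProb Ω S z c f * condProb Ω S z c f := sum_congr rfl fun f _ => sq _
  rw [h3, h4, h2, h1]
  ring

variable [DecidableEq ι] [Fintype C]

/-- How much the law of the color of `z`, given the colors on `S`, changes in mean square when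
the colors on `T` are revealed as well. -/
noncomputable def discrepancy (Ω : Finset (ι → C)) (S T : Finset ι) (z : ι) : ℝ :=
  ∑ c, ∑ f ∈ Ω, (condProb Ω (S ∪ T) z c f - condProb Ω S z c f) ^ 2

lemma discrepancy_nonneg (Ω : Finset (ι → C)) (S T : Finset ι) (z : ι) :
    0 ≤ discrepancy Ω S T z := by
  unfold discrepancy; positivity

lemma discrepancy_mono (Ω : Finset (ι → C)) (S : Finset ι) {T T' : Finset ι} (hT : T ⊆ T')
    (z : ι) : discrepancy Ω S T z ≤ discrepancy Ω S T' z := by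
  unfold discrepancy
  refine sum_le_sum fun c _ => ?_
  rw [sum_sq_condProb_sub Ω subset_union_left, sum_sq_condProb_sub Ω subset_union_left]
  have := sum_sq_condProb_sub Ω (union_subset_union_right (s := S) hT) z c
  have h0 : 0 ≤ ∑ f ∈ Ω, (condProb Ω (S ∪ T') z c f - condProb Ω (S ∪ T) z c f) ^ 2 := by
    positivity
  linarith

variable [Fintype ι]

/-- The mean-square energy of the conditional laws of all colors given the colors on `S`. -/
noncomputable def energy (Ω : Finset (ι → C)) (S : Finset ι) : ℝ :=
  ∑ z, ∑ c, ∑ f ∈ Ω, condProb Ω S z c f ^ 2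

lemma sum_discrepancy (Ω : Finset (ι → C)) (S T : Finset ι) :
    ∑ z, discrepancy Ω S T z = energy Ω (S ∪ T) - energy Ω S := by
  simp only [discrepancy, energy, ← sum_sub_distrib]
  refine sum_congr rfl fun z _ => sum_congr rfl fun c _ => ?_
  rw [sum_sq_condProb_sub Ω subset_union_left, sum_sub_distrib]

omit [DecidableEq ι] in
lemma energy_nonneg (Ω : Finset (ι → C)) (S : Finset ι) : 0 ≤ energy Ω S := by
  unfold energy; positivity

omit [DecidableEq ι] in
lemma energy_le (Ω : Finset (ι → C)) (S : Finset ι) :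
    energy Ω S ≤ Fintype.card ι * Fintype.card C * #Ω := by
  have : energy Ω S ≤ ∑ _z : ι, ∑ _c : C, ∑ _f ∈ Ω, (1 : ℝ) := by
    unfold energy
    gcongr with z _ c _ f _
    exact pow_le_one₀ (condProb_nonneg ..) (condProb_le_one ..)
  refine this.trans (le_of_eq ?_)
  simp [mul_assoc]

/-- There is a set `S` of bounded size such that revealing few further colors does not increase
the energy much. -/
lemma exists_energy_stable (Ω : Finset (ι → C)) (m s : ℕ) (hm : 0 < m) :
    ∃ S : Finset ι, #S ≤ m * s ∧ ∀ T : Finset ι, #T ≤ s →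
      energy Ω (S ∪ T) - energy Ω S ≤ Fintype.card ι * Fintype.card C * #Ω / m := by
  set M : ℝ := Fintype.card ι * Fintype.card C * #Ω with hM
  by_contra! hcon
  have hM0 : 0 ≤ M := by positivity
  have hm' : (0 : ℝ) < m := by exact_mod_cast hm
  have key : ∀ k ≤ m, ∃ S : Finset ι, #S ≤ k * s ∧ k * (M / m) ≤ energy Ω S := by
    intro k
    induction k with
    | zero => exact fun _ => ⟨∅, by simp, by simpa using energy_nonneg Ω ∅⟩
    | succ k ih =>
      intro hk
      obtain ⟨S, hS, hE⟩ := ih (by omega)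
      obtain ⟨T, hT, hlt⟩ := hcon S (hS.trans (by gcongr; omega))
      refine ⟨S ∪ T, (card_union_le S T).trans (by linarith), ?_⟩
      push_cast
      linarith
  obtain ⟨S, hS, hE⟩ := key m le_rfl
  obtain ⟨T, hT, hlt⟩ := hcon S hS
  have h1 := energy_le Ω (S ∪ T)
  have h2 : 0 ≤ M / m := by positivity
  rw [mul_div_cancel₀ _ hm'.ne'] at hE
  linarith

lemma sum_discrepancy_le {κ α : Type*} [Fintype κ] (Ω : Finset (ι → C)) (S : Finset ι)
    (V : κ → Finset ι) (Q : ℝ) (hV : ∀ k, energy Ω (S ∪ V k) - energy Ω S ≤ Q)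
    (I : Finset α) (T : α → Finset ι) (z : α → ι) (k : α → κ) (hT : ∀ a ∈ I, T a ⊆ V (k a))
    (hinj : Set.InjOn (fun a => (k a, z a)) I) :
    ∑ a ∈ I, discrepancy Ω S (T a) (z a) ≤ Fintype.card κ * Q := by
  classical
  calc ∑ a ∈ I, discrepancy Ω S (T a) (z a)
      ≤ ∑ a ∈ I, discrepancy Ω S (V (k a)) (z a) :=
        sum_le_sum fun a ha => discrepancy_mono Ω S (hT a ha) _
    _ = ∑ p ∈ I.image (fun a => (k a, z a)), discrepancy Ω S (V p.1) p.2 := by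
        rw [sum_image hinj]
    _ ≤ ∑ p : κ × ι, discrepancy Ω S (V p.1) p.2 :=
        sum_le_sum_of_subset_of_nonneg (subset_univ _) fun _ _ _ => discrepancy_nonneg ..
    _ = ∑ k, (energy Ω (S ∪ V k) - energy Ω S) := by
        rw [Fintype.sum_prod_type]
        exact sum_congr rfl fun k _ => sum_discrepancy Ω S (V k)
    _ ≤ ∑ _k : κ, Q := sum_le_sum fun k _ => hV k
    _ = Fintype.card κ * Q := by simp

omit [Fintype C] [Fintype ι] in
lemma fiber_fiber (Ω : Finset (ι → C)) (S T : Finset ι) {f₀ f : ι → C} (hf : f ∈ fiber Ω S f₀) :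
    fiber (fiber Ω S f₀) T f = fiber Ω (S ∪ T) f := by
  ext g
  simp only [mem_fiber, mem_union, or_imp, forall_and, and_assoc]
  refine and_congr_right fun _ => and_congr_left fun _ => forall₂_congr fun i hi => ?_
  rw [(mem_fiber.1 hf).2 i hi]

omit [Fintype ι] in
lemma discrepancy_fiber (Ω : Finset (ι → C)) (S T : Finset ι) (f₀ : ι → C) (z : ι) :
    discrepancy (fiber Ω S f₀) ∅ T z = ∑ f ∈ fiber Ω S f₀, ∑ c,
      (condProb Ω (S ∪ T) z c f - condProb Ω S z c f) ^ 2 := by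
  rw [discrepancy, sum_comm]
  refine sum_congr rfl fun f hf => sum_congr rfl fun c _ => ?_
  simp only [condProb, fiber_fiber Ω S _ hf, empty_union, union_empty]

omit [Fintype ι] in
/-- Some fiber of the restriction to `S` is both large and of at most average weight. -/
lemma exists_fiber_weight_le (Ω : Finset (ι → C)) (hΩ : Ω.Nonempty) (S : Finset ι)
    (W : (ι → C) → ℝ) (hW : ∀ f, 0 ≤ W f) (Q : ℝ) (hQ : 0 < Q) (hsum : ∑ f ∈ Ω, W f ≤ Q * #Ω) :
    ∃ f₀ ∈ Ω, (#Ω : ℝ) ≤ 2 * (Fintype.card C : ℝ) ^ #S * #(fiber Ω S f₀) ∧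
      ∑ f ∈ fiber Ω S f₀, W f ≤ 2 * Q * #(fiber Ω S f₀) := by
  set h : (ι → C) → ℝ := fun f => 1 - W f / (2 * Q) with hh
  have hcard : (0 : ℝ) < #Ω := by exact_mod_cast hΩ.card_pos
  obtain ⟨f₁, hf₁⟩ := hΩ
  have hne : Nonempty (S → C) := ⟨fun i => f₁ i⟩
  have hpow : (0 : ℝ) < (Fintype.card C : ℝ) ^ #S := by
    have := Fintype.card_pos (α := S → C)
    rw [Fintype.card_fun, Fintype.card_coe] at this
    exact_mod_cast this
  have h1 : ∑ s : S → C, ∑ f ∈ Ω with (fun i : S => f i) = s, h f = ∑ f ∈ Ω, h f :=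
    sum_fiberwise _ _ _
  have h2 : (#Ω : ℝ) / 2 ≤ ∑ f ∈ Ω, h f := by
    simp only [hh, sum_sub_distrib, ← sum_div]
    have : (∑ f ∈ Ω, W f) / (2 * Q) ≤ (Q * #Ω) / (2 * Q) := by gcongr
    have h3 : (Q * #Ω) / (2 * Q) = (#Ω : ℝ) / 2 := by field_simp
    simp only [sum_const, nsmul_eq_mul, mul_one]
    linarith
  have h3 : ∑ _s : S → C, (#Ω : ℝ) / (2 * (Fintype.card C : ℝ) ^ #S) = #Ω / 2 := by
    simp only [sum_const, nsmul_eq_mul, card_univ, Fintype.card_fun, Fintype.card_coe]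
    push_cast
    field_simp
  obtain ⟨s, -, hs⟩ := exists_le_of_sum_le (s := univ) univ_nonempty
    ((h3.trans_le h2).trans_eq h1.symm)
  have hpos : 0 < ∑ f ∈ Ω with (fun i : S => f i) = s, h f := lt_of_lt_of_le (by positivity) hs
  obtain ⟨f₀, hf₀⟩ := nonempty_of_sum_ne_zero hpos.ne'
  rw [mem_filter] at hf₀
  have hF : {f ∈ Ω | (fun i : S => f i) = s} = fiber Ω S f₀ := by
    ext g
    simp only [mem_filter, mem_fiber, ← hf₀.2, funext_iff, Subtype.forall]
  rw [hF] at hs hpos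
  simp only [hh, sum_sub_distrib, ← sum_div, sum_const, nsmul_eq_mul, mul_one] at hs hpos
  have h4 : 0 ≤ (∑ f ∈ fiber Ω S f₀, W f) / (2 * Q) :=
    div_nonneg (sum_nonneg fun f _ => hW f) (by positivity)
  refine ⟨f₀, hf₀.1, ?_, ?_⟩
  · have : (#Ω : ℝ) / (2 * (Fintype.card C : ℝ) ^ #S) ≤ #(fiber Ω S f₀) := by linarith
    rw [div_le_iff₀ (by positivity)] at this
    linarith
  · have : (∑ f ∈ fiber Ω S f₀, W f) / (2 * Q) ≤ #(fiber Ω S f₀) := by linarith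
    rw [div_le_iff₀ (by positivity)] at this
    linarith

omit [Fintype ι] in
lemma exists_fiber_discrepancy_le {α : Type*} (Ω : Finset (ι → C)) (hΩ : Ω.Nonempty)
    (S : Finset ι) (I : Finset α) (T T' : α → Finset ι) (z z' : α → ι) (Q : ℝ) (hQ : 0 < Q)
    (hsum : ∑ a ∈ I, (discrepancy Ω S (T a) (z a) + discrepancy Ω S (T' a) (z' a)) ≤ Q * #Ω) :
    ∃ f₀ ∈ Ω, (#Ω : ℝ) ≤ 2 * (Fintype.card C : ℝ) ^ #S * #(fiber Ω S f₀) ∧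
      ∑ a ∈ I, (discrepancy (fiber Ω S f₀) ∅ (T a) (z a) +
        discrepancy (fiber Ω S f₀) ∅ (T' a) (z' a)) ≤ 2 * Q * #(fiber Ω S f₀) := by
  set W : (ι → C) → ℝ := fun f => ∑ a ∈ I,
    (∑ c, (condProb Ω (S ∪ T a) (z a) c f - condProb Ω S (z a) c f) ^ 2 +
      ∑ c, (condProb Ω (S ∪ T' a) (z' a) c f - condProb Ω S (z' a) c f) ^ 2) with hW
  have h1 : ∑ f ∈ Ω, W f ≤ Q * #Ω := by
    refine le_trans (le_of_eq ?_) hsum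
    rw [hW, sum_comm]
    refine sum_congr rfl fun a _ => ?_
    rw [sum_add_distrib, discrepancy, discrepancy, sum_comm (s := Ω), sum_comm (s := Ω)]
  obtain ⟨f₀, hf₀, hcard, hle⟩ := exists_fiber_weight_le Ω hΩ S W
    (fun f => by rw [hW]; positivity) Q hQ h1
  refine ⟨f₀, hf₀, hcard, le_trans (le_of_eq ?_) hle⟩
  rw [hW, sum_comm]
  refine sum_congr rfl fun a _ => ?_
  rw [sum_add_distrib, discrepancy_fiber, discrepancy_fiber]

/-- The proportion of colorings in `F` that give `x` the color `c`. -/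
noncomputable def prob (F : Finset (ι → C)) (x : ι) (c : C) : ℝ :=
  (#{g ∈ F | g x = c} : ℝ) / #F

/-- The colors that `x` receives in a proportion at least `τ` of the colorings in `F`. -/
noncomputable def palette (F : Finset (ι → C)) (τ : ℝ) (x : ι) : Finset C :=
  {c | τ ≤ prob F x c}

omit [DecidableEq ι] [Fintype C] [Fintype ι] in
lemma condProb_empty (F : Finset (ι → C)) (x : ι) (c : C) (f : ι → C) :
    condProb F ∅ x c f = prob F x c := by
  simp [condProb, prob, fiber]

omit [DecidableEq ι] [Fintype ι] in
lemma mem_palette {F : Finset (ι → C)} {τ : ℝ} {x : ι} {c : C} :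
    c ∈ palette F τ x ↔ τ ≤ prob F x c := by
  simp [palette]

omit [Fintype ι] in
lemma mul_sq_le_discrepancy (F : Finset (ι → C)) (T : Finset ι) (z : ι) (c : C)
    (G : Finset (ι → C)) (hG : G ⊆ F) (a : ℝ) (ha : 0 ≤ a)
    (h : ∀ f ∈ G, a ≤ prob F z c - condProb F T z c f) :
    #G * a ^ 2 ≤ discrepancy F ∅ T z := by
  calc (#G : ℝ) * a ^ 2 = ∑ f ∈ G, a ^ 2 := by simp
    _ ≤ ∑ f ∈ G, (condProb F (∅ ∪ T) z c f - condProb F ∅ z c f) ^ 2 := by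
        refine sum_le_sum fun f hf => ?_
        rw [empty_union, condProb_empty, ← neg_sq (condProb F T z c f - _), neg_sub]
        exact pow_le_pow_left₀ ha (h f hf) 2
    _ ≤ ∑ f ∈ F, (condProb F (∅ ∪ T) z c f - condProb F ∅ z c f) ^ 2 :=
        sum_le_sum_of_subset_of_nonneg hG fun _ _ _ => sq_nonneg _
    _ ≤ discrepancy F ∅ T z :=
        single_le_sum (f := fun c => ∑ f ∈ F,
          (condProb F (∅ ∪ T) z c f - condProb F ∅ z c f) ^ 2)
          (fun c _ => sum_nonneg fun _ _ => sq_nonneg _) (mem_univ c)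

omit [Fintype ι] in
/-- A triple that never becomes rainbow although its palettes would allow it has large
discrepancy. -/
lemma le_discrepancy_of_palette (F : Finset (ι → C)) {τ : ℝ} (hτ : 0 < τ) (hτ1 : τ ≤ 1)
    {x y z : ι} (hF : ∀ f ∈ F, ¬(f x ≠ f y ∧ f x ≠ f z ∧ f y ≠ f z))
    (hx : 2 ≤ #(palette F τ x)) (hy : (palette F τ y).Nonempty) (hz : 3 ≤ #(palette F τ z)) :
    τ ^ 4 / 4 * #F ≤ discrepancy F ∅ {x, y} z + discrepancy F ∅ {y} x := by
  obtain ⟨c₂, hc₂⟩ := hy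
  obtain ⟨c₁, hc₁, h12⟩ := exists_mem_ne (by omega : 1 < #(palette F τ x)) c₂
  obtain ⟨c₃, hc₃, h3⟩ := exists_mem_notMem_of_card_lt_card
    (s := {c₁, c₂}) (t := palette F τ z) ((card_le_two).trans_lt (by omega))
  simp only [mem_insert, mem_singleton, not_or] at h3
  rw [mem_palette] at hc₁ hc₂ hc₃
  set Y : Finset (ι → C) := {g ∈ F | g y = c₂} with hY
  set G : Finset (ι → C) := {g ∈ Y | g x = c₁} with hG
  have hYF : Y ⊆ F := filter_subset _ _
  have hGF : G ⊆ F := (filter_subset _ _).trans hYF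
  have hfY : ∀ f ∈ Y, fiber F {y} f = Y := by
    intro f hf
    ext g
    simp only [mem_fiber, hY, mem_filter, mem_singleton, forall_eq, (mem_filter.1 hf).2]
  have hD1 : #G * τ ^ 2 ≤ discrepancy F ∅ {x, y} z := by
    refine mul_sq_le_discrepancy F _ z c₃ G hGF τ hτ.le fun f hf => ?_
    have h0 : condProb F {x, y} z c₃ f = 0 := by
      rw [condProb, div_eq_zero_iff]
      left
      simp only [Nat.cast_eq_zero, card_eq_zero, filter_eq_empty_iff, mem_fiber, mem_insert,
        mem_singleton, forall_eq_or_imp, forall_eq]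
      rintro g ⟨hgF, hgx, hgy⟩ hgz
      simp only [hG, hY, mem_filter] at hf
      refine hF g hgF ⟨?_, ?_, ?_⟩
      · rw [hgx, hgy, hf.2, hf.1.2]; exact h12
      · rw [hgx, hf.2, hgz]; exact Ne.symm h3.1
      · rw [hgy, hf.1.2, hgz]; exact Ne.symm h3.2
    rw [h0]; linarith
  have hD2 : 0 ≤ discrepancy F ∅ {y} x := discrepancy_nonneg ..
  have hD1' : 0 ≤ discrepancy F ∅ {x, y} z := discrepancy_nonneg ..
  have hF0 : (0 : ℝ) < #F := by
    rcases eq_empty_or_nonempty F with rfl | h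
    · simp [prob] at hc₂; linarith
    · exact_mod_cast h.card_pos
  have hYc : τ * #F ≤ #Y := by rwa [prob, le_div_iff₀ hF0] at hc₂
  have hY0 : (0 : ℝ) < #Y := lt_of_lt_of_le (by positivity) hYc
  by_cases hsmall : (#G : ℝ) ≤ τ / 2 * #Y
  · have h2 : #Y * (τ / 2) ^ 2 ≤ discrepancy F ∅ {y} x := by
      refine mul_sq_le_discrepancy F _ x c₁ Y hYF (τ / 2) (by positivity) fun f hf => ?_
      have : condProb F {y} x c₁ f ≤ τ / 2 := by
        rw [condProb, hfY f hf, div_le_iff₀ hY0]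
        exact hsmall
      linarith
    have h3 : τ * #F * (τ / 2) ^ 2 ≤ #Y * (τ / 2) ^ 2 := by gcongr
    have h4 : τ ^ 4 ≤ τ ^ 3 := pow_le_pow_of_le_one hτ.le hτ1 (by norm_num)
    have h5 : τ ^ 4 * (#F : ℝ) ≤ τ ^ 3 * #F := by gcongr
    nlinarith
  · push Not at hsmall
    have h3 : τ / 2 * (τ * #F) * τ ^ 2 ≤ #G * τ ^ 2 := by
      gcongr
      exact le_trans (by gcongr) hsmall.le
    have h4 : 0 ≤ τ ^ 4 * (#F : ℝ) := by positivity
    nlinarith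

omit [DecidableEq ι] [Fintype ι] in
lemma palette_nonempty (F : Finset (ι → C)) (hF : F.Nonempty) {τ : ℝ}
    (hτ : τ * Fintype.card C ≤ 1) (x : ι) : (palette F τ x).Nonempty := by
  have hF0 : (0 : ℝ) < #F := by exact_mod_cast hF.card_pos
  have hsum : ∑ c, prob F x c = 1 := by
    simp only [prob, ← sum_div]
    rw [div_eq_one_iff_eq hF0.ne']
    exact_mod_cast (card_eq_sum_card_fiberwise (f := fun g : ι → C => g x) (t := univ)
      (fun _ _ => by simp)).symm
  obtain ⟨f, hf⟩ := hF
  by_contra hcon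
  rw [not_nonempty_iff_eq_empty] at hcon
  have hlt : ∀ c, prob F x c < τ := by
    intro c
    by_contra! h
    have := mem_palette.2 h
    simp [hcon] at this
  have : ∑ c, prob F x c < ∑ _c : C, τ :=
    sum_lt_sum_of_nonempty ⟨f x, mem_univ _⟩ fun c _ => hlt c
  simp only [sum_const, card_univ, nsmul_eq_mul] at this
  linarith

omit [DecidableEq C] in
/-- The Gibbs inequality for the uniform distribution on `F` and a product distribution. -/
lemma sum_log_le (F : Finset (ι → C)) (hF : F.Nonempty) (q : ι → C → ℝ)
    (hq0 : ∀ x c, 0 < q x c) (hqsum : ∀ x, ∑ c, q x c = 1) :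
    ∑ f ∈ F, ∑ x, Real.log (q x (f x)) ≤ #F * -Real.log #F := by
  have hN : (0 : ℝ) < #F := by exact_mod_cast hF.card_pos
  have hw : ∑ f ∈ F, ∏ x, q x (f x) ≤ 1 := by
    calc ∑ f ∈ F, ∏ x, q x (f x) ≤ ∑ f : ι → C, ∏ x, q x (f x) :=
          sum_le_sum_of_subset_of_nonneg (subset_univ _) fun f _ _ =>
            prod_nonneg fun x _ => (hq0 x _).le
      _ = ∏ x, ∑ c, q x c := by
          rw [Finset.prod_univ_sum, Fintype.piFinset_univ]
      _ = 1 := by simp [hqsum]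
  have h1 : ∀ f ∈ F, ∑ x, Real.log (q x (f x)) + Real.log #F ≤ (∏ x, q x (f x)) * #F - 1 := by
    intro f _
    have hp : 0 < ∏ x, q x (f x) := prod_pos fun x _ => hq0 x _
    rw [← Real.log_prod fun x _ => (hq0 x _).ne', ← Real.log_mul hp.ne' hN.ne']
    exact Real.log_le_sub_one_of_pos (by positivity)
  have h2 := sum_le_sum h1
  rw [sum_add_distrib, sum_sub_distrib, ← sum_mul] at h2
  simp only [sum_const, nsmul_eq_mul, mul_one] at h2
  have h3 := mul_le_mul_of_nonneg_right hw hN.le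
  linarith

/-- A family of colorings is at most as large as its palettes allow, up to a small factor. -/
lemma log_card_le (F : Finset (ι → C)) (hF : F.Nonempty) {τ : ℝ} (hτ0 : 0 < τ) (hτ1 : τ < 1)
    (hτ : τ * Fintype.card C ≤ 1) :
    Real.log #F ≤ ∑ x, Real.log #(palette F τ x) + Fintype.card ι *
      (-Real.log (1 - τ) + Fintype.card C * τ * Real.log (Fintype.card C / τ)) := by
  set r : ℝ := (Fintype.card C : ℝ) with hr
  have hN : (0 : ℝ) < #F := by exact_mod_cast hF.card_pos
  obtain ⟨f₁, hf₁⟩ := hF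
  rcases isEmpty_or_nonempty ι with hι | ⟨⟨i₀⟩⟩
  · have : #F ≤ 1 := card_le_one.2 fun a _ b _ => Subsingleton.elim a b
    have : (#F : ℝ) ≤ 1 := by exact_mod_cast this
    simpa using Real.log_nonpos hN.le this
  have hr1 : 1 ≤ r := by
    have : 0 < Fintype.card C := Fintype.card_pos_iff.2 ⟨f₁ i₀⟩
    rw [hr]
    exact_mod_cast this
  have hr0 : 0 < r := by linarith
  have hk : ∀ x, (1 : ℝ) ≤ #(palette F τ x) := fun x => by
    exact_mod_cast (palette_nonempty F ⟨f₁, hf₁⟩ hτ x).card_pos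
  set L : ℝ := Real.log (r / τ) with hL
  have hL0 : 0 ≤ L := Real.log_nonneg (by rw [le_div_iff₀ hτ0]; linarith)
  set q : ι → C → ℝ := fun x c =>
    (if c ∈ palette F τ x then (1 - τ) / #(palette F τ x) else 0) + τ / r with hq
  have h1τ : 0 < 1 - τ := by linarith
  have hq0 : ∀ x c, 0 < q x c := by
    intro x c
    have : 0 ≤ (if c ∈ palette F τ x then (1 - τ) / #(palette F τ x) else 0 : ℝ) := by
      split_ifs <;> positivity
    have h2 : 0 < τ / r := by positivity
    simp only [hq]; linarith
  have hqsum : ∀ x, ∑ c, q x c = 1 := by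
    intro x
    have := hk x
    simp only [hq, sum_add_distrib, sum_ite_mem, univ_inter, sum_const, nsmul_eq_mul, card_univ,
      ← hr]
    field_simp
    ring
  have hlog := sum_log_le F ⟨f₁, hf₁⟩ q hq0 hqsum
  have hlow : ∀ x c, -Real.log #(palette F τ x) + Real.log (1 - τ)
      - (if c ∈ palette F τ x then 0 else L) ≤ Real.log (q x c) := by
    intro x c
    have hkx := hk x
    split_ifs with hc
    · have : (1 - τ) / #(palette F τ x) ≤ q x c := by
        simp only [hq, if_pos hc]
        have h2 : 0 < τ / r := by positivity
        linarith
      have := Real.log_le_log (by positivity) this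
      rw [Real.log_div h1τ.ne' (by positivity)] at this
      linarith
    · have h3 : q x c = (r / τ)⁻¹ := by simp [hq, if_neg hc]
      rw [h3, Real.log_inv]
      have := Real.log_nonneg hkx
      have := Real.log_nonpos h1τ.le (by linarith)
      linarith
  have hout : ∀ x, ∑ f ∈ F, (if f x ∈ palette F τ x then 0 else L) ≤ #F * (r * τ * L) := by
    intro x
    have h1 : ∑ f ∈ F, (if f x ∈ palette F τ x then 0 else L) =
        ∑ c, #{f ∈ F | f x = c} * (if c ∈ palette F τ x then 0 else L) := by
      rw [← sum_fiberwise F (fun f => f x)]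
      refine sum_congr rfl fun c _ => ?_
      rw [sum_congr rfl (g := fun _ => (if c ∈ palette F τ x then 0 else L))]
      · simp
      · intro f hf
        rw [(mem_filter.1 hf).2]
    have h2 : ∀ c, #{f ∈ F | f x = c} * (if c ∈ palette F τ x then 0 else L) ≤ #F * τ * L := by
      intro c
      split_ifs with hc
      · rw [mul_zero]; positivity
      · rw [mem_palette, prob, not_le, div_lt_iff₀ hN] at hc
        gcongr
        linarith
    rw [h1]
    refine (sum_le_sum fun c _ => h2 c).trans (le_of_eq ?_)
    simp only [sum_const, nsmul_eq_mul, card_univ, ← hr]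
    ring
  have hmain : ∑ x, (#F * (-Real.log #(palette F τ x) + Real.log (1 - τ) - r * τ * L)) ≤
      ∑ f ∈ F, ∑ x, Real.log (q x (f x)) := by
    rw [sum_comm]
    refine sum_le_sum fun x _ => ?_
    have := sum_le_sum fun f (_ : f ∈ F) => hlow x (f x)
    rw [sum_sub_distrib] at this
    simp only [sum_const, nsmul_eq_mul] at this
    have := hout x
    linarith
  rw [← mul_sum] at hmain
  have h5 := hmain.trans hlog
  rw [mul_le_mul_iff_right₀ hN] at h5
  simp only [sum_sub_distrib, sum_add_distrib, sum_neg_distrib, sum_const, nsmul_eq_mul,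
    card_univ] at h5
  linarith

end Energy

/-- The solutions of `x + y = z` in `A`, as triples `(x, y, z)`. -/
def schurTriples (A : Finset ℕ) : Finset (A × A × A) :=
  {t | (t.1 : ℕ) + t.2.1 = t.2.2}

lemma mem_schurTriples {A : Finset ℕ} {t : A × A × A} :
    t ∈ schurTriples A ↔ (t.1 : ℕ) + t.2.1 = t.2.2 := by
  simp [schurTriples]

/-- The elements of `A` in a given block of length `K` or a given residue class modulo `K`. -/
def blockUnionClass (A : Finset ℕ) (K u t : ℕ) : Finset A :=
  {i | (i : ℕ) / K = u ∨ (i : ℕ) % K = t}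

lemma card_blockUnionClass_le {A : Finset ℕ} {n : ℕ} (hA : A ⊆ Icc 1 n) {K : ℕ} (hK : 0 < K)
    (u t : ℕ) : #(blockUnionClass A K u t) ≤ K + (n / K + 1) := by
  have hext : ∀ i j : A, (i : ℕ) / K = (j : ℕ) / K → (i : ℕ) % K = (j : ℕ) % K → i = j := by
    intro i j h1 h2
    rw [Subtype.ext_iff, ← Nat.div_add_mod (i : ℕ) K, ← Nat.div_add_mod (j : ℕ) K, h1, h2]
  rw [blockUnionClass, filter_or]
  refine (card_union_le _ _).trans (add_le_add ?_ ?_)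
  · refine (card_le_card_of_injOn (t := range K) (fun i : A => (i : ℕ) % K) ?_ ?_).trans_eq
      (card_range K)
    · intro i _
      simpa using Nat.mod_lt _ hK
    · intro i hi j hj h
      simp only [coe_filter, mem_univ, true_and, Set.mem_ofPred_eq] at hi hj
      exact hext i j (hi.trans hj.symm) h
  · refine (card_le_card_of_injOn (t := range (n / K + 1)) (fun i : A => (i : ℕ) / K)
      ?_ ?_).trans_eq (card_range _)
    · intro i _
      simpa [Nat.lt_succ_iff] using Nat.div_le_div_right (c := K) (mem_Icc.1 (hA i.2)).2
    · intro i hi j hj h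
      simp only [coe_filter, mem_univ, true_and, Set.mem_ofPred_eq] at hi hj
      exact hext i j h (hi.trans hj.symm)

lemma card_le_of_subset_Icc {A : Finset ℕ} {n : ℕ} (hA : A ⊆ Icc 1 n) : #A ≤ n := by
  simpa using card_le_card hA

/-- Every family of colorings contains a large subfamily in which the colors of most Schur
triples are nearly independent. -/
lemma exists_subfamily_discrepancy_le {r n K m : ℕ} (hr : 0 < r) (hn : 0 < n) (hK : 0 < K)
    (hm : 0 < m) (hKn : K ≤ n) {A : Finset ℕ} (hA : A ⊆ Icc 1 n) (Ω : Finset (A → Fin r))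
    (hΩ : Ω.Nonempty) :
    ∃ F ⊆ Ω, F.Nonempty ∧ (#Ω : ℝ) ≤ 2 * (r : ℝ) ^ (m * (K + (n / K + 1))) * #F ∧
      ∑ t ∈ schurTriples A, (discrepancy F ∅ {t.1, t.2.1} t.2.2 + discrepancy F ∅ {t.2.1} t.1) ≤
        6 * r * n ^ 2 / m * #F := by
  obtain ⟨S, hScard, hS⟩ := exists_energy_stable Ω m (K + (n / K + 1)) hm
  set Q : ℝ := Fintype.card A * Fintype.card (Fin r) * #Ω / m with hQ
  have hAn : (Fintype.card A : ℝ) ≤ n := by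
    rw [Fintype.card_coe]
    exact_mod_cast card_le_of_subset_Icc hA
  have hQn : Q ≤ n * r * #Ω / m := by
    rw [hQ, Fintype.card_fin]
    gcongr
  have hQ0 : 0 ≤ Q := by positivity
  have h1 : ∑ t ∈ schurTriples A, discrepancy Ω S {t.1, t.2.1} t.2.2 ≤ 2 * n * Q := by
    refine (sum_discrepancy_le Ω S
      (fun k : Fin (n / K + 1) × Fin K => blockUnionClass A K k.1 k.2) Q
      (fun k => hS _ (card_blockUnionClass_le hA hK _ _)) (schurTriples A) _ _
      (fun t => (⟨(t.1 : ℕ) / K, Nat.lt_succ_of_le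
        (Nat.div_le_div_right (mem_Icc.1 (hA t.1.2)).2)⟩, ⟨(t.2.1 : ℕ) % K, Nat.mod_lt _ hK⟩))
      ?_ ?_).trans ?_
    · intro t _ i hi
      simp only [mem_insert, mem_singleton] at hi
      rcases hi with rfl | rfl <;> simp [blockUnionClass]
    · rintro ⟨x, y, z⟩ ht ⟨x', y', z'⟩ ht' h
      rw [mem_coe, mem_schurTriples] at ht ht'
      simp only [Prod.mk.injEq, Fin.mk.injEq] at h ht ht'
      obtain ⟨⟨hx, hy⟩, rfl⟩ := h
      have hmod : (x : ℕ) % K = (x' : ℕ) % K :=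
        Nat.ModEq.add_right_cancel (n := K) hy (by rw [ht, ht'])
      have hxx : (x : ℕ) = x' := by
        rw [← Nat.div_add_mod (x : ℕ) K, ← Nat.div_add_mod (x' : ℕ) K, hx, hmod]
      have hyy : (y : ℕ) = y' := by omega
      simp [Subtype.ext_iff, hxx, hyy]
    · refine mul_le_mul_of_nonneg_right ?_ hQ0
      rw [Fintype.card_prod, Fintype.card_fin, Fintype.card_fin]
      have : (n / K + 1) * K ≤ 2 * n := by
        have := Nat.div_mul_le_self n K
        nlinarith
      exact_mod_cast this
  have h2 : ∑ t ∈ schurTriples A, discrepancy Ω S {t.2.1} t.1 ≤ n * Q := by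
    refine (sum_discrepancy_le Ω S (fun y : A => {y}) Q (fun y => hS _ ?_) (schurTriples A) _ _
      (fun t => t.2.1) (fun _ _ => Subset.rfl) ?_).trans (by gcongr)
    · rw [card_singleton]; exact le_trans hK (Nat.le_add_right K _)
    · rintro ⟨x, y, z⟩ ht ⟨x', y', z'⟩ ht' h
      rw [mem_coe, mem_schurTriples] at ht ht'
      simp only [Prod.mk.injEq] at h ht ht'
      obtain ⟨rfl, rfl⟩ := h
      simp [Subtype.ext_iff, ← ht, ← ht']
  have hnr : (0 : ℝ) < n ∧ (0 : ℝ) < r ∧ (0 : ℝ) < m :=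
    ⟨by exact_mod_cast hn, by exact_mod_cast hr, by exact_mod_cast hm⟩
  obtain ⟨f₀, hf₀, hcard, hle⟩ := exists_fiber_discrepancy_le Ω hΩ S (schurTriples A)
    (fun t => {t.1, t.2.1}) (fun t => {t.2.1}) (fun t => t.2.2) (fun t => t.1)
    (3 * r * n ^ 2 / m) (by have := hnr.1; have := hnr.2.1; have := hnr.2.2; positivity) (by
      rw [sum_add_distrib]
      calc _ ≤ 2 * n * Q + n * Q := add_le_add h1 h2
        _ = 3 * n * Q := by ring
        _ ≤ 3 * n * (n * r * #Ω / m) := by gcongr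
        _ = 3 * r * n ^ 2 / m * #Ω := by ring)
  refine ⟨fiber Ω S f₀, fiber_subset .., ⟨f₀, mem_fiber.2 ⟨hf₀, fun _ _ => rfl⟩⟩,
    hcard.trans ?_, hle.trans (le_of_eq (by ring))⟩
  rw [Fintype.card_fin]
  gcongr
  exact_mod_cast hr

/-- The colorings `f` of `A` without rainbow sums. -/
def rainbowSumFree (r : ℕ) (A : Finset ℕ) : Finset (A → Fin r) :=
  {f | ∀ x y z : A, (x : ℕ) + (y : ℕ) = (z : ℕ) → ¬(f x ≠ f y ∧ f x ≠ f z ∧ f y ≠ f z)}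

lemma numRSF_eq_card (r : ℕ) (A : Finset ℕ) : numRSF r A = #(rainbowSumFree r A) := by
  exact Nat.subtype_card _ fun f => by
    rw [rainbowSumFree, mem_filter]
    exact and_iff_right (mem_univ f)

/-- In a family of rainbow sum-free colorings of small discrepancy, few Schur triples have
palettes that allow a rainbow coloring. -/
lemma card_schurTriples_palette_le {r : ℕ} {A : Finset ℕ} (F : Finset (A → Fin r))
    (hFr : F ⊆ rainbowSumFree r A) (hF : F.Nonempty) {τ : ℝ} (hτ0 : 0 < τ) (hτ1 : τ ≤ 1)
    (hτ : τ * r ≤ 1) {Q : ℝ}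
    (hQ : ∑ t ∈ schurTriples A, (discrepancy F ∅ {t.1, t.2.1} t.2.2 + discrepancy F ∅ {t.2.1} t.1)
      ≤ Q * #F) :
    (#{t ∈ schurTriples A | 2 ≤ #(palette F τ t.1) ∧ 3 ≤ #(palette F τ t.2.2)} : ℝ) ≤
      4 * Q / τ ^ 4 := by
  have hF0 : (0 : ℝ) < #F := by exact_mod_cast hF.card_pos
  set I := {t ∈ schurTriples A | 2 ≤ #(palette F τ t.1) ∧ 3 ≤ #(palette F τ t.2.2)} with hI
  have h1 : ∑ t ∈ I, τ ^ 4 / 4 * #F ≤ Q * #F := by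
    refine le_trans ?_ ((sum_le_sum_of_subset_of_nonneg
      (hI ▸ filter_subset _ _ : I ⊆ schurTriples A)
      fun t _ _ => add_nonneg (discrepancy_nonneg ..) (discrepancy_nonneg ..)).trans hQ)
    refine sum_le_sum fun t ht => ?_
    rw [mem_filter, mem_schurTriples] at ht
    refine le_discrepancy_of_palette F hτ0 hτ1 (fun f hf => ?_) ht.2.1
      (palette_nonempty F hF (by simpa using hτ) _) ht.2.2
    exact (mem_filter.1 (hFr hf)).2 _ _ _ ht.1
  rw [sum_const, nsmul_eq_mul, ← mul_assoc, mul_le_mul_iff_left₀ hF0] at h1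
  rw [le_div_iff₀ (by positivity)]
  linarith

/-- The elements of `A` below `b` whose reflection `b - x` is not in `A` number at most `b / 2`,
and at most the size of the complement of `A`. -/
lemma card_asymmetric_le {A : Finset ℕ} {n b : ℕ} (hA : A ⊆ Icc 1 n) (hb : b ∈ A) :
    2 * #{x ∈ A | x < b ∧ b - x ∉ A} ≤ b ∧ #A + #{x ∈ A | x < b ∧ b - x ∉ A} ≤ n := by
  set U := {x ∈ A | x < b ∧ b - x ∉ A} with hU
  have hmem : ∀ x ∈ U, x ∈ A ∧ x < b ∧ b - x ∉ A := fun x hx => by simpa [hU] using hx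
  have hcard : #(U.image (b - ·)) = #U := by
    refine card_image_of_injOn fun x hx y hy h => ?_
    have := (hmem x hx).2.1
    have := (hmem y hy).2.1
    have : b - x = b - y := h
    omega
  have hdisj : Disjoint A (U.image (b - ·)) := by
    rw [disjoint_right]
    intro y hy
    obtain ⟨x, hx, rfl⟩ := mem_image.1 hy
    exact (hmem x hx).2.2
  have hbn := (mem_Icc.1 (hA hb)).2
  constructor
  · rw [two_mul]
    nth_rewrite 2 [← hcard]
    rw [← card_union_of_disjoint (hdisj.mono_left (filter_subset _ _))]
    refine (card_le_card (t := Icc 1 b) ?_).trans (by simp)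
    intro y hy
    rw [mem_Icc]
    rcases mem_union.1 hy with h | h
    · have := mem_Icc.1 (hA (hmem y h).1)
      have := (hmem y h).2.1
      omega
    · obtain ⟨x, hx, rfl⟩ := mem_image.1 h
      have := (hmem x hx).2.1
      omega
  · rw [← hcard, ← card_union_of_disjoint hdisj]
    refine card_le_of_subset_Icc (union_subset hA fun y hy => ?_)
    obtain ⟨x, hx, rfl⟩ := mem_image.1 hy
    have := (hmem x hx).2.1
    rw [mem_Icc]
    omega

/-- If almost no Schur triple in `A` has palette sizes allowing a rainbow coloring, then the
palettes are small on average. -/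
lemma sum_log_palette_le {A : Finset ℕ} {n r : ℕ} (hn : 0 < n) (hA : A ⊆ Icc 1 n) (k : ℕ → ℕ)
    (hk1 : ∀ x ∈ A, 1 ≤ k x) (hkr : ∀ x ∈ A, k x ≤ r) {ε γ : ℝ} (hγ : 0 < γ)
    (hcard : (1 / 2 + ε) * n ≤ #A) (hr : 2 * Real.log 2 ≤ Real.log r)
    (hbad : ((∑ b ∈ A with 3 ≤ k b, #{x ∈ A | x < b ∧ b - x ∈ A ∧ 2 ≤ k x} : ℕ) : ℝ) ≤
      γ ^ 2 * n ^ 2) :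
    ∑ x ∈ A, Real.log (k x) ≤ Real.log r * (2 * γ * n + 1) + n / 2 * Real.log r -
      ε * n * (Real.log r - 2 * Real.log 2) := by
  set L := Real.log r with hL
  set l := Real.log 2 with hl
  have hn0 : (0 : ℝ) < n := by exact_mod_cast hn
  have hl0 : 0 ≤ l := Real.log_nonneg (by norm_num)
  have hL0 : 0 ≤ L := by linarith
  have hkL : ∀ x ∈ A, Real.log (k x) ≤ L := fun x hx =>
    Real.log_le_log (by exact_mod_cast hk1 x hx) (by exact_mod_cast hkr x hx)
  have hk2 : ∀ x ∈ A, k x ≤ 2 → Real.log (k x) ≤ l := fun x hx h =>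
    Real.log_le_log (by exact_mod_cast hk1 x hx) (by exact_mod_cast h)
  set R : ℕ → Finset ℕ := fun b => {x ∈ A | x < b ∧ b - x ∈ A ∧ 2 ≤ k x} with hR
  set B : Finset ℕ := {b ∈ A | 3 ≤ k b ∧ γ * n < #(R b)} with hB
  have hBcard : (#B : ℝ) ≤ γ * n := by
    have h1 : ∑ b ∈ B, γ * n ≤ γ ^ 2 * n ^ 2 := by
      refine le_trans ?_ hbad
      push_cast
      refine (sum_le_sum fun b hb => ?_).trans (sum_le_sum_of_subset_of_nonneg
        (t := {b ∈ A | 3 ≤ k b}) (f := fun b => (#(R b) : ℝ)) (fun b hb => ?_)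
        fun _ _ _ => by positivity)
      · exact (mem_filter.1 hb).2.2.le
      · rw [mem_filter] at hb ⊢
        exact ⟨hb.1, hb.2.1⟩
    rw [sum_const, nsmul_eq_mul] at h1
    have h2 : 0 < γ * n := by positivity
    nlinarith
  have hAn : (#A : ℝ) ≤ n := by exact_mod_cast card_le_of_subset_Icc hA
  rcases eq_empty_or_nonempty {b ∈ A | 3 ≤ k b ∧ #(R b) ≤ γ * n} with hG | hG
  · have h1 : ∀ x ∈ A, Real.log (k x) ≤ (if x ∈ B then L else 0) + l := by
      intro x hx
      split_ifs with h
      · have := hkL x hx; linarith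
      · rw [zero_add]
        refine hk2 x hx ?_
        by_contra! h3
        have h4 : x ∉ {b ∈ A | 3 ≤ k b ∧ #(R b) ≤ γ * n} := by simp [hG]
        simp only [hB, mem_filter, hx, true_and, not_and, not_lt, not_le] at h h4
        exact absurd (h h3) (not_le.2 (h4 h3))
    have h2 := sum_le_sum h1
    rw [sum_add_distrib, sum_ite_mem, inter_eq_right.2 (filter_subset _ _)] at h2
    simp only [sum_const, nsmul_eq_mul] at h2
    have h3 : #B * L ≤ γ * n * L := by gcongr
    have h4 : #A * l ≤ n * l := by gcongr
    have h5 : 0 ≤ (1 / 2 - ε) * n * (L - 2 * l) := mul_nonneg (by linarith) (by linarith)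
    have h6 : 0 ≤ γ * n * L := by positivity
    nlinarith
  · obtain ⟨b, hbG, hbmax⟩ := exists_max_image _ id hG
    rw [mem_filter] at hbG
    obtain ⟨hbA, hb3, hbR⟩ := hbG
    obtain ⟨hu1, hu2⟩ := card_asymmetric_le hA hbA
    set U := {x ∈ A | x < b ∧ b - x ∉ A} with hU
    have h1 : ∀ x ∈ A, Real.log (k x) ≤ (if x ∈ B then L else 0) + (if x ∈ U then L else 0) +
        (if x ∈ R b then L else 0) + (if x = b then L else 0) +
        (if x ∈ ({x ∈ A | b < x} : Finset ℕ) then l else 0) := by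
      intro x hx
      have hxL := hkL x hx
      have p1 : 0 ≤ if x ∈ B then L else 0 := by split_ifs <;> simp [hL0]
      have p2 : 0 ≤ if x ∈ U then L else 0 := by split_ifs <;> simp [hL0]
      have p3 : 0 ≤ if x ∈ R b then L else 0 := by split_ifs <;> simp [hL0]
      have p4 : 0 ≤ if x = b then L else 0 := by split_ifs <;> simp [hL0]
      have p5 : 0 ≤ if x ∈ ({x ∈ A | b < x} : Finset ℕ) then l else 0 := by
        split_ifs <;> simp [hl0]
      by_cases hxB : x ∈ B
      · rw [if_pos hxB] at p1 ⊢; linarith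
      rcases lt_trichotomy x b with hlt | heq | hgt
      · by_cases hxU : x ∈ U
        · rw [if_pos hxU] at p2 ⊢; linarith
        have hxb : b - x ∈ A := by
          by_contra h
          exact hxU (by simp [hU, hx, hlt, h])
        by_cases hx2 : 2 ≤ k x
        · have : x ∈ R b := by simp [hR, hx, hlt, hxb, hx2]
          rw [if_pos this] at p3 ⊢; linarith
        · have : k x = 1 := by have := hk1 x hx; omega
          rw [this, Nat.cast_one, Real.log_one]
          linarith
      · rw [if_pos heq] at p4 ⊢; linarith
      · have : k x ≤ 2 := by
          by_contra! h3
          have h4 : x ∉ {b ∈ A | 3 ≤ k b ∧ #(R b) ≤ γ * n} := fun h =>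
            absurd (hbmax x h) (not_le.2 hgt)
          simp only [hB, mem_filter, hx, true_and, not_and, not_lt, not_le] at hxB h4
          exact absurd (hxB h3) (not_le.2 (h4 h3))
        have h5 := hk2 x hx this
        rw [if_pos (show x ∈ ({x ∈ A | b < x} : Finset ℕ) by simp [hx, hgt])] at p5 ⊢
        linarith
    have h2 := sum_le_sum h1
    rw [sum_add_distrib, sum_add_distrib, sum_add_distrib, sum_add_distrib,
      sum_ite_mem, inter_eq_right.2 (filter_subset _ _),
      sum_ite_mem, inter_eq_right.2 (filter_subset _ _),
      sum_ite_mem, inter_eq_right.2 (filter_subset _ _), sum_ite_eq' A b, if_pos hbA,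
      sum_ite_mem, inter_eq_right.2 (filter_subset _ _)] at h2
    simp only [sum_const, nsmul_eq_mul] at h2
    have h3 : (#{x ∈ A | b < x} : ℝ) ≤ n - b := by
      have : #{x ∈ A | b < x} ≤ #(Ioc b n) := card_le_card fun x hx => by
        rw [mem_filter] at hx
        exact mem_Ioc.2 ⟨hx.2, (mem_Icc.1 (hA hx.1)).2⟩
      rw [Nat.card_Ioc] at this
      rw [← Nat.cast_sub (mem_Icc.1 (hA hbA)).2]
      exact_mod_cast this
    have hu1' : 2 * (#U : ℝ) ≤ b := by exact_mod_cast hu1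
    have hu2' : (#A : ℝ) + #U ≤ n := by exact_mod_cast hu2
    have g1 : #B * L ≤ γ * n * L := by gcongr
    have g2 : #(R b) * L ≤ γ * n * L := by gcongr
    have g3 : (#{x ∈ A | b < x} : ℝ) * l ≤ (n - 2 * #U) * l := by
      gcongr; linarith
    have g4 : #U * (L - 2 * l) ≤ (1 / 2 - ε) * n * (L - 2 * l) :=
      mul_le_mul_of_nonneg_right (by linarith) (by linarith)
    linarith

/-- The error terms of `log_card_le` can be made arbitrarily small. -/
lemma exists_threshold {r : ℕ} (hr : 0 < r) {κ : ℝ} (hκ : 0 < κ) :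
    ∃ τ : ℝ, 0 < τ ∧ τ < 1 ∧ τ * r ≤ 1 ∧
      -Real.log (1 - τ) + r * τ * Real.log (r / τ) ≤ κ := by
  have hr0 : (0 : ℝ) < r := by exact_mod_cast hr
  have hcont : ContinuousAt (fun τ : ℝ => -Real.log (1 - τ) +
      r * (τ * Real.log r - τ * Real.log τ)) 0 := by
    have h1 : ContinuousAt (fun τ : ℝ => Real.log (1 - τ)) 0 :=
      ContinuousAt.log (by fun_prop) (by norm_num)
    have h2 := Real.continuous_mul_log.continuousAt (x := 0)
    have h3 : ContinuousAt (fun τ : ℝ => τ * Real.log r) 0 := by fun_prop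
    exact h1.neg.add ((h3.sub h2).const_mul _)
  have hev := hcont.eventually_lt (continuousAt_const (y := κ)) (by simpa using hκ)
  obtain ⟨η, hη, hball⟩ := Metric.eventually_nhds_iff.1 hev
  refine ⟨min (η / 2) (1 / (2 * r)), by positivity, ?_, ?_, ?_⟩
  · refine (min_le_right _ _).trans_lt ?_
    rw [div_lt_one (by positivity)]
    have : (1 : ℝ) ≤ r := by exact_mod_cast hr
    linarith
  · calc min (η / 2) (1 / (2 * r)) * r ≤ 1 / (2 * r) * r := by gcongr; exact min_le_right _ _
      _ ≤ 1 := by field_simp; norm_num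
  · set τ := min (η / 2) (1 / (2 * r) : ℝ) with hτ
    have hτ0 : 0 < τ := by positivity
    have hτη : τ < η := (min_le_left _ _).trans_lt (by linarith)
    have := @hball τ (by rwa [Real.dist_eq, sub_zero, abs_of_pos hτ0])
    rw [Real.log_div hr0.ne' hτ0.ne']
    have h2 : r * τ * (Real.log r - Real.log τ) = r * (τ * Real.log r - τ * Real.log τ) := by ring
    rw [h2]
    exact this.le

lemma sum_card_le_card_schurTriples {A : Finset ℕ} (p : A → ℕ) :
    ∑ b ∈ A with 3 ≤ (if h : b ∈ A then p ⟨b, h⟩ else 1),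
      #{x ∈ A | x < b ∧ b - x ∈ A ∧ 2 ≤ if h : x ∈ A then p ⟨x, h⟩ else 1} ≤
      #{t ∈ schurTriples A | 2 ≤ p t.1 ∧ 3 ≤ p t.2.2} := by
  set k : ℕ → ℕ := fun b => if h : b ∈ A then p ⟨b, h⟩ else 1 with hk
  have hpk : ∀ x : A, k x = p x := fun x => by simp [hk]
  rw [← card_sigma]
  refine card_le_card_of_surjOn (fun t => ⟨t.2.2, t.1⟩) ?_
  rintro ⟨b, x⟩ h
  simp only [coe_sigma, Set.mem_sigma_iff, mem_coe, mem_filter] at h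
  obtain ⟨⟨hb, hb3⟩, hx, hxb, hbx, hx2⟩ := h
  refine ⟨(⟨x, hx⟩, ⟨b - x, hbx⟩, ⟨b, hb⟩), ?_, rfl⟩
  simp only [mem_coe, mem_filter, mem_schurTriples]
  rw [dif_pos hb] at hb3
  rw [dif_pos hx] at hx2
  exact ⟨by omega, hx2, hb3⟩

lemma log_card_rainbowSumFree_le {r : ℕ} (hr : 5 ≤ r) {ε γ τ : ℝ} (hγ : 0 < γ) (hτ0 : 0 < τ)
    (hτ1 : τ < 1) (hτr : τ * r ≤ 1) {n K m : ℕ} (hn : 0 < n) (hK : 0 < K) (hKn : K ≤ n)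
    (hm : 0 < m) (hmγ : 24 * r / (γ ^ 2 * τ ^ 4) ≤ m) {A : Finset ℕ} (hA : A ⊆ Icc 1 n)
    (hcard : (1 / 2 + ε) * n ≤ #A) (hne : (rainbowSumFree r A).Nonempty) :
    Real.log #(rainbowSumFree r A) ≤ Real.log 2 + m * (K + (n / K + 1)) * Real.log r +
      (Real.log r * (2 * γ * n + 1) + n / 2 * Real.log r -
        ε * n * (Real.log r - 2 * Real.log 2)) +
      n * (-Real.log (1 - τ) + r * τ * Real.log (r / τ)) := by
  have hr0 : (0 : ℝ) < r := by positivity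
  have hr1 : (1 : ℝ) ≤ r := by exact_mod_cast (by omega : 1 ≤ r)
  have hm0 : (0 : ℝ) < m := by exact_mod_cast hm
  have hLr : 0 ≤ Real.log r := Real.log_nonneg hr1
  obtain ⟨F, hFr, hF, hΩ, hdisc⟩ := exists_subfamily_discrepancy_le (by omega : 0 < r) hn hK hm hKn
    hA (rainbowSumFree r A) hne
  have hF0 : (0 : ℝ) < #F := by exact_mod_cast hF.card_pos
  have hΩ0 : (0 : ℝ) < #(rainbowSumFree r A) := by exact_mod_cast hne.card_pos
  have h1 : Real.log #(rainbowSumFree r A) ≤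
      Real.log 2 + m * (K + (n / K + 1)) * Real.log r + Real.log #F := by
    refine (Real.log_le_log hΩ0 hΩ).trans ?_
    rw [Real.log_mul (by positivity) hF0.ne', Real.log_mul (by norm_num) (by positivity),
      Real.log_pow]
    push_cast
    gcongr
    exact Nat.cast_div_le
  have h2 := log_card_le F hF hτ0 hτ1 (by simpa using hτr)
  have h3 := card_schurTriples_palette_le F hFr hF hτ0 hτ1.le hτr hdisc
  have hpal : ∀ x, 1 ≤ #(palette F τ x) := fun x =>
    (palette_nonempty F hF (by simpa using hτr) x).card_pos
  set k : ℕ → ℕ := fun b => if h : b ∈ A then #(palette F τ ⟨b, h⟩) else 1 with hk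
  have h4 := sum_log_palette_le hn hA k
    (fun x hx => by simp only [hk, dif_pos hx]; exact hpal _)
    (fun x hx => by simp only [hk, dif_pos hx]; simpa using card_le_univ (palette F τ ⟨x, hx⟩))
    hγ hcard (r := r) (by
      rw [← Real.log_rpow (by norm_num)]
      refine Real.log_le_log (by positivity) ?_
      have : (5 : ℝ) ≤ r := by exact_mod_cast hr
      norm_num; linarith)
    (by
      refine (Nat.cast_le.2 (sum_card_le_card_schurTriples fun x => #(palette F τ x))).trans
        (h3.trans ?_)
      rw [div_le_iff₀ (by positivity)] at hmγ ⊢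
      rw [← mul_div_assoc, div_le_iff₀ hm0]
      have := mul_le_mul_of_nonneg_left hmγ (sq_nonneg (n : ℝ))
      linarith)
  have h5 : ∑ x : A, Real.log #(palette F τ x) = ∑ x ∈ A, Real.log (k x) := by
    rw [← sum_coe_sort A]
    refine sum_congr rfl fun x _ => ?_
    simp [hk]
  have h6 : 0 ≤ -Real.log (1 - τ) + r * τ * Real.log (r / τ) := by
    have a1 := Real.log_nonpos (by linarith : 0 ≤ 1 - τ) (by linarith)
    have a2 : 0 ≤ Real.log (r / τ) := Real.log_nonneg (by rw [le_div_iff₀ hτ0]; linarith)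
    have a3 : 0 ≤ r * τ * Real.log (r / τ) := by positivity
    linarith
  have h7 : (Fintype.card A : ℝ) ≤ n := by
    rw [Fintype.card_coe]
    exact_mod_cast card_le_of_subset_Icc hA
  have h8 := mul_le_mul_of_nonneg_right h7 h6
  rw [Fintype.card_fin, h5] at h2
  linarith

end RainbowSum

open RainbowSum in
theorem stmt_15 (r : ℕ) (hr : 5 ≤ r) (ε : ℝ) (hε : 0 < ε) :
    ∃ δ₁ : ℝ, 0 < δ₁ ∧ ∃ n₀ : ℕ, ∀ n : ℕ, n₀ ≤ n → ∀ A ⊆ Finset.Icc 1 n,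
      ((1 : ℝ) / 2 + ε) * n ≤ (A.card : ℝ) →
      (numRSF r A : ℝ) ≤ (r : ℝ) ^ (((1 : ℝ) / 2 - δ₁) * n) := by
  have hr5 : (5 : ℝ) ≤ r := by exact_mod_cast hr
  have hr0 : (0 : ℝ) < r := by linarith
  set L := Real.log r with hL
  have hgap : 0 < L - 2 * Real.log 2 := by
    rw [sub_pos, ← Real.log_rpow (by norm_num)]
    exact Real.log_lt_log (by positivity) (by norm_num; linarith)
  have hl0 : 0 < Real.log 2 := Real.log_pos (by norm_num)
  have hL0 : 0 < L := by linarith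
  set Δ := ε * (L - 2 * Real.log 2) with hΔ
  have hΔ0 : 0 < Δ := by positivity
  obtain ⟨τ, hτ0, hτ1, hτr, hτ⟩ := exists_threshold (by omega : 0 < r)
    (show 0 < Δ / 8 by positivity)
  set γ := Δ / (16 * L) with hγ
  have hγ0 : 0 < γ := by positivity
  obtain ⟨m, hm⟩ := exists_nat_ge (max 1 (24 * r / (γ ^ 2 * τ ^ 4)))
  have hm1 : (1 : ℝ) ≤ m := (le_max_left _ _).trans hm
  obtain ⟨K, hK⟩ := exists_nat_ge (8 * m * L / Δ)
  have hK0 : (0 : ℝ) < K := lt_of_lt_of_le (by positivity) hK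
  obtain ⟨N, hN⟩ := exists_nat_ge ((Real.log 2 + m * (K + 1) * L + L) / (Δ / 8))
  refine ⟨Δ / (2 * L), by positivity, max N K, fun n hn A hA hcard => ?_⟩
  have hKn : K ≤ n := (le_max_right _ _).trans hn
  have hn0 : (0 : ℝ) < n := hK0.trans_le (by exact_mod_cast hKn)
  rw [numRSF_eq_card]
  rcases eq_empty_or_nonempty (rainbowSumFree r A) with h0 | hne
  · rw [h0, card_empty, Nat.cast_zero]
    positivity
  have h1 := log_card_rainbowSumFree_le hr hγ0 hτ0 hτ1 hτr (by exact_mod_cast hn0)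
    (by exact_mod_cast hK0) hKn (by exact_mod_cast (by linarith : (0 : ℝ) < m))
    ((le_max_right _ _).trans hm) hA hcard hne
  have hΩ0 : (0 : ℝ) < #(rainbowSumFree r A) := by exact_mod_cast hne.card_pos
  rw [← Real.log_le_log_iff hΩ0 (by positivity), Real.log_rpow hr0]
  refine h1.trans ?_
  have e1 : m * (n / K) * L ≤ Δ / 8 * n := by
    rw [div_le_iff₀ hΔ0] at hK
    rw [← mul_div_assoc, div_mul_eq_mul_div, div_le_iff₀ hK0]
    nlinarith
  have e2 : Real.log 2 + m * (K + 1) * L + L ≤ Δ / 8 * n := by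
    rw [div_le_iff₀ (by positivity)] at hN
    have : (N : ℝ) ≤ n := by exact_mod_cast (le_max_left _ _).trans hn
    nlinarith
  have e3 : L * (2 * γ * n) = Δ / 8 * n := by rw [hγ]; field_simp; norm_num
  have e4 : n * (-Real.log (1 - τ) + r * τ * Real.log (r / τ)) ≤ n * (Δ / 8) := by gcongr
  have e5 : ((1 : ℝ) / 2 - Δ / (2 * L)) * n * L = n / 2 * L - Δ / 2 * n := by field_simp
  have e6 : ε * n * (L - 2 * Real.log 2) = Δ * n := by rw [hΔ]; ring
  rw [← hL, e5, e6]
  linarith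
end

section
/- For every ε > 0 there exist δ₂ = δ₂(ε) > 0 and n₀ such that for all n ≥ n₀: every A ⊆ [n] with (1/2 + ε)n ≤ |A| ≤ (1 - ε)n satisfies g(A, 4) ≤ 4^{n/2 - δ₂·n}. -/
open Finset

/-- The absolute difference of two natural numbers. -/
def absDiff (x y : ℕ) : ℕ := (x - y) + (y - x)

/-- If `B ⊆ C ⊆ A ⊆ [n]` and every `x ∈ B` has at most `t` elements of `C` at a distance lying
in `A`, then `B`, `C` and `A` cannot all be large. -/
lemma card_add_card_add_card_le {n t : ℕ} {A B C : Finset ℕ} (hBC : B ⊆ C) (hCA : C ⊆ A)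
    (hA : A ⊆ Icc 1 n) (hB : B.Nonempty)
    (h : ∀ x ∈ B, #{y ∈ C | absDiff x y ∈ A} ≤ t) :
    2 * (#B + #C + #A) ≤ 3 * n + 3 * t + 4 := by
  obtain ⟨x, hx, hxmax⟩ : ∃ x ∈ B, ∀ y ∈ B, y ≤ x := ⟨B.max' hB, B.max'_mem hB, B.le_max'⟩
  obtain ⟨m, hm, hmmin⟩ : ∃ m ∈ B, ∀ y ∈ B, m ≤ y := ⟨B.min' hB, B.min'_mem hB, B.min'_le⟩
  have hmem : ∀ a ∈ A, 1 ≤ a ∧ a ≤ n := fun a ha ↦ mem_Icc.1 (hA ha)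
  have hxn := hmem x (hCA (hBC hx))
  have hlow : #{y ∈ C | y < x} ≤ #{a ∈ A | a < x} :=
    card_le_card fun y hy ↦ by
      simp only [mem_filter] at hy ⊢
      exact ⟨hCA hy.1, hy.2⟩
  have hlow_split : #{y ∈ C | y < x} ≤ #{y ∈ C | y < x ∧ x - y ∉ A} + t := by
    refine le_trans ?_ (Nat.add_le_add_left (h x hx) _)
    refine le_trans (card_le_card fun y hy ↦ ?_) (card_union_le _ _)
    simp only [mem_filter, mem_union] at hy ⊢
    have : absDiff x y = x - y := by unfold absDiff; omega
    rw [this]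
    tauto
  have hlow_refl : #{y ∈ C | y < x ∧ x - y ∉ A} + #{a ∈ A | a < x} ≤ x - 1 := by
    have hinj : #{y ∈ C | y < x ∧ x - y ∉ A} =
        #(({y ∈ C | y < x ∧ x - y ∉ A} : Finset ℕ).image (x - ·)) := by
      refine (card_image_of_injOn fun a ha b hb hab ↦ ?_).symm
      simp only [coe_filter, Set.mem_ofPred_eq] at ha hb hab
      omega
    rw [hinj, ← card_union_of_disjoint]
    · rw [← Nat.card_Ico 1 x]
      refine card_le_card fun a ha ↦ ?_
      simp only [mem_union, mem_image, mem_filter, mem_Ico] at ha ⊢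
      rcases ha with ⟨y, ⟨hy, hyx, -⟩, rfl⟩ | ⟨ha, hax⟩
      · have := hmem y (hCA hy)
        omega
      · exact ⟨(hmem a ha).1, hax⟩
    · rw [disjoint_left]
      intro a ha ha'
      simp only [mem_image, mem_filter] at ha ha'
      obtain ⟨y, ⟨-, -, hy⟩, rfl⟩ := ha
      exact hy ha'.1
  have hhigh_split : #{y ∈ C | m < y} ≤ #{y ∈ C | m < y ∧ y - m ∉ A} + t := by
    refine le_trans ?_ (Nat.add_le_add_left (h m hm) _)
    refine le_trans (card_le_card fun y hy ↦ ?_) (card_union_le _ _)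
    simp only [mem_filter, mem_union] at hy ⊢
    have : absDiff m y = y - m := by unfold absDiff; omega
    rw [this]
    tauto
  have hhigh_shift : #{y ∈ C | m < y ∧ y - m ∉ A} + #A ≤ n := by
    have hinj : #{y ∈ C | m < y ∧ y - m ∉ A} =
        #(({y ∈ C | m < y ∧ y - m ∉ A} : Finset ℕ).image (· - m)) := by
      refine (card_image_of_injOn fun a ha b hb hab ↦ ?_).symm
      simp only [coe_filter, Set.mem_ofPred_eq] at ha hb hab
      omega
    rw [hinj, ← card_union_of_disjoint]
    · calc _ ≤ #(Icc 1 n) := card_le_card fun a ha ↦ ?_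
        _ = n := by simp
      simp only [mem_union, mem_image, mem_filter] at ha
      rcases ha with ⟨y, ⟨hy, hym, -⟩, rfl⟩ | ha
      · have := hmem y (hCA hy)
        rw [mem_Icc]
        omega
      · exact hA ha
    · rw [disjoint_left]
      intro a ha ha'
      simp only [mem_image, mem_filter] at ha
      obtain ⟨y, ⟨-, -, hy⟩, rfl⟩ := ha
      exact hy ha'
  have hhigh : #(B.erase m) + #{y ∈ C | x < y} ≤ #{y ∈ C | m < y} := by
    rw [← card_union_of_disjoint]
    · refine card_le_card fun y hy ↦ ?_
      simp only [mem_union, mem_erase, mem_filter] at hy ⊢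
      rcases hy with ⟨hym, hy⟩ | ⟨hy, hxy⟩
      · exact ⟨hBC hy, lt_of_le_of_ne (hmmin y hy) (Ne.symm hym)⟩
      · exact ⟨hy, lt_of_le_of_lt (hxmax m hm) hxy⟩
    · rw [disjoint_left]
      intro y hy hy'
      have h1 := hxmax y (mem_of_mem_erase hy)
      have h2 := (mem_filter.1 hy').2
      omega
  have hCsplit : #C ≤ #{y ∈ C | y < x} + 1 + #{y ∈ C | x < y} := by
    calc #C ≤ #(({y ∈ C | y < x} ∪ {x}) ∪ {y ∈ C | x < y} : Finset ℕ) :=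
          card_le_card fun y hy ↦ by
            simp only [mem_union, mem_filter, mem_singleton]
            rcases lt_trichotomy y x with h | h | h <;> simp [h, hy]
      _ ≤ _ := (card_union_le _ _).trans (Nat.add_le_add_right
          ((card_union_le _ _).trans (by simp)) _)
  rw [card_erase_of_mem hm] at hhigh
  omega

/-- Counting form of the graph container lemma: a family of functions whose graphs are independent
for the relation `Adj` is controlled by its members inside sets of small maximum degree. -/
lemma card_filter_le_pow_mul {α κ : Type*} [Fintype α] [DecidableEq α] [DecidableEq κ]
    (F : Finset (α → κ)) (Adj : α × κ → α × κ → Prop) [DecidableRel Adj]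
    (hF : ∀ f ∈ F, ∀ x y, ¬ Adj (x, f x) (y, f y)) {d : ℕ} {c : ℝ} (hd : 1 ≤ d) (hc : 1 ≤ c)
    (hcd : c ^ (d - 1) + 1 ≤ c ^ d) {M : ℝ} (hM0 : 0 ≤ M) (P : Finset (α × κ))
    (hM : ∀ Q ⊆ P, (∀ v ∈ Q, #{w ∈ Q | Adj v w} < d) →
      (#{f ∈ F | ∀ x, (x, f x) ∈ Q} : ℝ) ≤ M) :
    (#{f ∈ F | ∀ x, (x, f x) ∈ P} : ℝ) ≤ c ^ #P * M := by
  induction P using Finset.strongInduction with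
  | H P ih =>
    by_cases hP : ∀ v ∈ P, #{w ∈ P | Adj v w} < d
    · exact (hM P subset_rfl hP).trans (le_mul_of_one_le_left hM0 (one_le_pow₀ hc))
    · push Not at hP
      obtain ⟨v, hv, hdv⟩ := hP
      set N : Finset (α × κ) := {w ∈ P | Adj v w} with hN
      have hNP : N ⊆ P := filter_subset _ _
      have hN1 : N.Nonempty := card_pos.1 (by omega)
      have h1 := ih (P.erase v) (erase_ssubset hv)
        fun Q hQ ↦ hM Q (hQ.trans (erase_subset _ _))
      have h2 := ih (P \ N) (sdiff_ssubset hNP hN1) fun Q hQ ↦ hM Q (hQ.trans sdiff_subset)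
      have hsplit : #{f ∈ F | ∀ x, (x, f x) ∈ P} ≤
          #{f ∈ F | ∀ x, (x, f x) ∈ P.erase v} + #{f ∈ F | ∀ x, (x, f x) ∈ P \ N} := by
        refine le_trans (card_le_card fun f hf ↦ ?_) (card_union_le _ _)
        simp only [mem_union, mem_filter, mem_erase, mem_sdiff] at hf ⊢
        by_cases hfv : f v.1 = v.2
        · refine Or.inr ⟨hf.1, fun x ↦ ⟨hf.2 x, fun hx ↦ hF f hf.1 v.1 x ?_⟩⟩
          rw [hfv]
          exact (mem_filter.1 hx).2
        · refine Or.inl ⟨hf.1, fun x ↦ ⟨?_, hf.2 x⟩⟩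
          rintro rfl
          exact hfv rfl
      have hpd : d ≤ #P := hdv.trans (card_le_card hNP)
      have hc0 : 0 ≤ c := by linarith
      have e1 : c ^ #(P.erase v) = c ^ (#P - d) * c ^ (d - 1) := by
        rw [← pow_add, card_erase_of_mem hv]
        congr 1
        omega
      have e2 : c ^ #(P \ N) ≤ c ^ (#P - d) := by
        refine pow_le_pow_right₀ hc ?_
        rw [card_sdiff_of_subset hNP]
        omega
      have e3 : c ^ #P = c ^ (#P - d) * c ^ d := by
        rw [← pow_add]
        congr 1
        omega
      calc (#{f ∈ F | ∀ x, (x, f x) ∈ P} : ℝ)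
          ≤ c ^ #(P.erase v) * M + c ^ #(P \ N) * M := by
            refine le_trans ?_ (add_le_add h1 h2)
            exact_mod_cast hsplit
        _ ≤ c ^ (#P - d) * c ^ (d - 1) * M + c ^ (#P - d) * M := by
            rw [e1]
            gcongr
        _ = c ^ (#P - d) * (c ^ (d - 1) + 1) * M := by ring
        _ ≤ c ^ (#P - d) * c ^ d * M := by gcongr
        _ = c ^ #P * M := by rw [e3]

lemma card_filter_product_le {α β : Type*} (S : Finset α) (T : Finset β) (R : α → β → Prop)
    [∀ a b, Decidable (R a b)] {k : ℕ} (h : ∀ a ∈ S, #{b ∈ T | R a b} ≤ k) :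
    #{p ∈ S ×ˢ T | R p.1 p.2} ≤ #S * k := by
  rw [card_filter, sum_product, ← smul_eq_mul]
  refine sum_le_card_nsmul _ _ _ fun a ha ↦ ?_
  rw [← card_filter]
  exact h a ha

/-- Deleting vertices from a graph of maximum degree `Δ` to reach maximum degree below `d`
requires many deletions when there are many edges. -/
lemma card_edges_le {V : Type*} [DecidableEq V] (Adj : V → V → Prop) [DecidableRel Adj]
    (hsymm : ∀ v w, Adj v w → Adj w v) {P Q : Finset V} {d Δ : ℕ}
    (hd : ∀ v ∈ Q, #{w ∈ Q | Adj v w} < d) (hΔ : ∀ v, #{w ∈ P | Adj v w} ≤ Δ) :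
    #{p ∈ P ×ˢ P | Adj p.1 p.2} ≤ #Q * d + 2 * (#(P \ Q) * Δ) := by
  have h1 := card_filter_product_le Q Q Adj fun v hv ↦ (hd v hv).le
  have h2 := card_filter_product_le (P \ Q) P Adj fun v _ ↦ hΔ v
  have h3 : #{p ∈ P ×ˢ P | Adj p.1 p.2} ≤ #{p ∈ Q ×ˢ Q | Adj p.1 p.2} +
      #{p ∈ (P \ Q) ×ˢ P | Adj p.1 p.2} +
        #(({p ∈ (P \ Q) ×ˢ P | Adj p.1 p.2}).image Prod.swap) := by
    refine (card_le_card fun p hp ↦ ?_).trans ((card_union_le _ _).trans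
      (Nat.add_le_add_right (card_union_le _ _) _))
    obtain ⟨v, w⟩ := p
    simp only [mem_filter, mem_product, mem_union, mem_sdiff, mem_image, Prod.exists,
      Prod.swap_prod_mk, Prod.mk.injEq] at hp ⊢
    by_cases hv : v ∈ Q
    · by_cases hw : w ∈ Q
      · exact Or.inl (Or.inl ⟨⟨hv, hw⟩, hp.2⟩)
      · exact Or.inr ⟨w, v, ⟨⟨⟨hp.1.2, hw⟩, hp.1.1⟩, hsymm _ _ hp.2⟩, rfl, rfl⟩
    · exact Or.inl (Or.inr ⟨⟨⟨hp.1.1, hv⟩, hp.1.2⟩, hp.2⟩)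
  have h4 := card_image_le (s := {p ∈ (P \ Q) ×ˢ P | Adj p.1 p.2}) (f := Prod.swap)
  omega

lemma card_filter_absDiff_eq_le {A : Finset ℕ} (T : Finset ↥A) (y s : ℕ) :
    #{z ∈ T | absDiff y (z : ↥A) = s} ≤ 2 := by
  rw [← card_image_of_injective _ Subtype.val_injective]
  refine (card_le_card (t := {y + s, y - s}) fun a ha ↦ ?_).trans card_le_two
  simp only [mem_image, mem_filter] at ha
  obtain ⟨z, ⟨-, hz⟩, rfl⟩ := ha
  simp only [mem_insert, mem_singleton]
  unfold absDiff at hz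
  omega

section Palettes

variable {A : Finset ℕ}

/-- The palette of `x`: the colours that the template `P` allows at `x`. -/
def palette (P : Finset (↥A × Fin 4)) (x : ↥A) : Finset (Fin 4) := {c | (x, c) ∈ P}

/-- The elements with at least `i` available colours. -/
def richSet (i : ℕ) (P : Finset (↥A × Fin 4)) : Finset ↥A := {x | i ≤ #(palette P x)}

/-- The elements of `richSet 3 P` at a distance in `A` from more than `t` elements of
`richSet 2 P`. -/
def popularSet (t : ℕ) (P : Finset (↥A × Fin 4)) : Finset ↥A :=
  {x ∈ richSet 3 P | t < #{y ∈ richSet 2 P | absDiff x (y : ↥A) ∈ A}}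

lemma richSet_three_subset (P : Finset (↥A × Fin 4)) : richSet 3 P ⊆ richSet 2 P := by
  intro x hx
  simp only [richSet, mem_filter, mem_univ, true_and] at hx ⊢
  omega

lemma card_richSet_add_card_richSet_le {n t q W : ℕ} (hA : A ⊆ Icc 1 n)
    (P : Finset (↥A × Fin 4)) (hP : #(popularSet t P) ≤ q) (hW₁ : #A + q ≤ W)
    (hW₂ : 3 * n + 3 * t + 4 + 2 * q ≤ 2 * (W + #A)) :
    #(richSet 3 P) + #(richSet 2 P) ≤ W := by
  have hC : #(richSet 2 P) ≤ #A := (card_le_univ _).trans_eq (Fintype.card_coe A)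
  have hsplit := card_filter_add_card_filter_not (s := richSet 3 P)
    (fun x : ↥A ↦ t < #{y ∈ richSet 2 P | absDiff x (y : ↥A) ∈ A})
  set B : Finset ↥A := {x ∈ richSet 3 P | ¬ t < #{y ∈ richSet 2 P | absDiff x (y : ↥A) ∈ A}} with hB
  rw [popularSet] at hP
  rcases B.eq_empty_or_nonempty with h0 | hne
  · rw [h0, card_empty] at hsplit
    omega
  · have hinj : Function.Injective (Subtype.val : ↥A → ℕ) := Subtype.val_injective
    have key := card_add_card_add_card_le (t := t) (B := B.image Subtype.val)
      (C := (richSet 2 P).image Subtype.val)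
      (image_subset_image ((filter_subset _ _).trans (richSet_three_subset P)))
      (by
        intro a ha
        obtain ⟨x, -, rfl⟩ := mem_image.1 ha
        exact x.2) hA (hne.image _) ?_
    · rw [card_image_of_injective _ hinj, card_image_of_injective _ hinj] at key
      omega
    · intro a ha
      obtain ⟨x, hx, rfl⟩ := mem_image.1 ha
      rw [filter_image, card_image_of_injective _ hinj]
      exact not_lt.1 (mem_filter.1 hx).2

lemma card_filter_mem_le (F : Finset (↥A → Fin 4)) (P : Finset (↥A × Fin 4)) :
    #{f ∈ F | ∀ x, (x, f x) ∈ P} ≤ 2 ^ (#(richSet 3 P) + #(richSet 2 P)) := by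
  calc #{f ∈ F | ∀ x, (x, f x) ∈ P} ≤ #(Fintype.piFinset (palette P)) :=
        card_le_card fun f hf ↦ by
          simpa [palette] using (mem_filter.1 hf).2
    _ = ∏ x, #(palette P x) := Fintype.card_piFinset _
    _ ≤ ∏ x : ↥A, 2 ^ ((if 3 ≤ #(palette P x) then 1 else 0) +
          (if 2 ≤ #(palette P x) then 1 else 0)) := by
        refine prod_le_prod' fun x _ ↦ ?_
        have h4 : #(palette P x) ≤ 4 := (card_le_univ _).trans_eq (Fintype.card_fin 4)
        interval_cases #(palette P x) <;> simp
    _ = _ := by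
        rw [prod_pow_eq_pow_sum, sum_add_distrib, ← card_filter, ← card_filter]
        rfl

lemma exists_colors_ne {P : Finset (↥A × Fin 4)} {x y : ↥A} (hx : x ∈ richSet 3 P)
    (hy : y ∈ richSet 2 P) (a : Fin 4) :
    ∃ b c, (x, b) ∈ P ∧ (y, c) ∈ P ∧ a ≠ b ∧ a ≠ c ∧ b ≠ c := by
  simp only [richSet, mem_filter, mem_univ, true_and] at hx hy
  obtain ⟨c, hc, hca⟩ := exists_mem_ne (by omega : 1 < #(palette P y)) a
  have h1 : 0 < #(((palette P x).erase a).erase c) := by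
    have := pred_card_le_card_erase (s := palette P x) (a := a)
    have := pred_card_le_card_erase (s := (palette P x).erase a) (a := c)
    omega
  obtain ⟨b, hb⟩ := card_pos.1 h1
  simp only [mem_erase, palette, mem_filter, mem_univ, true_and] at hb hc
  exact ⟨b, c, hb.2.2, hc, hb.2.1.symm, hca.symm, hb.1⟩

/-- The pairs of `richSet 3 P × richSet 2 P` at distance `s`. -/
def pairsAt (P : Finset (↥A × Fin 4)) (s : ℕ) : Finset (↥A × ↥A) :=
  {p ∈ richSet 3 P ×ˢ richSet 2 P | absDiff p.1 p.2 = s}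

lemma sum_card_pairsAt (P : Finset (↥A × Fin 4)) (S : Finset ↥A) :
    ∑ s ∈ S, #(pairsAt P s) =
      #{p ∈ richSet 3 P ×ˢ richSet 2 P | ∃ s ∈ S, absDiff p.1 p.2 = ↑s} := by
  rw [← card_biUnion]
  · congr 1
    ext p
    simp only [pairsAt, mem_biUnion, mem_filter]
    tauto
  · intro s _ s' _ hss
    rw [Function.onFun, disjoint_left]
    intro p hp hp'
    exact hss (Subtype.ext ((mem_filter.1 hp).2.symm.trans (mem_filter.1 hp').2))

lemma card_pairsAt_le {n : ℕ} (hA : #A ≤ n) (P : Finset (↥A × Fin 4)) (s : ℕ) :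
    #(pairsAt P s) ≤ 2 * n := by
  have h := card_filter_product_le (richSet 3 P) (richSet 2 P)
    (fun x y : ↥A ↦ absDiff x y = s) (k := 2) fun x _ ↦ card_filter_absDiff_eq_le _ _ _
  have hB : #(richSet 3 P) ≤ #A := (card_le_univ _).trans_eq (Fintype.card_coe A)
  exact h.trans (by omega)

lemma exists_popular_distances {n q t h k : ℕ} (hA : #A ≤ n) (P : Finset (↥A × Fin 4))
    (hP : q < #(popularSet t P)) (hqt : 2 * n * k + n * h < q * t) :
    ∃ S : Finset ↥A, #S = k ∧ ∀ s ∈ S, h ≤ #(pairsAt P s) := by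
  suffices hk : k ≤ #({s | h ≤ #(pairsAt P s)} : Finset ↥A) by
    obtain ⟨S, hS, hSk⟩ := exists_subset_card_eq hk
    exact ⟨S, hSk, fun s hs ↦ (mem_filter.1 (hS hs)).2⟩
  by_contra! hk
  have hlow : q * t ≤ ∑ s : ↥A, #(pairsAt P s) := by
    calc q * t ≤ #(popularSet t P) • t := Nat.mul_le_mul_right _ hP.le
      _ ≤ ∑ x ∈ popularSet t P, #{y ∈ richSet 2 P | absDiff x (y : ↥A) ∈ A} :=
          card_nsmul_le_sum _ _ _ fun x hx ↦ (mem_filter.1 hx).2.le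
      _ ≤ ∑ x ∈ richSet 3 P, #{y ∈ richSet 2 P | absDiff x (y : ↥A) ∈ A} :=
          sum_le_sum_of_subset (filter_subset _ _)
      _ = #{p ∈ richSet 3 P ×ˢ richSet 2 P | absDiff p.1 p.2 ∈ A} := by
          rw [card_filter, sum_product]
          simp only [card_filter]
      _ = ∑ s : ↥A, #(pairsAt P s) := by
          rw [sum_card_pairsAt]
          congr 1
          ext p
          simp
  have hup : ∑ s : ↥A, #(pairsAt P s) ≤ 2 * n * k + n * h := by
    rw [← sum_filter_add_sum_filter_not univ (fun s : ↥A ↦ h ≤ #(pairsAt P s))]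
    refine add_le_add ?_ ?_
    · refine (sum_le_card_nsmul _ _ (2 * n) fun s _ ↦ card_pairsAt_le hA P _).trans ?_
      rw [smul_eq_mul, mul_comm]
      exact Nat.mul_le_mul_left _ hk.le
    · refine (sum_le_card_nsmul _ _ h fun s hs ↦ (not_le.1 (mem_filter.1 hs).2).le).trans ?_
      exact Nat.mul_le_mul_right _ (((card_le_univ _).trans_eq (Fintype.card_coe A)).trans hA)
  omega

/-- The conflict relation between coloured elements that is forced by a colouring `φ` of `S`. -/
def Conflict (S : Finset ↥A) (φ : ↥S → Fin 4) (v w : ↥A × Fin 4) : Prop :=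
  ∃ s : ↥S, absDiff v.1 w.1 = ((s : ↥A) : ℕ) ∧ φ s ≠ v.2 ∧ φ s ≠ w.2 ∧ v.2 ≠ w.2

lemma Conflict.symm {S : Finset ↥A} {φ : ↥S → Fin 4} {v w : ↥A × Fin 4}
    (h : Conflict S φ v w) : Conflict S φ w v := by
  obtain ⟨s, hs, h1, h2, h3⟩ := h
  exact ⟨s, by rw [← hs, absDiff, absDiff, add_comm], h2, h1, h3.symm⟩

open Classical in
lemma card_filter_conflict_le (S : Finset ↥A) (φ : ↥S → Fin 4) (P : Finset (↥A × Fin 4))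
    (v : ↥A × Fin 4) : #{w ∈ P | Conflict S φ v w} ≤ 8 * #S := by
  calc #{w ∈ P | Conflict S φ v w}
      ≤ #(S.biUnion fun s ↦ ({z | absDiff v.1 z = s} : Finset ↥A) ×ˢ (univ : Finset (Fin 4))) := by
        refine card_le_card fun w hw ↦ ?_
        obtain ⟨-, s, hs, -⟩ := mem_filter.1 hw
        simp only [mem_biUnion, mem_product, mem_filter, mem_univ, true_and, and_true]
        exact ⟨s, s.2, hs⟩
    _ ≤ #S * 8 := by
        refine card_biUnion_le_card_mul _ _ _ fun s _ ↦ ?_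
        rw [card_product, card_univ, Fintype.card_fin]
        have := card_filter_absDiff_eq_le (A := A) univ v.1 s
        omega
    _ = 8 * #S := mul_comm _ _

open Classical in
lemma mul_le_card_conflict {h : ℕ} (S : Finset ↥A) (φ : ↥S → Fin 4)
    (P : Finset (↥A × Fin 4)) (hS : ∀ s ∈ S, h ≤ #(pairsAt P s)) :
    #S * h ≤ #{p ∈ P ×ˢ P | Conflict S φ p.1 p.2} := by
  calc #S * h ≤ ∑ s ∈ S, #(pairsAt P s) := card_nsmul_le_sum _ _ _ hS
    _ = #{p ∈ richSet 3 P ×ˢ richSet 2 P | ∃ s ∈ S, absDiff p.1 p.2 = ↑s} :=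
        sum_card_pairsAt P S
    _ ≤ #(({p ∈ P ×ˢ P | Conflict S φ p.1 p.2}).image fun p ↦ (p.1.1, p.2.1)) := by
        refine card_le_card fun p hp ↦ ?_
        simp only [mem_filter, mem_product] at hp
        obtain ⟨⟨hx, hy⟩, s, hs, hps⟩ := hp
        obtain ⟨b, c, hb, hc, h1, h2, h3⟩ := exists_colors_ne hx hy (φ ⟨s, hs⟩)
        refine mem_image.2 ⟨((p.1, b), (p.2, c)), mem_filter.2 ⟨mem_product.2 ⟨hb, hc⟩, ?_⟩, rfl⟩
        exact ⟨⟨s, hs⟩, hps, h1, h2, h3⟩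
    _ ≤ _ := card_image_le

/-- The rainbow sum-free `4`-colourings of `A`. -/
noncomputable def rainbowFree (A : Finset ℕ) : Finset (↥A → Fin 4) := by
  classical
  exact {f | ∀ x y z : ↥A, (x : ℕ) + (y : ℕ) = (z : ℕ) → ¬(f x ≠ f y ∧ f x ≠ f z ∧ f y ≠ f z)}

lemma numRSF_four (A : Finset ℕ) : numRSF 4 A = #(rainbowFree A) := by
  classical
  rw [numRSF, rainbowFree, Nat.card_eq_fintype_card, Fintype.card_subtype]

lemma not_conflict_of_mem_rainbowFree {f : ↥A → Fin 4} (hf : f ∈ rainbowFree A)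
    (S : Finset ↥A) (x y : ↥A) : ¬ Conflict S (fun s ↦ f s) (x, f x) (y, f y) := by
  rintro ⟨s, hs, h1, h2, h3⟩
  simp only [rainbowFree, mem_filter, mem_univ, true_and] at hf
  simp only [absDiff] at hs h1 h2 h3
  rcases le_total (x : ℕ) y with hxy | hxy
  · exact hf s x y (by omega) ⟨h1, h2, h3⟩
  · exact hf s y x (by omega) ⟨h2, h1, h3.symm⟩

/-- If many elements are popular for `P`, then the colourings inside `P` are controlled by those
inside noticeably smaller templates. -/
lemma card_rainbowFree_filter_le_of_popular {n q t h k d r : ℕ} {c M : ℝ} (hA : #A ≤ n)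
    (P : Finset (↥A × Fin 4)) (hP : q < #(popularSet t P))
    (hqt : 2 * n * k + n * h < q * t) (hd : 1 ≤ d) (hdk : 8 * n * d ≤ k * h) (hk : 1 ≤ k)
    (hr : 32 * r ≤ h) (hc : 1 ≤ c) (hcd : c ^ (d - 1) + 1 ≤ c ^ d) (hM0 : 0 ≤ M)
    (hM : ∀ Q ⊆ P, #Q + r ≤ #P → (#{f ∈ rainbowFree A | ∀ x, (x, f x) ∈ Q} : ℝ) ≤ M) :
    (#{f ∈ rainbowFree A | ∀ x, (x, f x) ∈ P} : ℝ) ≤ 4 ^ k * c ^ (4 * n) * M := by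
  classical
  obtain ⟨S, hSk, hS⟩ := exists_popular_distances hA P hP hqt
  have hcardP : #P ≤ 4 * n := by
    refine (card_le_univ P).trans ?_
    rw [Fintype.card_prod, Fintype.card_coe, Fintype.card_fin]
    omega
  have hfib : ∀ φ : ↥S → Fin 4,
      (#{f ∈ {f ∈ rainbowFree A | ∀ x, (x, f x) ∈ P} | (fun s : ↥S ↦ f (s : ↥A)) = φ} : ℝ)
        ≤ c ^ (4 * n) * M := by
    intro φ
    have key := card_filter_le_pow_mul {f ∈ rainbowFree A | (fun s : ↥S ↦ f (s : ↥A)) = φ}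
      (Conflict S φ) (fun f hf x y ↦ by
        rw [← (mem_filter.1 hf).2]
        exact not_conflict_of_mem_rainbowFree (mem_filter.1 hf).1 S x y) hd hc hcd hM0 P ?_
    · rw [filter_filter] at key ⊢
      simp only [and_comm] at key ⊢
      refine key.trans ?_
      gcongr
    · intro Q hQP hQ
      refine le_trans ?_ (hM Q hQP ?_)
      · exact_mod_cast card_le_card (filter_subset_filter _ (filter_subset _ _))
      · have h1 := mul_le_card_conflict S φ P hS
        have h2 := card_edges_le (Conflict S φ) (fun _ _ ↦ Conflict.symm) hQ
          (card_filter_conflict_le S φ P)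
        rw [hSk] at h1 h2
        have h3 : #Q * d ≤ 4 * n * d :=
          Nat.mul_le_mul_right _ ((card_le_card hQP).trans hcardP)
        have h4 : k * h ≤ k * (32 * #(P \ Q)) := by linarith
        have h5 := Nat.le_of_mul_le_mul_left h4 hk
        rw [card_sdiff_of_subset hQP] at h5
        have := card_le_card hQP
        omega
  rw [card_eq_sum_card_fiberwise (f := fun f (s : ↥S) ↦ f (s : ↥A)) (t := univ) (by simp), Nat.cast_sum]
  refine (sum_le_card_nsmul univ _ (c ^ (4 * n) * M) fun φ _ ↦ hfib φ).trans_eq ?_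
  rw [card_univ, Fintype.card_fun, Fintype.card_fin, Fintype.card_coe, hSk, nsmul_eq_mul]
  push_cast
  ring

lemma card_rainbowFree_filter_le {n q t h k d r W : ℕ} {c : ℝ} (hA : A ⊆ Icc 1 n)
    (hqt : 2 * n * k + n * h < q * t) (hd : 1 ≤ d) (hdk : 8 * n * d ≤ k * h) (hk : 1 ≤ k)
    (hr : 32 * r ≤ h) (hc : 1 ≤ c) (hcd : c ^ (d - 1) + 1 ≤ c ^ d) (hW₁ : #A + q ≤ W)
    (hW₂ : 3 * n + 3 * t + 4 + 2 * q ≤ 2 * (W + #A)) (j : ℕ) (P : Finset (↥A × Fin 4))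
    (hj : #P ≤ j * r) :
    (#{f ∈ rainbowFree A | ∀ x, (x, f x) ∈ P} : ℝ) ≤ (4 ^ k * c ^ (4 * n)) ^ j * 2 ^ W := by
  have hAn : #A ≤ n := (card_le_card hA).trans_eq (by simp)
  have h1 : 1 ≤ (4 : ℝ) ^ k * c ^ (4 * n) :=
    one_le_mul_of_one_le_of_one_le (one_le_pow₀ (by norm_num)) (one_le_pow₀ hc)
  induction j generalizing P with
  | zero =>
    have hP0 : P = ∅ := by simpa using hj
    have hpop : #(popularSet t P) ≤ q := by simp [hP0, popularSet, richSet, palette]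
    have h2 := card_richSet_add_card_richSet_le hA P hpop hW₁ hW₂
    have h3 := (card_filter_mem_le (rainbowFree A) P).trans (Nat.pow_le_pow_right two_pos h2)
    rw [pow_zero, one_mul]
    exact_mod_cast h3
  | succ j ih =>
    rcases le_or_gt #(popularSet t P) q with hpop | hpop
    · have h2 := card_richSet_add_card_richSet_le hA P hpop hW₁ hW₂
      have h3 := (card_filter_mem_le (rainbowFree A) P).trans (Nat.pow_le_pow_right two_pos h2)
      refine le_trans ?_ (le_mul_of_one_le_left (by positivity) (one_le_pow₀ h1))
      exact_mod_cast h3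
    · rw [pow_succ', mul_assoc]
      refine card_rainbowFree_filter_le_of_popular hAn P hpop hqt hd hdk hk hr hc hcd
        (by positivity) fun Q _ hQ ↦ ih Q ?_
      rw [add_mul, one_mul] at hj
      omega

end Palettes

lemma exists_pow_pred_add_one_le {c : ℝ} (hc : 1 < c) :
    ∃ d : ℕ, 1 ≤ d ∧ c ^ (d - 1) + 1 ≤ c ^ d := by
  obtain ⟨m, hm⟩ := pow_unbounded_of_one_lt (1 / (c - 1)) hc
  refine ⟨m + 1, by omega, ?_⟩
  rw [div_lt_iff₀ (by linarith)] at hm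
  rw [Nat.add_sub_cancel, pow_succ]
  linarith

theorem stmt_16 (ε : ℝ) (hε : 0 < ε) :
    ∃ δ₂ : ℝ, 0 < δ₂ ∧ ∃ n₀ : ℕ, ∀ n : ℕ, n₀ ≤ n → ∀ A ⊆ Finset.Icc 1 n,
      ((1 : ℝ) / 2 + ε) * n ≤ (A.card : ℝ) → (A.card : ℝ) ≤ (1 - ε) * n →
      (numRSF 4 A : ℝ) ≤ (4 : ℝ) ^ ((n : ℝ) / 2 - δ₂ * n) := by
  obtain ⟨η, hη⟩ : ∃ η : ℝ, η = ε ^ 2 / 200 := ⟨_, rfl⟩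
  have hη0 : 0 < η := by rw [hη]; positivity
  obtain ⟨j, hj⟩ := exists_nat_ge (256 / η)
  have hj0 : (0 : ℝ) < j := lt_of_lt_of_le (by positivity) hj
  obtain ⟨c, hc⟩ : ∃ c : ℝ, c = 2 ^ (ε / (32 * j)) := ⟨_, rfl⟩
  have hc1 : 1 < c := by
    rw [hc]
    exact Real.one_lt_rpow (by norm_num) (by positivity)
  obtain ⟨d, hd1, hd⟩ := exists_pow_pred_add_one_le hc1
  have hd0 : (0 : ℝ) < d := by exact_mod_cast hd1
  obtain ⟨k, hk⟩ := exists_nat_ge (16 * d / η)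
  have hk0 : (0 : ℝ) < k := lt_of_lt_of_le (by positivity) hk
  obtain ⟨n₁, hn₁⟩ := exists_nat_ge (66 / η)
  obtain ⟨n₂, hn₂⟩ := exists_nat_gt ((400 * k + 40 * ε) / ε ^ 2)
  obtain ⟨n₃, hn₃⟩ := exists_nat_ge (16 * k * j / ε)
  refine ⟨ε / 8, by positivity, n₁ + n₂ + n₃ + 1, fun n hn A hA hlo hhi ↦ ?_⟩
  have hnR : (n₁ : ℝ) + n₂ + n₃ + 1 ≤ n := by exact_mod_cast hn
  have hn0 : (0 : ℝ) < n := lt_of_lt_of_le (by positivity) hnR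
  have hpos₁ : (0 : ℝ) ≤ n₁ := n₁.cast_nonneg
  have hpos₂ : (0 : ℝ) ≤ n₂ := n₂.cast_nonneg
  have hpos₃ : (0 : ℝ) ≤ n₃ := n₃.cast_nonneg
  have hn₁' : 66 ≤ n * η := (div_le_iff₀ hη0).1 (hn₁.trans (by linarith))
  have hn₂' : 400 * k + 40 * ε < n * ε ^ 2 :=
    (div_lt_iff₀ (by positivity)).1 (hn₂.trans_le (by linarith))
  have hn₃' : 16 * k * j ≤ n * ε :=
    (div_le_iff₀ hε).1 (hn₃.trans (by linarith))
  have hεn : 40 ≤ n * ε := by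
    by_contra! h
    nlinarith
  have hε4 : ε ≤ 1 / 4 := by
    by_contra! h
    nlinarith
  obtain ⟨h, hh⟩ : ∃ h : ℕ, h = ⌊n * η⌋₊ := ⟨_, rfl⟩
  obtain ⟨q, hq⟩ : ∃ q : ℕ, q = ⌊n * ε / 10⌋₊ := ⟨_, rfl⟩
  obtain ⟨W, hW⟩ : ∃ W : ℕ, W = ⌊(1 - ε / 2) * n⌋₊ := ⟨_, rfl⟩
  have hh1 : (h : ℝ) ≤ n * η := hh ▸ Nat.floor_le (by positivity)
  have hh2 : n * η < h + 1 := hh ▸ Nat.lt_floor_add_one _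
  have hq1 : (q : ℝ) ≤ n * ε / 10 := hq ▸ Nat.floor_le (by positivity)
  have hq2 : n * ε / 10 < q + 1 := hq ▸ Nat.lt_floor_add_one _
  have hW1 : (W : ℝ) ≤ (1 - ε / 2) * n :=
    hW ▸ Nat.floor_le (mul_nonneg (by linarith) hn0.le)
  have hW2 : (1 - ε / 2) * n < W + 1 := hW ▸ Nat.lt_floor_add_one _
  have hr : h < 32 * (h / 32) + 32 := by omega
  have hrR : (h : ℝ) < 32 * (h / 32 : ℕ) + 32 := by exact_mod_cast hr
  have hqt : 2 * n * k + n * h < q * q := by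
    have h1 : (n * ε / 10 - 1) ^ 2 < (q : ℝ) * q := by
      rw [← sq]
      exact pow_lt_pow_left₀ (by linarith) (by linarith) two_ne_zero
    have h2 : 2 * n * k + n * h ≤ (n * ε / 10 - 1) ^ 2 := by
      have h3 : (n : ℝ) * h ≤ n * (n * η) := by gcongr
      have h4 : (n : ℝ) * (400 * k + 40 * ε) ≤ n * (n * ε ^ 2) := by gcongr
      rw [hη] at h3
      linarith
    exact_mod_cast h2.trans_lt h1
  have hdk : 8 * n * d ≤ k * h := by
    have h1 : 16 * d ≤ k * η := (div_le_iff₀ hη0).1 hk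
    have h2 : n * η ≤ 2 * h := by linarith
    have h3 : (k : ℝ) * (n * η) ≤ k * (2 * h) := by gcongr
    have h4 : (n : ℝ) * (16 * d) ≤ n * (k * η) := by gcongr
    have h5 : (8 : ℝ) * n * d ≤ k * h := by linarith
    exact_mod_cast h5
  have hW₁ : #A + q ≤ W := by
    have : (#A : ℝ) + q < W + 1 := by linarith
    have : #A + q < W + 1 := by exact_mod_cast this
    omega
  have hW₂ : 3 * n + 3 * q + 4 + 2 * q ≤ 2 * (W + #A) := by
    have : (3 : ℝ) * n + 3 * q + 4 + 2 * q ≤ 2 * (W + #A) := by linarith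
    exact_mod_cast this
  have hcard : #(univ : Finset (↥A × Fin 4)) ≤ j * (h / 32) := by
    have hAn : #A ≤ n := (card_le_card hA).trans_eq (by simp)
    have h1 : 256 ≤ j * η := (div_le_iff₀ hη0).1 hj
    have h2 : n * η ≤ 64 * (h / 32 : ℕ) := by linarith
    have h3 : (j : ℝ) * (n * η) ≤ j * (64 * (h / 32 : ℕ)) := by gcongr
    have h4 : (n : ℝ) * 256 ≤ n * (j * η) := by gcongr
    have h5 : (4 : ℝ) * n ≤ j * (h / 32 : ℕ) := by linarith
    have h6 : 4 * n ≤ j * (h / 32) := by exact_mod_cast h5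
    rw [card_univ, Fintype.card_prod, Fintype.card_coe, Fintype.card_fin]
    omega
  have key := card_rainbowFree_filter_le (W := W) hA hqt hd1 hdk (by exact_mod_cast hk0)
    (Nat.mul_div_le h 32) hc1.le hd hW₁ hW₂ j univ hcard
  simp only [mem_univ, implies_true, filter_true] at key
  rw [numRSF_four]
  refine key.trans ?_
  have e1 : ((4 : ℝ) ^ k * c ^ (4 * n)) ^ j * 2 ^ W =
      2 ^ ((2 * k * j : ℝ) + ε * n / 8 + W) := by
    rw [Real.rpow_add two_pos, Real.rpow_add two_pos, Real.rpow_natCast, mul_pow, ← pow_mul,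
      ← pow_mul]
    congr 2
    · rw [show (4 : ℝ) = 2 ^ 2 by norm_num, ← pow_mul, ← Real.rpow_natCast]
      push_cast
      congr 1
      ring
    · rw [hc, ← Real.rpow_natCast, ← Real.rpow_mul two_pos.le]
      congr 1
      push_cast
      field_simp
      ring
  have e2 : (4 : ℝ) ^ ((n : ℝ) / 2 - ε / 8 * n) = 2 ^ (n - ε * n / 4) := by
    rw [show (4 : ℝ) = 2 ^ (2 : ℝ) by norm_num, ← Real.rpow_mul two_pos.le]
    congr 1
    ring
  rw [e1, e2]
  refine Real.rpow_le_rpow_of_exponent_le one_le_two ?_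
  linarith
end
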